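/- arXiv:1203.6561 — 9 statements merged into one kernel-verified Lean document; each statement's English description precedes it below -/
import Mathlib

section
/- Periodic Laman theorem on the fixed torus (existential form). Let ⟨G,m⟩ be a gain graph with V nonempty and |E| = 2|V| − 2. Then there exists a realization p : V → ℝ² for which the edges of (⟨G,m⟩, p) are independent (i.e. ⟨G,m⟩ is minimally rigid on the fixed two-dimensional torus for some realization) if and only if (i) every subgraph (V',E') with V' nonempty satisfies |E'| ≤ 2|V'| − 2, and (ii) m is constructive. -/
open Finset

namespace PeriodicRigidity

/-- Cast an integer gain vector to a vector of `ℝ × ℝ`. -/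
def zcast (z : ℤ × ℤ) : ℝ × ℝ := ((z.1 : ℝ), (z.2 : ℝ))

variable {V E : Type*}

/-- The rigidity row of the edge `e` of the gain graph `(t, h, m)` at the realization `p`:
its value at a vertex `v` is `d_e` if `v = t e ≠ h e`, `-d_e` if `v = h e ≠ t e`, and `0`
otherwise, where `d_e = p (t e) - p (h e) - m e`. -/
def row [DecidableEq V] (t h : E → V) (m : E → ℤ × ℤ) (p : V → ℝ × ℝ) (e : E) :
    V → ℝ × ℝ := fun v =>
  if t e = h e then 0
  else if v = t e then p (t e) - p (h e) - zcast (m e)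
  else if v = h e then -(p (t e) - p (h e) - zcast (m e))
  else 0

/-- The edges of the framework `((t, h, m), p)` are independent. -/
def Indep [DecidableEq V] (t h : E → V) (m : E → ℤ × ℤ) (p : V → ℝ × ℝ) : Prop :=
  LinearIndependent ℝ (row t h m p)

/-- `(V', E')` is a subgraph of the gain graph with tail map `t` and head map `h`. -/
def IsSubgraph (t h : E → V) (V' : Finset V) (E' : Finset E) : Prop :=
  ∀ e ∈ E', t e ∈ V' ∧ h e ∈ V'

/-- A set of edges is balanced if the gains are given by a potential on the vertices. -/
def Balanced (t h : E → V) (m : E → ℤ × ℤ) (E' : Finset E) : Prop :=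
  ∃ φ : V → ℤ × ℤ, ∀ e ∈ E', m e = φ (h e) - φ (t e)

/-- The gain assignment `m` is constructive: no subgraph `(V', E')` with `|V'| ≥ 2` and
`|E'| = 2 |V'| - 2` is balanced. -/
def Constructive (t h : E → V) (m : E → ℤ × ℤ) : Prop :=
  ∀ (V' : Finset V) (E' : Finset E), IsSubgraph t h V' E' → 2 ≤ V'.card →
    (E'.card : ℤ) = 2 * V'.card - 2 → ¬ Balanced t h m E'

/-- Relative version of `Constructive`, for the graph `(VS, ES)` inside an ambient graph. -/
def ConstructiveOn (t h : E → V) (m : E → ℤ × ℤ) (VS : Finset V) (ES : Finset E) : Prop :=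
  ∀ (V' : Finset V) (E' : Finset E), V' ⊆ VS → E' ⊆ ES → IsSubgraph t h V' E' →
    2 ≤ V'.card → (E'.card : ℤ) = 2 * V'.card - 2 → ¬ Balanced t h m E'

/-- The edge `e` is, up to reversal, an edge from `u` to `v` with gain `g`. -/
def EdgeIs (t h : E → V) (m : E → ℤ × ℤ) (e : E) (u v : V) (g : ℤ × ℤ) : Prop :=
  (t e = u ∧ h e = v ∧ m e = g) ∨ (t e = v ∧ h e = u ∧ m e = -g)

open Module

/-- A finite linearly independent family of functionals attains every tuple of values. -/
theorem exists_forall_apply_eq_of_linearIndependent {K W ι : Type*} [Field K] [AddCommGroup W]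
    [Module K W] [Finite ι] {F : ι → Dual K W} (hF : LinearIndependent K F) (b : ι → K) :
    ∃ x, ∀ i, F i x = b i := by
  have hF' : LinearIndependent K (fun i => (F i : W → K)) :=
    hF.map' (LinearMap.ltoFun K W K K) (LinearMap.ker_eq_bot.2 DFunLike.coe_injective)
  have hspan := span_flip_eq_top_iff_linearIndependent.2 hF'
  have hle : Submodule.span K (Set.range (flip fun i => (F i : W → K))) ≤
      LinearMap.range (LinearMap.pi F) := by
    rw [Submodule.span_le]
    rintro _ ⟨x, rfl⟩
    exact ⟨x, rfl⟩
  rw [hspan] at hle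
  obtain ⟨x, hx⟩ := hle (Submodule.mem_top (x := b))
  exact ⟨x, fun i => congrFun hx i⟩

/-- A subspace of dimension at least two is the sup of two proper subspaces. -/
theorem exists_lt_lt_sup_eq {K W : Type*} [Field K] [AddCommGroup W] [Module K W]
    [FiniteDimensional K W] (S : Submodule K W) (hS : 1 < finrank K S) :
    ∃ A B : Submodule K W, A < S ∧ B < S ∧ A ⊔ B = S := by
  have hne : S ≠ ⊥ := by
    rintro rfl
    simp at hS
  obtain ⟨x, hx, hx0⟩ := S.exists_mem_ne_zero_of_ne_bot hne
  obtain ⟨C, hC⟩ := Submodule.exists_isCompl (K ∙ x)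
  have hxS : K ∙ x ≤ S := (Submodule.span_singleton_le_iff_mem _ _).2 hx
  refine ⟨C ⊓ S, K ∙ x, inf_le_right.lt_of_ne fun h => ?_, hxS.lt_of_ne fun h => ?_, ?_⟩
  · have hxC : x ∈ C := inf_eq_right.1 h hx
    exact hx0 (Submodule.disjoint_def.1 hC.disjoint x (Submodule.mem_span_singleton_self x) hxC)
  · rw [← h, finrank_span_singleton hx0] at hS
    exact hS.false
  · rw [sup_comm, ← sup_inf_assoc_of_le C hxS, hC.sup_eq_top, top_inf_eq]

/-- **Rado's theorem** for finite families of subspaces: a linearly independent system of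
representatives exists as soon as any `k` of the subspaces span a space of dimension at least
`k`. -/
theorem exists_linearIndependent_mem {K W ι : Type*} [Field K] [AddCommGroup W] [Module K W]
    [FiniteDimensional K W] [Fintype ι] (U : ι → Submodule K W)
    (hU : ∀ J : Finset ι, J.card ≤ finrank K (J.sup U : Submodule K W)) :
    ∃ u : ι → W, (∀ i, u i ∈ U i) ∧ LinearIndependent K u := by
  classical
  induction hN : ∑ i, finrank K (U i) using Nat.strong_induction_on generalizing U with
  | _ N ih =>
  subst hN
  by_cases hone : ∀ i, finrank K (U i) ≤ 1
  · have hgen : ∀ i, ∃ v ∈ U i, U i ≤ K ∙ v := by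
      intro i
      obtain ⟨v, hv⟩ := finrank_le_one_iff.1 (hone i)
      refine ⟨v, v.2, fun w hw => ?_⟩
      obtain ⟨c, hc⟩ := hv ⟨w, hw⟩
      exact Submodule.mem_span_singleton.2 ⟨c, congrArg Subtype.val hc⟩
    choose u hu hspan using hgen
    refine ⟨u, hu, linearIndependent_iff_card_le_finrank_span.2 ?_⟩
    refine (hU univ).trans (Submodule.finrank_mono (Finset.sup_le fun i _ => ?_))
    exact (hspan i).trans (Submodule.span_mono (by simp))
  · push Not at hone
    obtain ⟨i, hi⟩ := hone
    obtain ⟨A, B, hA, hB, hAB⟩ := exists_lt_lt_sup_eq (U i) hi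
    have hshrink : ∀ S : Submodule K W, S < U i →
        (∀ J : Finset ι, J.card ≤ finrank K (J.sup (Function.update U i S) : Submodule K W)) →
        ∃ u : ι → W, (∀ i, u i ∈ U i) ∧ LinearIndependent K u := by
      intro S hS hJ
      have hle : ∀ j, Function.update U i S j ≤ U j := by
        intro j
        by_cases hj : j = i
        · subst hj
          simpa using hS.le
        · simp [hj]
      obtain ⟨u, hu, hli⟩ := ih _ (Finset.sum_lt_sum
        (fun j _ => Submodule.finrank_mono (hle j)) ⟨i, mem_univ i, by
          rw [Function.update_self]
          exact Submodule.finrank_lt_finrank_of_lt hS⟩) _ hJ rfl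
      exact ⟨u, fun j => hle j (hu j), hli⟩
    by_contra hcon
    have hviol : ∀ S : Submodule K W, S < U i → ∃ J : Finset ι, i ∉ J ∧
        finrank K (S ⊔ J.sup U : Submodule K W) ≤ J.card := by
      intro S hS
      by_contra! hno
      refine hcon (hshrink S hS fun J => ?_)
      have hoff : ∀ J' : Finset ι, i ∉ J' → J'.sup (Function.update U i S) = J'.sup U :=
        fun J' hJ' => Finset.sup_congr rfl fun j hj =>
          Function.update_of_ne (by rintro rfl; exact hJ' hj) _ _
      by_cases hiJ : i ∈ J
      · have := hno (J.erase i) (notMem_erase i J)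
        rw [← Finset.insert_erase hiJ, Finset.sup_insert, Function.update_self,
          hoff _ (notMem_erase i J), card_insert_of_notMem (notMem_erase i J)]
        exact this
      · rw [hoff J hiJ]
        exact hU J
    obtain ⟨J₁, hi₁, h₁⟩ := hviol A hA
    obtain ⟨J₂, hi₂, h₂⟩ := hviol B hB
    have hdim := Submodule.finrank_sup_add_finrank_inf_eq (A ⊔ J₁.sup U) (B ⊔ J₂.sup U)
    have hsup : (A ⊔ J₁.sup U) ⊔ (B ⊔ J₂.sup U) = (insert i (J₁ ∪ J₂)).sup U := by
      rw [Finset.sup_insert, Finset.sup_union, sup_sup_sup_comm, hAB]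
    have hinf : (J₁ ∩ J₂).sup U ≤ (A ⊔ J₁.sup U) ⊓ (B ⊔ J₂.sup U) :=
      le_inf ((Finset.sup_mono inter_subset_left).trans le_sup_right)
        ((Finset.sup_mono inter_subset_right).trans le_sup_right)
    have hu₁ := hU (insert i (J₁ ∪ J₂))
    have hu₂ := (hU (J₁ ∩ J₂)).trans (Submodule.finrank_mono hinf)
    rw [← hsup, card_insert_of_notMem (by simp [hi₁, hi₂])] at hu₁
    have := card_union_add_card_inter J₁ J₂
    omega

/-- The linear form `x ↦ n · (x (t e) - x (h e))` attached to the edge `e` and the vector `n`. -/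
def edgeForm (t h : E → V) (e : E) : ℝ × ℝ →ₗ[ℝ] Dual ℝ (V → ℝ × ℝ) :=
  LinearMap.mk₂ ℝ
    (fun n x => n.1 * (x (t e) - x (h e)).1 + n.2 * (x (t e) - x (h e)).2)
    (fun _ _ _ => by simp; ring) (fun _ _ _ => by simp; ring)
    (fun _ _ _ => by simp; ring) (fun _ _ _ => by simp; ring)

theorem edgeForm_apply (t h : E → V) (e : E) (n : ℝ × ℝ) (x : V → ℝ × ℝ) :
    edgeForm t h e n x = n.1 * (x (t e) - x (h e)).1 + n.2 * (x (t e) - x (h e)).2 := rfl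

theorem edgeForm_const (t h : E → V) (e : E) (n c : ℝ × ℝ) :
    edgeForm t h e n (fun _ => c) = 0 := by
  simp [edgeForm_apply]

/-- Independence of the rigidity rows is independence of the corresponding edge forms. -/
theorem indep_iff_linearIndependent_edgeForm [Fintype V] [DecidableEq V] (t h : E → V)
    (m : E → ℤ × ℤ) (p : V → ℝ × ℝ) :
    Indep t h m p ↔
      LinearIndependent ℝ fun e => edgeForm t h e (p (t e) - p (h e) - zcast (m e)) := by
  let dot : (V → ℝ × ℝ) →ₗ[ℝ] Dual ℝ (V → ℝ × ℝ) :=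
    LinearMap.mk₂ ℝ (fun r x => ∑ v, ((r v).1 * (x v).1 + (r v).2 * (x v).2))
      (fun _ _ _ => by simp only [← Finset.sum_add_distrib]; congr! 1; simp; ring)
      (fun _ _ _ => by simp only [Finset.smul_sum]; congr! 1; simp; ring)
      (fun _ _ _ => by simp only [← Finset.sum_add_distrib]; congr! 1; simp; ring)
      (fun _ _ _ => by simp only [Finset.smul_sum]; congr! 1; simp; ring)
  have hdot : ∀ r x, dot r x = ∑ v, ((r v).1 * (x v).1 + (r v).2 * (x v).2) := fun _ _ => rfl
  have hker : LinearMap.ker dot = ⊥ := by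
    rw [LinearMap.ker_eq_bot']
    intro r hr
    have hsum : ∑ v, ((r v).1 * (r v).1 + (r v).2 * (r v).2) = 0 := by
      rw [← hdot, hr, LinearMap.zero_apply]
    rw [Finset.sum_eq_zero_iff_of_nonneg fun v _ =>
      add_nonneg (mul_self_nonneg _) (mul_self_nonneg _)] at hsum
    ext v
    · have := hsum v (mem_univ v)
      simp only [Pi.zero_apply, Prod.fst_zero]
      nlinarith [mul_self_nonneg (r v).1, mul_self_nonneg (r v).2]
    · have := hsum v (mem_univ v)
      simp only [Pi.zero_apply, Prod.snd_zero]
      nlinarith [mul_self_nonneg (r v).1, mul_self_nonneg (r v).2]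
  have hrow : (fun e => edgeForm t h e (p (t e) - p (h e) - zcast (m e))) =
      dot ∘ row t h m p := by
    ext1 e
    refine LinearMap.ext fun x => ?_
    rw [Function.comp_apply, hdot, edgeForm_apply]
    by_cases hth : t e = h e
    · simp [row, hth]
    · rw [Fintype.sum_eq_add (t e) (h e) hth]
      · simp [row, hth, Ne.symm hth]
        ring
      · rintro v ⟨hvt, hvh⟩
        simp [row, hvt, hvh]
  rw [hrow, LinearMap.linearIndependent_iff dot hker, Indep]

/-- A family of independent edge forms has at most `2 |V| - 2` members, and if it has exactly
that many then only the constant functions are in its common kernel. -/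
theorem card_add_two_le_of_linearIndependent [Fintype V] [Nonempty V] [Fintype E] {t h : E → V}
    {n : E → ℝ × ℝ} (hn : LinearIndependent ℝ fun e => edgeForm t h e (n e)) :
    Fintype.card E + 2 ≤ 2 * Fintype.card V ∧
      (Fintype.card E + 2 = 2 * Fintype.card V →
        ∀ x : V → ℝ × ℝ, (∀ e, edgeForm t h e (n e) x = 0) → ∃ c, x = fun _ => c) := by
  set F : (V → ℝ × ℝ) →ₗ[ℝ] (E → ℝ) := LinearMap.pi fun e => edgeForm t h e (n e) with hF
  have hsurj : Function.Surjective F := fun b =>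
    (exists_forall_apply_eq_of_linearIndependent hn b).imp fun x hx => funext hx
  have hdim := LinearMap.finrank_range_add_finrank_ker F
  rw [LinearMap.range_eq_top.2 hsurj, finrank_top, finrank_pi, finrank_pi_fintype] at hdim
  simp only [finrank_prod, finrank_self, sum_const, card_univ, smul_eq_mul] at hdim
  let const : ℝ × ℝ →ₗ[ℝ] (V → ℝ × ℝ) := LinearMap.pi fun _ => LinearMap.id
  have hconst : Function.Injective const := fun a b hab =>
    congrFun hab (Classical.arbitrary V)
  have hle : LinearMap.range const ≤ LinearMap.ker F := by
    rintro _ ⟨c, rfl⟩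
    exact funext fun e => edgeForm_const t h e (n e) c
  have hrange : finrank ℝ (LinearMap.range const) = 2 := by
    rw [LinearMap.finrank_range_of_inj hconst, finrank_prod, finrank_self]
  have h2 := Submodule.finrank_mono hle
  refine ⟨by omega, fun hcard x hx => ?_⟩
  have heq := Submodule.eq_of_le_of_finrank_eq hle (by omega)
  have hxm : x ∈ LinearMap.ker F := funext hx
  rw [← heq] at hxm
  obtain ⟨c, hc⟩ := hxm
  exact ⟨c, hc.symm⟩

/-- Independence of rows passes to subgraphs. -/
theorem Indep.subgraph [Fintype V] [DecidableEq V] {t h : E → V} {m : E → ℤ × ℤ}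
    {p : V → ℝ × ℝ} (hp : Indep t h m p) {V' : Finset V} {E' : Finset E}
    (hsub : IsSubgraph t h V' E') :
    LinearIndependent ℝ fun e : E' =>
      edgeForm (V := V') (fun e : E' => ⟨t e, (hsub e e.2).1⟩) (fun e : E' => ⟨h e, (hsub e e.2).2⟩)
        e (p (t e) - p (h e) - zcast (m e)) := by
  rw [indep_iff_linearIndependent_edgeForm] at hp
  refine LinearIndependent.of_comp
    (LinearMap.funLeft ℝ (ℝ × ℝ) (Subtype.val : V' → V)).dualMap ?_
  exact hp.comp (Subtype.val : E' → E) Subtype.val_injective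

theorem Indep.card_le [Fintype V] [DecidableEq V] {t h : E → V} {m : E → ℤ × ℤ}
    {p : V → ℝ × ℝ} (hp : Indep t h m p) {V' : Finset V} {E' : Finset E}
    (hsub : IsSubgraph t h V' E') (hV' : V'.Nonempty) :
    (E'.card : ℤ) ≤ 2 * V'.card - 2 := by
  have := hV'.to_subtype
  have hle := (card_add_two_le_of_linearIndependent (hp.subgraph hsub)).1
  simp only [Fintype.card_coe] at hle
  omega

theorem Indep.constructive [Fintype V] [DecidableEq V] {t h : E → V} {m : E → ℤ × ℤ}
    {p : V → ℝ × ℝ} (hp : Indep t h m p) : Constructive t h m := by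
  rintro V' E' hsub hV' hcard ⟨φ, hφ⟩
  have hne : V'.Nonempty := card_pos.1 (by omega)
  have := hne.to_subtype
  have hli := hp.subgraph hsub
  have hconst := (card_add_two_le_of_linearIndependent hli).2
    (by simp only [Fintype.card_coe]; omega)
  set q : V → ℝ × ℝ := fun v => p v + zcast (φ v) with hq
  have hdq : ∀ e ∈ E', p (t e) - p (h e) - zcast (m e) = q (t e) - q (h e) := by
    intro e he
    rw [hφ e he]
    ext <;> simp [hq, zcast] <;> ring
  obtain ⟨c, hc⟩ := hconst (fun v => (-(q v).2, (q v).1)) fun e => by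
    rw [hdq e e.2, edgeForm_apply]
    simp only [Prod.fst_sub, Prod.snd_sub]
    ring
  obtain ⟨e, he⟩ : E'.Nonempty := card_pos.1 (by omega)
  refine hli.ne_zero ⟨e, he⟩ ?_
  have hte := congrFun hc ⟨t e, (hsub e he).1⟩
  have hhe := congrFun hc ⟨h e, (hsub e he).2⟩
  have hqe : q (t e) = q (h e) := by
    have := hte.trans hhe.symm
    simp only [Prod.mk.injEq, neg_inj] at this
    exact Prod.ext this.2 this.1
  rw [hdq e he, hqe, sub_self, map_zero]

/-- In a `(2, 2)`-sparse graph every edge set `J` has rank at least `|J|`, and if a nonempty `J` has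
rank exactly `|J|` then it contains a tight subgraph. -/
theorem card_le_finrank_sup_of_sparse [Fintype V] {t h : E → V}
    (hS : ∀ (V' : Finset V) (E' : Finset E), IsSubgraph t h V' E' → V'.Nonempty →
      (E'.card : ℤ) ≤ 2 * V'.card - 2) (J : Finset E) :
    J.card ≤ finrank ℝ (J.sup fun e => LinearMap.range (edgeForm t h e) : Submodule ℝ _) ∧
      (J.Nonempty →
        finrank ℝ (J.sup fun e => LinearMap.range (edgeForm t h e) : Submodule ℝ _) ≤ J.card →
        ∃ (V' : Finset V) (E' : Finset E), E' ⊆ J ∧ IsSubgraph t h V' E' ∧ 2 ≤ V'.card ∧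
          (E'.card : ℤ) = 2 * V'.card - 2) := by
  classical
  set S : Submodule ℝ (Dual ℝ (V → ℝ × ℝ)) :=
    J.sup fun e => LinearMap.range (edgeForm t h e) with hSdef
  let s : Setoid V := Relation.EqvGen.setoid fun u v => ∃ e ∈ J, t e = u ∧ h e = v
  let π : V → Quotient s := Quotient.mk s
  have hπ : ∀ e ∈ J, π (t e) = π (h e) := fun e he =>
    Quotient.sound (Relation.EqvGen.rel _ _ ⟨e, he, rfl, rfl⟩)
  have hcoann : S.dualCoannihilator ≤ LinearMap.range (LinearMap.funLeft ℝ (ℝ × ℝ) π) := by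
    intro x hx
    rw [Submodule.mem_dualCoannihilator] at hx
    have hedge : ∀ e ∈ J, x (t e) = x (h e) := by
      intro e he
      have hform : ∀ n, edgeForm t h e n x = 0 := fun n =>
        hx _ (Finset.le_sup (f := fun e => LinearMap.range (edgeForm t h e)) he ⟨n, rfl⟩)
      have h1 := hform (1, 0)
      have h2 := hform (0, 1)
      simp only [edgeForm_apply, Prod.fst_sub, Prod.snd_sub, one_mul, zero_mul, add_zero,
        zero_add, sub_eq_zero] at h1 h2
      exact Prod.ext h1 h2
    have hresp : ∀ u v, Relation.EqvGen (fun u v => ∃ e ∈ J, t e = u ∧ h e = v) u v →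
        x u = x v := by
      intro u v huv
      induction huv with
      | rel u v huv =>
        obtain ⟨e, he, rfl, rfl⟩ := huv
        exact hedge e he
      | refl u => rfl
      | symm u v _ ih => exact ih.symm
      | trans u v w _ _ ih₁ ih₂ => exact ih₁.trans ih₂
    exact ⟨Quotient.lift x hresp, rfl⟩
  have hdim := Subspace.finrank_add_finrank_dualCoannihilator_eq S
  have hle := (Submodule.finrank_mono hcoann).trans (LinearMap.finrank_range_le _)
  rw [finrank_pi_fintype] at hdim hle
  simp only [finrank_prod, finrank_self, sum_const, card_univ, smul_eq_mul] at hdim hle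
  let Vc : Quotient s → Finset V := fun q => univ.filter fun v => π v = q
  let Ec : Quotient s → Finset E := fun q => J.filter fun e => π (t e) = q
  have hVc : Fintype.card V = ∑ q, (Vc q).card :=
    card_eq_sum_card_fiberwise fun _ _ => mem_coe.2 (mem_univ _)
  have hEc : J.card = ∑ q, (Ec q).card :=
    card_eq_sum_card_fiberwise fun _ _ => mem_coe.2 (mem_univ _)
  have hsub : ∀ q, IsSubgraph t h (Vc q) (Ec q) := by
    intro q e he
    obtain ⟨heJ, heq⟩ := mem_filter.1 he
    exact ⟨mem_filter.2 ⟨mem_univ _, heq⟩, mem_filter.2 ⟨mem_univ _, (hπ e heJ) ▸ heq⟩⟩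
  have hcomp : ∀ q, ((Ec q).card : ℤ) ≤ 2 * (Vc q).card - 2 := by
    intro q
    obtain ⟨v, hv⟩ := Quotient.exists_rep q
    exact hS _ _ (hsub q) ⟨v, mem_filter.2 ⟨mem_univ _, hv⟩⟩
  have htotal : ∑ q, (2 * ((Vc q).card : ℤ) - 2) =
      2 * Fintype.card V - 2 * Fintype.card (Quotient s) := by
    rw [sum_sub_distrib, ← mul_sum, hVc]
    simp [mul_comm]
  have hEc' : (J.card : ℤ) = ∑ q, ((Ec q).card : ℤ) := by
    exact_mod_cast hEc
  have hsum := Finset.sum_le_sum fun q (_ : q ∈ univ) => hcomp q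
  refine ⟨by omega, fun ⟨e, he⟩ hrank => ?_⟩
  have htight := (Finset.sum_eq_sum_iff_of_le fun q (_ : q ∈ univ) => hcomp q).1
    (by omega) (π (t e)) (mem_univ _)
  have hpos : 0 < (Ec (π (t e))).card := card_pos.2 ⟨e, mem_filter.2 ⟨he, rfl⟩⟩
  exact ⟨_, _, filter_subset _ _, hsub _, by omega, htight⟩

/-- A vector orthogonal to `n ≠ 0` is, after a quarter turn, a multiple of `n`. -/
theorem exists_quarter_turn_eq_smul {n d : ℝ × ℝ} (hn : n ≠ 0)
    (hd : n.1 * d.1 + n.2 * d.2 = 0) : ∃ c : ℝ, (-d.2, d.1) = c • n := by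
  have hpos : n.1 ^ 2 + n.2 ^ 2 ≠ 0 := by
    intro h0
    refine hn (Prod.ext ?_ ?_)
    · exact pow_eq_zero_iff two_ne_zero |>.1 (by nlinarith [sq_nonneg n.1, sq_nonneg n.2])
    · exact pow_eq_zero_iff two_ne_zero |>.1 (by nlinarith [sq_nonneg n.1, sq_nonneg n.2])
  refine ⟨(n.2 * d.1 - n.1 * d.2) / (n.1 ^ 2 + n.2 ^ 2), Prod.ext ?_ ?_⟩
  · simp only [Prod.smul_fst, smul_eq_mul]
    field_simp
    linear_combination (-n.2) * hd
  · simp only [Prod.smul_snd, smul_eq_mul]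
    field_simp
    linear_combination n.1 * hd

/-- `p` realizes the gain graph with every edge vector `p (t e) - p (h e) - m e` equal to
`μ e • n e`, where the directions `n` make the edge forms independent. The edge `e` is collapsed
when `μ e = 0`. -/
structure IsDirectionRealization (t h : E → V) (m : E → ℤ × ℤ) (n : E → ℝ × ℝ) (p : V → ℝ × ℝ)
    (μ : E → ℝ) : Prop where
  indep : LinearIndependent ℝ fun e => edgeForm t h e (n e)
  edge_eq : ∀ e, p (t e) - p (h e) - zcast (m e) = μ e • n e

theorem IsDirectionRealization.dir_ne_zero {t h : E → V} {m : E → ℤ × ℤ} {n : E → ℝ × ℝ}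
    {p : V → ℝ × ℝ} {μ : E → ℝ} (hp : IsDirectionRealization t h m n p μ) (e : E) : n e ≠ 0 := by
  intro h0
  exact hp.indep.ne_zero e (by simp [h0])

/-- Independent directions are realized by some placement of the vertices. -/
theorem exists_isDirectionRealization [Finite E] {t h : E → V} (m : E → ℤ × ℤ) {n : E → ℝ × ℝ}
    (hn : LinearIndependent ℝ fun e => edgeForm t h e (n e)) :
    ∃ p μ, IsDirectionRealization t h m n p μ := by
  obtain ⟨x, hx⟩ := exists_forall_apply_eq_of_linearIndependent hn
    fun e => (n e).1 * (zcast (m e)).2 - (n e).2 * (zcast (m e)).1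
  have hex : ∀ e, ∃ c : ℝ, (-(x (t e)).2, (x (t e)).1) - (-(x (h e)).2, (x (h e)).1) -
      zcast (m e) = c • n e := by
    intro e
    have hne : n e ≠ 0 := fun h0 => hn.ne_zero e (by simp [h0])
    have hxe := hx e
    simp only [edgeForm_apply, Prod.fst_sub, Prod.snd_sub] at hxe
    obtain ⟨c, hc⟩ := exists_quarter_turn_eq_smul hne
      (d := x (t e) - x (h e) - ((zcast (m e)).2, -(zcast (m e)).1)) (by
        simp only [Prod.fst_sub, Prod.snd_sub]
        linear_combination hxe)
    refine ⟨c, hc ▸ ?_⟩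
    ext <;> simp
    ring
  choose μ hμ using hex
  exact ⟨fun v => (-(x v).2, (x v).1), μ, hn, hμ⟩

/-- If a motion `x` stresses only the uncollapsed edge `f` and moves the endpoints of the collapsed
edge `e₀` apart, then `e₀` can be opened up without collapsing any other edge. -/
theorem IsDirectionRealization.exists_uncollapse [Fintype E] [DecidableEq E] {t h : E → V}
    {m : E → ℤ × ℤ} {n : E → ℝ × ℝ} {p : V → ℝ × ℝ} {μ : E → ℝ}
    (hp : IsDirectionRealization t h m n p μ) {f e₀ : E} (hf : μ f ≠ 0) (he₀ : μ e₀ = 0)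
    {x : V → ℝ × ℝ} (hx : ∀ e, edgeForm t h e (n e) x = if e = f then 1 else 0)
    (hxe₀ : x (t e₀) ≠ x (h e₀)) :
    ∃ n' p' μ', IsDirectionRealization t h m n' p' μ' ∧ (∀ e, μ' e = 0 → μ e = 0) ∧
      μ' e₀ ≠ 0 := by
  have hν : ∀ e, ∃ c : ℝ, e ≠ f →
      (-(x (t e) - x (h e)).2, (x (t e) - x (h e)).1) = c • n e := by
    intro e
    by_cases hef : e = f
    · exact ⟨0, fun h => absurd hef h⟩
    · obtain ⟨c, hc⟩ := exists_quarter_turn_eq_smul (hp.dir_ne_zero e)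
        (d := x (t e) - x (h e)) (by simpa [hef, edgeForm_apply] using hx e)
      exact ⟨c, fun _ => hc⟩
  choose ν hν using hν
  obtain ⟨c, hc⟩ := Infinite.exists_notMem_finset
    (insert (0 : ℝ) (univ.image fun e => -μ e / ν e))
  simp only [mem_insert, mem_image, mem_univ, true_and, not_or, not_exists] at hc
  obtain ⟨hc0, hc⟩ := hc
  set n' : E → ℝ × ℝ := Function.update n f
    (n f + (c / μ f) • (-(x (t f) - x (h f)).2, (x (t f) - x (h f)).1)) with hn'
  set p' : V → ℝ × ℝ := fun v => p v + c • (-(x v).2, (x v).1) with hp'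
  set μ' : E → ℝ := Function.update (fun e => μ e + c * ν e) f (μ f) with hμ'
  have he₀f : e₀ ≠ f := by
    rintro rfl
    exact hf he₀
  have hp'e : ∀ e, p' (t e) - p' (h e) - zcast (m e) = (p (t e) - p (h e) - zcast (m e)) +
      c • (-(x (t e) - x (h e)).2, (x (t e) - x (h e)).1) := by
    intro e
    ext <;> simp [hp'] <;> ring
  refine ⟨n', p', μ', ⟨?_, fun e => ?_⟩, fun e he => ?_, ?_⟩
  · have hform : ∀ e, edgeForm t h e (n' e) x = if e = f then 1 else 0 := by
      intro e
      by_cases hef : e = f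
      · subst hef
        have := hx e
        simp only [if_pos, edgeForm_apply, hn', Function.update_self] at this ⊢
        simp only [Prod.fst_add, Prod.snd_add, Prod.smul_fst, Prod.smul_snd, smul_eq_mul]
        linear_combination this
      · simpa [hn', hef] using hx e
    rw [Fintype.linearIndependent_iff]
    intro a ha
    have haf : a f = 0 := by
      have := LinearMap.congr_fun ha x
      simpa [LinearMap.sum_apply, hform] using this
    refine Fintype.linearIndependent_iff.1 hp.indep a ?_
    rw [← ha]
    refine sum_congr rfl fun e _ => ?_
    by_cases hef : e = f
    · rw [hef, haf, zero_smul, zero_smul]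
    · simp [hn', hef]
  · rw [hp'e, hp.edge_eq]
    by_cases hef : e = f
    · subst hef
      simp only [hn', hμ', Function.update_self, smul_add, smul_smul]
      rw [mul_div_cancel₀ _ hf]
    · rw [hν e hef]
      simp [hn', hμ', hef, add_smul, smul_smul]
  · by_cases hef : e = f
    · subst hef
      simpa [hμ'] using he
    · simp only [hμ', Function.update_of_ne hef] at he
      by_cases hνe : ν e = 0
      · simpa [hνe] using he
      · refine absurd ?_ (hc e)
        rw [div_eq_iff hνe]
        linarith
  · simp only [hμ', Function.update_of_ne he₀f, he₀, zero_add]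
    refine mul_ne_zero hc0 fun hν0 => hxe₀ ?_
    have := hν e₀ he₀f
    rw [hν0, zero_smul, Prod.mk_eq_zero, neg_eq_zero] at this
    exact sub_eq_zero.1 (Prod.ext this.2 this.1)

/-- The edges collapsed by `p` are balanced. -/
theorem balanced_of_forall_collapsed {t h : E → V} {m : E → ℤ × ℤ} {p : V → ℝ × ℝ}
    {E' : Finset E} (hE' : ∀ e ∈ E', p (t e) - p (h e) - zcast (m e) = 0) :
    Balanced t h m E' := by
  refine ⟨fun v => (-⌊(p v).1⌋, -⌊(p v).2⌋), fun e he => ?_⟩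
  have hpe := hE' e he
  have h1 : (p (t e)).1 = (p (h e)).1 + ((m e).1 : ℤ) := by
    have := congrArg Prod.fst hpe
    simp only [zcast, Prod.fst_sub, Prod.fst_zero] at this
    linarith
  have h2 : (p (t e)).2 = (p (h e)).2 + ((m e).2 : ℤ) := by
    have := congrArg Prod.snd hpe
    simp only [zcast, Prod.snd_sub, Prod.snd_zero] at this
    linarith
  ext
  · simp [h1]
  · simp [h2]

/-- A realization of a tight sparse constructive gain graph with a collapsed edge can be improved. -/
theorem IsDirectionRealization.exists_improvement [Fintype V] [Nonempty V] [Fintype E]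
    {t h : E → V} {m : E → ℤ × ℤ} (hcard : Fintype.card E + 2 = 2 * Fintype.card V)
    (hS : ∀ (V' : Finset V) (E' : Finset E), IsSubgraph t h V' E' → V'.Nonempty →
      (E'.card : ℤ) ≤ 2 * V'.card - 2)
    (hC : Constructive t h m) {n : E → ℝ × ℝ} {p : V → ℝ × ℝ} {μ : E → ℝ}
    (hp : IsDirectionRealization t h m n p μ) {e₁ : E} (he₁ : μ e₁ = 0) :
    ∃ n' p' μ', IsDirectionRealization t h m n' p' μ' ∧ (∀ e, μ' e = 0 → μ e = 0) ∧
      ∃ e₀, μ e₀ = 0 ∧ μ' e₀ ≠ 0 := by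
  classical
  choose x hx using fun f => exists_forall_apply_eq_of_linearIndependent hp.indep
    fun e => if e = f then 1 else 0
  by_contra hno
  have hstuck : ∀ e₀ f, μ e₀ = 0 → μ f ≠ 0 → x f (t e₀) = x f (h e₀) := by
    intro e₀ f he₀ hf
    by_contra hne
    obtain ⟨n', p', μ', hp', hle, hlt⟩ := hp.exists_uncollapse hf he₀ (hx f) hne
    exact hno ⟨n', p', μ', hp', hle, e₀, he₀, hlt⟩
  set C : Finset E := univ.filter fun e => μ e = 0 with hCdef
  have hexpand : ∀ ψ : Dual ℝ (V → ℝ × ℝ), (∀ c, ψ (fun _ => c) = 0) →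
      ψ = ∑ g, ψ (x g) • edgeForm t h g (n g) := by
    intro ψ hψ
    refine LinearMap.ext fun y => ?_
    obtain ⟨c, hc⟩ := (card_add_two_le_of_linearIndependent hp.indep).2 hcard
      (y - ∑ g, edgeForm t h g (n g) y • x g) fun e => by
        simp [map_sub, map_sum, hx]
    have hy := congrArg ψ hc
    rw [hψ, map_sub, map_sum, sub_eq_zero] at hy
    rw [hy, LinearMap.sum_apply]
    exact sum_congr rfl fun g _ => by simp [mul_comm]
  have hspan : (C.sup fun e => LinearMap.range (edgeForm t h e)) ≤
      Submodule.span ℝ ((C.image fun g => edgeForm t h g (n g) : Finset _) : Set _) := by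
    refine Finset.sup_le fun e he => ?_
    rintro _ ⟨k, rfl⟩
    have heC : μ e = 0 := (mem_filter.1 he).2
    rw [hexpand (edgeForm t h e k) fun c => edgeForm_const t h e k c]
    refine Submodule.sum_mem _ fun g _ => ?_
    by_cases hg : μ g = 0
    · refine Submodule.smul_mem _ _ (Submodule.subset_span ?_)
      exact mem_coe.2 (mem_image_of_mem _ (mem_filter.2 ⟨mem_univ g, hg⟩))
    · rw [edgeForm_apply, hstuck e g heC hg]
      simp
  have hrank := (Submodule.finrank_mono hspan).trans
    ((finrank_span_finset_le_card _).trans card_image_le)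
  obtain ⟨V', E', hE'C, hsub, hV', htight⟩ := (card_le_finrank_sup_of_sparse hS C).2
    ⟨e₁, mem_filter.2 ⟨mem_univ e₁, he₁⟩⟩ hrank
  refine hC V' E' hsub hV' htight (balanced_of_forall_collapsed (p := p) fun e he => ?_)
  rw [hp.edge_eq, (mem_filter.1 (hE'C he)).2, zero_smul]

/-- A tight sparse constructive gain graph has a realization without collapsed edges. -/
theorem exists_isDirectionRealization_forall_ne_zero [Fintype V] [Nonempty V] [Fintype E]
    {t h : E → V} {m : E → ℤ × ℤ} (hcard : Fintype.card E + 2 = 2 * Fintype.card V)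
    (hS : ∀ (V' : Finset V) (E' : Finset E), IsSubgraph t h V' E' → V'.Nonempty →
      (E'.card : ℤ) ≤ 2 * V'.card - 2)
    (hC : Constructive t h m) :
    ∃ n p μ, IsDirectionRealization t h m n p μ ∧ ∀ e, μ e ≠ 0 := by
  classical
  obtain ⟨u, hu, hli⟩ := exists_linearIndependent_mem
    (fun e => LinearMap.range (edgeForm t h e)) fun J => (card_le_finrank_sup_of_sparse hS J).1
  choose n hn using hu
  obtain ⟨p, μ, hp⟩ := exists_isDirectionRealization (t := t) (h := h) m (n := n)
    (by simpa only [hn] using hli)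
  induction hN : (univ.filter fun e => μ e = 0).card using Nat.strong_induction_on
    generalizing n p μ u with
  | _ N ih =>
  subst hN
  by_cases hμ : ∀ e, μ e ≠ 0
  · exact ⟨n, p, μ, hp, hμ⟩
  · push Not at hμ
    obtain ⟨e₁, he₁⟩ := hμ
    obtain ⟨n', p', μ', hp', hle, e₀, he₀, he₀'⟩ := hp.exists_improvement hcard hS hC he₁
    refine ih _ (card_lt_card ?_) _ hp'.indep n' (fun _ => rfl) p' μ' hp' rfl
    refine ⟨fun e he => ?_, fun hsub => ?_⟩
    · exact mem_filter.2 ⟨mem_univ e, hle e (mem_filter.1 he).2⟩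
    · exact he₀' (mem_filter.1 (hsub (mem_filter.2 ⟨mem_univ e₀, he₀⟩))).2

/-- **Periodic Laman theorem on the fixed torus (existential form).**
For a gain graph `⟨G, m⟩` with `V` nonempty and `|E| = 2 |V| - 2`, there is a realization `p`
making the edges independent (minimal rigidity on the fixed torus for some realization)
iff every subgraph with nonempty vertex set satisfies `|E'| ≤ 2 |V'| - 2` and `m` is
constructive. -/
theorem periodic_laman {V E : Type*} [Fintype V] [Fintype E] [DecidableEq V]
    (t h : E → V) (m : E → ℤ × ℤ)
    (hV : Nonempty V)
    (hE : (Fintype.card E : ℤ) = 2 * Fintype.card V - 2) :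
    (∃ p : V → ℝ × ℝ, Indep t h m p) ↔
      ((∀ (V' : Finset V) (E' : Finset E), IsSubgraph t h V' E' → V'.Nonempty →
          (E'.card : ℤ) ≤ 2 * V'.card - 2) ∧
        Constructive t h m) := by
  constructor
  · rintro ⟨p, hp⟩
    exact ⟨fun V' E' hsub hV' => hp.card_le hsub hV', hp.constructive⟩
  · rintro ⟨hS, hC⟩
    obtain ⟨n, p, μ, hp, hμ⟩ :=
      exists_isDirectionRealization_forall_ne_zero (by omega) hS hC
    refine ⟨p, (indep_iff_linearIndependent_edgeForm t h m p).2 ?_⟩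
    convert hp.indep.units_smul fun e => Units.mk0 (μ e) (hμ e) using 1
    ext1 e
    rw [hp.edge_eq, map_smul]
    rfl

end PeriodicRigidity
end

section
/- Main theorem (combinatorial characterization). Let G = (V,E,t,h) be a finite multigraph with V nonempty and |E| = 2|V| − 2. The following are equivalent: (i) every subgraph (V',E') with V' nonempty satisfies |E'| ≤ 2|V'| − 2; (ii) for every constructive gain assignment m : E → ℤ² there exists a realization p : V → ℝ² for which the edges of (⟨G,m⟩, p) are independent; (iii) there exist a gain assignment m : E → ℤ² and a realization p : V → ℝ² for which the edges of (⟨G,m⟩, p) are independent. -/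
open Finset

namespace PeriodicRigidity

variable {V E : Type*}

open Module Submodule in
/-- Rado's condition passes to one of two subspaces spanning a member of the family. -/
theorem rado_condition_update {K M E : Type*} [Field K] [AddCommGroup M] [Module K M]
    [FiniteDimensional K M] [DecidableEq E] (A : E → Submodule K M)
    (hA : ∀ F : Finset E, F.card ≤ finrank K (F.sup A : Submodule K M))
    (e : E) {B B' : Submodule K M} (hB : A e = B ⊔ B') :
    (∀ F : Finset E, F.card ≤ finrank K (F.sup (Function.update A e B) : Submodule K M)) ∨
    (∀ F : Finset E, F.card ≤ finrank K (F.sup (Function.update A e B') : Submodule K M)) := by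
  have mem (C : Submodule K M) (F : Finset E)
      (hF : finrank K (F.sup (Function.update A e C) : Submodule K M) < F.card) : e ∈ F := by
    by_contra he
    refine hF.not_ge ?_
    have hcongr : ∀ i ∈ F, Function.update A e C i = A i := fun i hi =>
      Function.update_of_ne (ne_of_mem_of_not_mem hi he) C A
    rw [Finset.sup_congr rfl hcongr]
    exact hA F
  have le (C : Submodule K M) (F : Finset E) {i : E} (hi : i ∈ F) (hie : i ≠ e) :
      A i ≤ F.sup (Function.update A e C) := by
    have := Finset.le_sup (f := Function.update A e C) hi
    rwa [Function.update_of_ne hie] at this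
  have le' (C : Submodule K M) (F : Finset E) (hi : e ∈ F) :
      C ≤ F.sup (Function.update A e C) := by
    have := Finset.le_sup (f := Function.update A e C) hi
    rwa [Function.update_self] at this
  by_contra! ⟨⟨F, hF⟩, ⟨F', hF'⟩⟩
  have heF := mem B F hF
  have heF' := mem B' F' hF'
  set X := F.sup (Function.update A e B)
  set X' := F'.sup (Function.update A e B')
  have union : (F ∪ F').sup A ≤ X ⊔ X' := by
    refine Finset.sup_le fun i hi => ?_
    by_cases hie : i = e
    · subst hie
      rw [hB]
      exact sup_le_sup (le' _ _ heF) (le' _ _ heF')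
    · rcases Finset.mem_union.1 hi with hi | hi
      · exact (le B F hi hie).trans le_sup_left
      · exact (le B' F' hi hie).trans le_sup_right
  have inter : ((F ∩ F').erase e).sup A ≤ X ⊓ X' := by
    refine Finset.sup_le fun i hi => ?_
    obtain ⟨hie, hi⟩ := Finset.mem_erase.1 hi
    obtain ⟨hi, hi'⟩ := Finset.mem_inter.1 hi
    exact le_inf (le B F hi hie) (le B' F' hi' hie)
  have h1 := (hA _).trans (finrank_mono union)
  have h2 := (hA _).trans (finrank_mono inter)
  rw [Finset.card_erase_of_mem (by simp [heF, heF'])] at h2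
  have h3 := finrank_sup_add_finrank_inf_eq X X'
  have h4 := Finset.card_union_add_card_inter F F'
  omega

open Module Submodule in
/-- Rado's theorem for pairs of vectors: one vector can be chosen from each pair so that the
chosen vectors are independent, provided every set of pairs spans a large enough space. -/
theorem exists_linearIndependent_choice {K M E : Type*} [Field K] [AddCommGroup M] [Module K M]
    [FiniteDimensional K M] [Fintype E] (a b : E → M)
    (hab : ∀ F : Finset E, F.card ≤ finrank K (F.sup fun e => span K {a e, b e} : Submodule K M)) :
    ∃ c : E → M, (∀ e, c e = a e ∨ c e = b e) ∧ LinearIndependent K c := by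
  classical
  have key (S : Finset E) : ∃ A : E → Submodule K M,
      (∀ e ∈ S, A e = span K {a e} ∨ A e = span K {b e}) ∧
      (∀ e ∉ S, A e = span K {a e, b e}) ∧
      ∀ F : Finset E, F.card ≤ finrank K (F.sup A : Submodule K M) := by
    induction S using Finset.induction_on with
    | empty => exact ⟨fun e => span K {a e, b e}, by simp, by simp, hab⟩
    | insert e S he ih =>
      obtain ⟨A, h1, h2, h3⟩ := ih
      have := rado_condition_update A h3 e ((h2 e he).trans (span_insert _ _))
      rcases this with h | h
      · exact ⟨_, by grind [Function.update_apply], by grind [Function.update_apply], h⟩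
      · exact ⟨_, by grind [Function.update_apply], by grind [Function.update_apply], h⟩
  obtain ⟨A, h1, -, h3⟩ := key Finset.univ
  have h4 (e : E) : ∃ c, (c = a e ∨ c = b e) ∧ A e = span K {c} := by
    rcases h1 e (Finset.mem_univ e) with h | h
    · exact ⟨_, .inl rfl, h⟩
    · exact ⟨_, .inr rfl, h⟩
  choose c hc hAc using h4
  refine ⟨c, hc, ?_⟩
  rw [linearIndependent_iff_card_le_finrank_span, Set.finrank]
  have h5 := h3 Finset.univ
  rwa [Finset.card_univ, Finset.sup_univ_eq_iSup, iSup_congr hAc, ← span_range_eq_iSup] at h5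

/-- Linearly independent functions supported on `V'` with vanishing total sum take values in a
module of rank `|V'| - 1` times the rank of the target. -/
theorem card_le_of_support_of_sum_eq_zero {R M V ι : Type*} [CommRing R] [StrongRankCondition R]
    [AddCommGroup M] [Module R M] [Module.Free R M] [Module.Finite R M] [Fintype V] [Fintype ι]
    {V' : Finset V} (hV' : V'.Nonempty) (w : ι → V → M)
    (hsupp : ∀ i, ∀ v ∉ V', w i v = 0) (hsum : ∀ i, ∑ v, w i v = 0)
    (hw : LinearIndependent R w) :
    Fintype.card ι ≤ (V'.card - 1) * Module.finrank R M := by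
  classical
  obtain ⟨v₀, hv₀⟩ := hV'
  have hli : LinearIndependent R fun i (v : V'.erase v₀) => w i v := by
    rw [Fintype.linearIndependent_iff] at hw ⊢
    intro g hg
    refine hw g ?_
    have h1 (v : V) (hv : v ≠ v₀) : (∑ i, g i • w i) v = 0 := by
      by_cases hvV : v ∈ V'
      · simpa using congrFun hg ⟨v, Finset.mem_erase.2 ⟨hv, hvV⟩⟩
      · simp [hsupp _ v hvV]
    funext v
    by_cases hv : v = v₀
    · subst hv
      have h2 : ∑ u, (∑ i, g i • w i) u = 0 := by
        simp only [Finset.sum_apply, Pi.smul_apply]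
        rw [Finset.sum_comm]
        simp [← Finset.smul_sum, hsum]
      rwa [Finset.sum_eq_single v (fun u _ hu => h1 u hu) (by simp)] at h2
    · exact h1 v hv
  have := hli.fintype_card_le_finrank
  rwa [Module.finrank_pi_fintype, Finset.sum_const, Finset.card_univ, Fintype.card_coe,
    Finset.card_erase_of_mem hv₀, smul_eq_mul] at this

/-- A family of functionals is jointly surjective if it is linearly independent. -/
theorem surjective_pi_of_linearIndependent {K W ι : Type*} [Field K] [AddCommGroup W] [Module K W]
    [Fintype ι] {L : ι → Module.Dual K W} (hL : LinearIndependent K L) :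
    Function.Surjective (LinearMap.pi L) := by
  classical
  rw [← LinearMap.range_eq_top]
  by_contra hne
  obtain ⟨f, hf, hle⟩ := Submodule.exists_le_ker_of_lt_top _ (lt_top_iff_ne_top.2 hne)
  refine hf ?_
  rw [Fintype.linearIndependent_iff] at hL
  have h0 : ∀ i, f (Pi.single i 1) = 0 := by
    refine hL (fun i => f (Pi.single i 1)) ?_
    ext z
    have h1 : f (LinearMap.pi L z) = 0 := hle ⟨z, rfl⟩
    rw [← Finset.univ_sum_single (LinearMap.pi L z), map_sum] at h1
    have h2 (i : ι) : f (Pi.single i (L i z)) = f (Pi.single i 1) * L i z := by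
      rw [mul_comm, ← smul_eq_mul, ← map_smul, ← Pi.single_smul, smul_eq_mul, mul_one]
    simpa [h2] using h1
  ext i
  simpa using h0 i

/-- Finitely many nonzero integer linear forms have a common nonvanishing point. -/
theorem exists_forall_sum_mul_ne_zero {E ι : Type*} [Fintype E] (S : Finset ι) (c : ι → E → ℤ)
    (hc : ∀ i ∈ S, c i ≠ 0) : ∃ x : E → ℤ, ∀ i ∈ S, ∑ e, c i e * x e ≠ 0 := by
  classical
  set P : MvPolynomial E ℤ := ∏ i ∈ S, ∑ e, MvPolynomial.C (c i e) * MvPolynomial.X e with hP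
  have hne : P ≠ 0 := by
    rw [hP, Finset.prod_ne_zero_iff]
    intro i hi h0
    obtain ⟨e, he⟩ := Function.ne_iff.1 (hc i hi)
    have := congrArg (MvPolynomial.eval (Pi.single e 1)) h0
    simp [Pi.single_apply] at this
    exact he this
  obtain ⟨x, hx⟩ : ∃ x, MvPolynomial.eval x P ≠ 0 := by
    by_contra! h
    exact hne (MvPolynomial.funext fun x => by simpa using h x)
  refine ⟨x, ?_⟩
  simpa [hP, MvPolynomial.eval_prod, Finset.prod_ne_zero_iff] using hx

section Components

/-- The connected components of the graph on `V` with edge set `F`. -/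
abbrev Component (t h : E → V) (F : Finset E) : Type _ :=
  Quot fun u v => ∃ e ∈ F, t e = u ∧ h e = v

/-- A sparse set `F` of edges satisfies `|F| + 2 c ≤ 2 |V|`, where `c` is its number of
components, strictly so if it is nonempty and contains no tight subgraph. -/
theorem card_add_two_mul_card_component [Fintype V] {t h : E → V} {F : Finset E}
    [Fintype (Component t h F)]
    (hF : ∀ (V' : Finset V) (E' : Finset E), E' ⊆ F → IsSubgraph t h V' E' → V'.Nonempty →
      (E'.card : ℤ) ≤ 2 * V'.card - 2) :
    F.card + 2 * Fintype.card (Component t h F) ≤ 2 * Fintype.card V ∧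
    (F.Nonempty → (∀ (V' : Finset V) (E' : Finset E), E' ⊆ F → IsSubgraph t h V' E' →
      2 ≤ V'.card → (E'.card : ℤ) ≠ 2 * V'.card - 2) →
      F.card + 2 * Fintype.card (Component t h F) < 2 * Fintype.card V) := by
  classical
  let π : V → Component t h F := Quot.mk _
  let edges (x : Component t h F) : Finset E := F.filter fun e => π (t e) = x
  let verts (x : Component t h F) : Finset V := Finset.univ.filter fun v => π v = x
  have hπ (e : E) (he : e ∈ F) : π (h e) = π (t e) := (Quot.sound ⟨e, he, rfl, rfl⟩).symm
  have hsub (x) : IsSubgraph t h (verts x) (edges x) := fun e he => by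
    simp only [edges, Finset.mem_filter] at he
    simp [verts, hπ e he.1, he.2]
  have hle (x) : (edges x).card + 2 ≤ 2 * (verts x).card := by
    have hne : (verts x).Nonempty := by
      obtain ⟨v, rfl⟩ := Quot.exists_rep x
      exact ⟨v, by simp [verts, π]⟩
    have := hF (verts x) (edges x) (Finset.filter_subset _ _) (hsub x) hne
    omega
  have hFc : F.card = ∑ x, (edges x).card :=
    Finset.card_eq_sum_card_fiberwise fun _ _ => Finset.mem_coe.2 (Finset.mem_univ _)
  have hVc : Fintype.card V = ∑ x, (verts x).card :=
    Finset.card_eq_sum_card_fiberwise fun _ _ => Finset.mem_coe.2 (Finset.mem_univ _)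
  have hcard : F.card + 2 * Fintype.card (Component t h F) = ∑ x, ((edges x).card + 2) := by
    rw [hFc, Finset.sum_add_distrib]
    simp [mul_comm]
  rw [hcard, hVc, Finset.mul_sum]
  refine ⟨Finset.sum_le_sum fun x _ => hle x, fun ⟨e, he⟩ htight => ?_⟩
  refine Finset.sum_lt_sum (fun x _ => hle x) ⟨π (t e), Finset.mem_univ _, ?_⟩
  have hcard1 : 1 ≤ (edges (π (t e))).card := Finset.card_pos.2 ⟨e, by simp [edges, he]⟩
  have := hle (π (t e))
  have := htight (verts (π (t e))) (edges (π (t e))) (Finset.filter_subset _ _) (hsub _)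
    (by omega)
  omega

end Components

section Directions

/-- The cross product with a fixed vector of the plane. -/
def crossForm (d : ℝ × ℝ) : ℝ × ℝ →ₗ[ℝ] ℝ :=
  d.1 • LinearMap.snd ℝ ℝ ℝ - d.2 • LinearMap.fst ℝ ℝ ℝ

theorem crossForm_apply (d x : ℝ × ℝ) : crossForm d x = d.1 * x.2 - d.2 * x.1 := by
  simp [crossForm]

theorem exists_eq_smul_of_crossForm_eq_zero {d x : ℝ × ℝ} (hd : d ≠ 0)
    (h : crossForm d x = 0) : ∃ k : ℝ, x = k • d := by
  rw [crossForm_apply] at h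
  by_cases h1 : d.1 = 0
  · have h2 : d.2 ≠ 0 := fun h2 => hd (Prod.ext h1 h2)
    refine ⟨x.2 / d.2, Prod.ext ?_ ?_⟩
    · simp_all
    · simp [h2]
  · refine ⟨x.1 / d.1, Prod.ext ?_ ?_⟩
    · simp [h1]
    · simp only [Prod.smul_snd, smul_eq_mul]
      field_simp
      linarith

/-- The difference of the displacements of the two endpoints of an edge. -/
def edgeDiff (t h : E → V) (e : E) : (V → ℝ × ℝ) →ₗ[ℝ] ℝ × ℝ :=
  LinearMap.proj (R := ℝ) (φ := fun _ => ℝ × ℝ) (t e) -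
    LinearMap.proj (R := ℝ) (φ := fun _ => ℝ × ℝ) (h e)

theorem edgeDiff_apply (t h : E → V) (e : E) (z : V → ℝ × ℝ) :
    edgeDiff t h e z = z (t e) - z (h e) := rfl

/-- The equations of the direction network with edge directions `D`. -/
def directionMap (t h : E → V) (D : E → ℝ × ℝ) : (V → ℝ × ℝ) →ₗ[ℝ] E → ℝ :=
  LinearMap.pi fun e => crossForm (D e) ∘ₗ edgeDiff t h e

theorem directionMap_apply (t h : E → V) (D : E → ℝ × ℝ) (z : V → ℝ × ℝ) (e : E) :
    directionMap t h D z e = crossForm (D e) (edgeDiff t h e z) := rfl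

theorem finrank_le_of_edgeDiff_eq_zero [Fintype V] {t h : E → V} {F : Finset E}
    [Fintype (Component t h F)] {K : Submodule ℝ (V → ℝ × ℝ)}
    (hK : ∀ z ∈ K, ∀ e ∈ F, edgeDiff t h e z = 0) :
    Module.finrank ℝ K ≤ 2 * Fintype.card (Component t h F) := by
  let π : V → Component t h F := Quot.mk _
  have hle : K ≤ LinearMap.range (LinearMap.funLeft ℝ (ℝ × ℝ) π) := by
    intro z hz
    refine ⟨Quot.lift z ?_, rfl⟩
    rintro _ _ ⟨e, he, rfl, rfl⟩
    exact sub_eq_zero.1 (hK z hz e he)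
  refine (Submodule.finrank_mono hle).trans ((LinearMap.finrank_range_le _).trans ?_)
  rw [Module.finrank_pi_fintype]
  simp [mul_comm]

/-- On a sparse graph, some direction network has independent equations. -/
theorem exists_surjective_directionMap [Fintype V] [Fintype E] {t h : E → V}
    (hsparse : ∀ (V' : Finset V) (E' : Finset E), IsSubgraph t h V' E' → V'.Nonempty →
      (E'.card : ℤ) ≤ 2 * V'.card - 2) :
    ∃ D : E → ℝ × ℝ, Function.Surjective (directionMap t h D) := by
  classical
  let L (d : ℝ × ℝ) (e : E) : Module.Dual ℝ (V → ℝ × ℝ) := crossForm d ∘ₗ edgeDiff t h e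
  obtain ⟨c, hc, hli⟩ := exists_linearIndependent_choice (K := ℝ) (L (1, 0)) (L (0, 1)) (by
    intro F
    have : Fintype (Component t h F) := Fintype.ofFinite _
    set W := F.sup fun e => Submodule.span ℝ {L (1, 0) e, L (0, 1) e} with hW
    have h1 := Subspace.finrank_add_finrank_dualCoannihilator_eq W
    have h2 : Module.finrank ℝ W.dualCoannihilator ≤ 2 * Fintype.card (Component t h F) := by
      refine finrank_le_of_edgeDiff_eq_zero fun z hz e he => ?_
      rw [Submodule.mem_dualCoannihilator] at hz
      have hle : Submodule.span ℝ {L (1, 0) e, L (0, 1) e} ≤ W :=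
        Finset.le_sup (f := fun e => Submodule.span ℝ {L (1, 0) e, L (0, 1) e}) he
      have h3 := hz _ (hle (Submodule.subset_span (Set.mem_insert _ _)))
      have h4 := hz _ (hle (Submodule.subset_span (Set.mem_insert_of_mem _ rfl)))
      simp only [L, LinearMap.comp_apply, crossForm_apply] at h3 h4
      exact Prod.ext (by simpa using h4) (by simpa using h3)
    have h3 := (card_add_two_mul_card_component (F := F) fun V' E' _ => hsparse V' E').1
    have h4 : Module.finrank ℝ (V → ℝ × ℝ) = 2 * Fintype.card V := by
      rw [Module.finrank_pi_fintype]
      simp [mul_comm]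
    omega)
  have hD (e : E) : ∃ d : ℝ × ℝ, c e = L d e := by
    rcases hc e with h | h
    exacts [⟨_, h⟩, ⟨_, h⟩]
  choose D hD using hD
  refine ⟨D, ?_⟩
  have := surjective_pi_of_linearIndependent hli
  rwa [funext hD] at this

/-- The vector spanned by an edge in the periodic framework. -/
def edgeVec (t h : E → V) (m : E → ℤ × ℤ) (p : V → ℝ × ℝ) (e : E) : ℝ × ℝ :=
  edgeDiff t h e p - zcast (m e)

theorem edgeVec_add_smul (t h : E → V) (m : E → ℤ × ℤ) (p q : V → ℝ × ℝ) (a : ℝ) (e : E) :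
    edgeVec t h m (p + a • q) e = edgeVec t h m p e + a • edgeDiff t h e q := by
  simp only [edgeVec, map_add, map_smul]
  abel

/-- The realization `p` solves the direction network with directions `D`, whose equations are
independent. -/
structure IsDirectionNetwork (t h : E → V) (m : E → ℤ × ℤ) (D : E → ℝ × ℝ) (p : V → ℝ × ℝ) :
    Prop where
  surjective : Function.Surjective (directionMap t h D)
  parallel : ∀ e, crossForm (D e) (edgeVec t h m p e) = 0

theorem exists_isDirectionNetwork [Fintype V] [Fintype E] {t h : E → V} (m : E → ℤ × ℤ)
    (hsparse : ∀ (V' : Finset V) (E' : Finset E), IsSubgraph t h V' E' → V'.Nonempty →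
      (E'.card : ℤ) ≤ 2 * V'.card - 2) :
    ∃ D p, IsDirectionNetwork t h m D p := by
  obtain ⟨D, hD⟩ := exists_surjective_directionMap hsparse
  obtain ⟨p, hp⟩ := hD fun e => crossForm (D e) (zcast (m e))
  refine ⟨D, p, hD, fun e => ?_⟩
  rw [edgeVec, map_sub, ← directionMap_apply, hp, sub_self]

variable {t h : E → V} {m : E → ℤ × ℤ} {D : E → ℝ × ℝ} {p : V → ℝ × ℝ}

theorem IsDirectionNetwork.ne_zero (hDp : IsDirectionNetwork t h m D p) (e : E) : D e ≠ 0 := by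
  intro h0
  obtain ⟨z, hz⟩ := hDp.surjective 1
  have := congrFun hz e
  simp [directionMap_apply, h0, crossForm_apply] at this

theorem IsDirectionNetwork.exists_eq_smul (hDp : IsDirectionNetwork t h m D p) (e : E) :
    ∃ k : ℝ, edgeVec t h m p e = k • D e :=
  exists_eq_smul_of_crossForm_eq_zero (hDp.ne_zero e) (hDp.parallel e)

/-- Rotating the direction of a noncollapsed edge `f` collapses no further edge, and keeps
collapsed only those edges on which the displacement dual to `f` is constant. -/
theorem IsDirectionNetwork.exists_rotate [Fintype E] [DecidableEq E]
    (hDp : IsDirectionNetwork t h m D p)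
    {f : E} (hf : edgeVec t h m p f ≠ 0) {q : V → ℝ × ℝ}
    (hq : directionMap t h D q = Pi.single f 1) :
    ∃ D' p', IsDirectionNetwork t h m D' p' ∧ ∀ e, edgeVec t h m p' e = 0 →
      edgeVec t h m p e = 0 ∧ edgeDiff t h e q = 0 := by
  have hqf : crossForm (D f) (edgeDiff t h f q) = 1 := by
    rw [← directionMap_apply, hq, Pi.single_eq_same]
  have hqe {e : E} (he : e ≠ f) : crossForm (D e) (edgeDiff t h e q) = 0 := by
    rw [← directionMap_apply, hq, Pi.single_eq_of_ne he]
  obtain ⟨a, ha0, ha⟩ : ∃ a : ℝ, a ≠ 0 ∧ ∀ e, edgeVec t h m p e ≠ 0 →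
      edgeVec t h m p e + a • edgeDiff t h e q ≠ 0 := by
    have hfin : ({0} ∪ ⋃ e ∈ {e | edgeVec t h m p e ≠ 0},
        {a : ℝ | edgeVec t h m p e + a • edgeDiff t h e q = 0}).Finite := by
      refine (Set.finite_singleton _).union (Set.Finite.biUnion (Set.toFinite _) fun e he => ?_)
      refine Set.Subsingleton.finite fun a ha b hb => ?_
      simp only [Set.mem_ofPred_eq] at ha hb he
      have hab : (a - b) • edgeDiff t h e q = 0 := by
        rw [sub_smul, sub_eq_zero]
        exact add_left_cancel (ha.trans hb.symm)
      rcases smul_eq_zero.1 hab with h0 | h0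
      · exact sub_eq_zero.1 h0
      · rw [h0, smul_zero, add_zero] at ha
        exact absurd ha he
    obtain ⟨a, ha⟩ := hfin.exists_notMem
    simp only [Set.mem_union, Set.mem_singleton_iff, Set.mem_iUnion, Set.mem_ofPred_eq,
      exists_prop, not_or, not_exists, not_and] at ha
    exact ⟨a, ha.1, ha.2⟩
  obtain ⟨k, hk⟩ := hDp.exists_eq_smul f
  have hk0 : k ≠ 0 := by
    rintro rfl
    exact hf (by rw [hk, zero_smul])
  refine ⟨Function.update D f (edgeVec t h m (p + a • q) f), p + a • q, ⟨fun y => ?_, fun e => ?_⟩,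
    fun e he => ?_⟩
  · obtain ⟨z, hz⟩ := hDp.surjective y
    have hne : crossForm (edgeVec t h m (p + a • q) f) (edgeDiff t h f q) = k := by
      rw [edgeVec_add_smul, hk]
      simp only [crossForm_apply, Prod.fst_add, Prod.snd_add, Prod.smul_fst, Prod.smul_snd,
        smul_eq_mul] at hqf ⊢
      linear_combination k * hqf
    let c := (y f - crossForm (edgeVec t h m (p + a • q) f) (edgeDiff t h f z)) / k
    refine ⟨z + c • q, funext fun e => ?_⟩
    rw [directionMap_apply, map_add, map_smul, map_add, map_smul]
    by_cases he : e = f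
    · subst he
      rw [Function.update_self, hne, smul_eq_mul, div_mul_cancel₀ _ hk0]
      ring
    · rw [Function.update_of_ne he, hqe he, smul_zero, add_zero, ← directionMap_apply, hz]
  · by_cases he : e = f
    · subst he
      rw [Function.update_self, crossForm_apply]
      ring
    · rw [Function.update_of_ne he, edgeVec_add_smul, map_add, map_smul, hDp.parallel, hqe he]
      simp
  · rw [edgeVec_add_smul] at he
    have h0 : edgeVec t h m p e = 0 := by
      by_contra h0
      exact ha e h0 he
    rw [h0, zero_add, smul_eq_zero] at he
    exact ⟨h0, he.resolve_left ha0⟩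

/-- The collapsed edges of a periodic framework are balanced. -/
theorem balanced_of_edgeVec_eq_zero {C : Finset E} (hC : ∀ e ∈ C, edgeVec t h m p e = 0) :
    Balanced t h m C := by
  refine ⟨fun v => (-⌊(p v).1⌋, -⌊(p v).2⌋), fun e he => ?_⟩
  have h0 : p (t e) = p (h e) + zcast (m e) := by
    have := hC e he
    rw [edgeVec, edgeDiff_apply, sub_eq_zero, sub_eq_iff_eq_add'] at this
    exact this
  ext <;> simp [h0, zcast]

/-- If displacements dual to all edges outside `C` are constant on the components of `C`, there
are few edges outside `C`. -/
theorem card_compl_add_two_le [Nonempty V] [Fintype E] [DecidableEq E] {C : Finset E}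
    [Fintype (Component t h C)]
    (hC : ∀ f ∉ C, ∃ q, directionMap t h D q = Pi.single f 1 ∧ ∀ e ∈ C, edgeDiff t h e q = 0) :
    Cᶜ.card + 2 ≤ 2 * Fintype.card (Component t h C) := by
  choose! q hq hqC using hC
  let π : V → Component t h C := Quot.mk _
  let v₀ : V := Classical.arbitrary V
  let T : (Component t h C → ℝ × ℝ) →ₗ[ℝ] ((Cᶜ : Finset E) → ℝ) × (ℝ × ℝ) :=
    (LinearMap.funLeft ℝ ℝ (Subtype.val) ∘ₗ directionMap t h D ∘ₗ
      LinearMap.funLeft ℝ (ℝ × ℝ) π).prod (LinearMap.proj (π v₀))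
  have hT : Function.Surjective T := by
    rintro ⟨y, c⟩
    let z : V → ℝ × ℝ := ∑ f : (Cᶜ : Finset E), y f • q f
    have hzy (e : (Cᶜ : Finset E)) : directionMap t h D z e = y e := by
      have hqf (f : (Cᶜ : Finset E)) : directionMap t h D (q f) = Pi.single f.1 1 :=
        hq f (Finset.mem_compl.1 f.2)
      simp only [z, map_sum, map_smul, Finset.sum_apply, Pi.smul_apply, hqf]
      rw [Finset.sum_eq_single e]
      · simp
      · intro f _ hfe
        rw [Pi.single_eq_of_ne (fun h => hfe (Subtype.ext h.symm)), smul_zero]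
      · simp
    have hzC (e : E) (he : e ∈ C) : z (t e) = z (h e) := by
      have : edgeDiff t h e z = 0 := by
        simp only [z, map_sum, map_smul]
        exact Finset.sum_eq_zero fun f _ => by
          rw [hqC f (Finset.mem_compl.1 f.2) e he, smul_zero]
      exact sub_eq_zero.1 this
    let g : Component t h C → ℝ × ℝ := Quot.lift z (by
      rintro _ _ ⟨e, he, rfl, rfl⟩
      exact hzC e he)
    refine ⟨fun x => g x + (c - z v₀), Prod.ext (funext fun e => ?_) ?_⟩
    · refine Eq.trans ?_ (hzy e)
      change crossForm (D e) (z (t e) + (c - z v₀) - (z (h e) + (c - z v₀))) = _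
      rw [add_sub_add_right_eq_sub]
      rfl
    · change z v₀ + (c - z v₀) = c
      abel
  have := LinearMap.finrank_le_finrank_of_surjective hT
  rw [Module.finrank_pi_fintype] at this
  simpa [Finset.card_compl, mul_comm] using this

/-- A constructive gain assignment on a tight sparse graph has a direction network without
collapsed edges. -/
theorem exists_isDirectionNetwork_edgeVec_ne_zero [Fintype V] [Fintype E] [Nonempty V]
    (hE : (Fintype.card E : ℤ) = 2 * Fintype.card V - 2)
    (hsparse : ∀ (V' : Finset V) (E' : Finset E), IsSubgraph t h V' E' → V'.Nonempty →
      (E'.card : ℤ) ≤ 2 * V'.card - 2)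
    (hm : Constructive t h m) :
    ∃ D p, IsDirectionNetwork t h m D p ∧ ∀ e, edgeVec t h m p e ≠ 0 := by
  classical
  let collapsed (p : V → ℝ × ℝ) : Finset E := {e | edgeVec t h m p e = 0}
  have hex : ∃ n, ∃ D p, IsDirectionNetwork t h m D p ∧ (collapsed p).card = n := by
    obtain ⟨D, p, hDp⟩ := exists_isDirectionNetwork m hsparse
    exact ⟨_, D, p, hDp, rfl⟩
  obtain ⟨D, p, hDp, hn⟩ := Nat.find_spec hex
  have hmin {D' p'} (hDp' : IsDirectionNetwork t h m D' p') :
      (collapsed p).card ≤ (collapsed p').card :=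
    hn ▸ Nat.find_min' hex ⟨D', p', hDp', rfl⟩
  refine ⟨D, p, hDp, ?_⟩
  by_contra! ⟨e₀, he₀⟩
  have : Fintype (Component t h (collapsed p)) := Fintype.ofFinite _
  have hdual : ∀ f ∉ collapsed p, ∃ q, directionMap t h D q = Pi.single f 1 ∧
      ∀ e ∈ collapsed p, edgeDiff t h e q = 0 := by
    intro f hf
    obtain ⟨q, hq⟩ := hDp.surjective (Pi.single f 1)
    obtain ⟨D', p', hDp', hp'⟩ := hDp.exists_rotate (by simpa [collapsed] using hf) hq
    have hsub : collapsed p' ⊆ collapsed p := fun e he => by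
      simp only [collapsed, Finset.mem_filter, Finset.mem_univ, true_and] at he ⊢
      exact (hp' e he).1
    have heq := Finset.eq_of_subset_of_card_le hsub (hmin hDp')
    refine ⟨q, hq, fun e he => ?_⟩
    rw [← heq] at he
    exact (hp' e (by simpa [collapsed] using he)).2
  have h1 := card_compl_add_two_le hdual
  have h2 := (card_add_two_mul_card_component (F := collapsed p) fun V' E' _ =>
    hsparse V' E').2 ⟨e₀, by simp [collapsed, he₀]⟩ (fun V' E' hE' hsub hV' hcard =>
      hm V' E' hsub hV' hcard (balanced_of_edgeVec_eq_zero (p := p) fun e he => by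
        simpa [collapsed] using hE' he))
  have h3 := Finset.card_add_card_compl (collapsed p)
  omega

theorem sum_crossForm_row [Fintype V] [DecidableEq V] (z : V → ℝ × ℝ) (e : E) :
    ∑ v, crossForm (row t h m p e v) (z v) =
      crossForm (edgeVec t h m p e) (edgeDiff t h e z) := by
  have hrow (v : V) : crossForm (row t h m p e v) (z v) =
      (if v = t e then crossForm (edgeVec t h m p e) (z v) else 0) -
      (if v = h e then crossForm (edgeVec t h m p e) (z v) else 0) := by
    simp only [row, edgeVec, edgeDiff_apply]
    split_ifs <;> simp_all [crossForm_apply]; ring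
  simp [hrow, Finset.sum_sub_distrib, edgeDiff_apply]

theorem IsDirectionNetwork.indep [Fintype V] [Fintype E] [DecidableEq V]
    (hDp : IsDirectionNetwork t h m D p) (hne : ∀ e, edgeVec t h m p e ≠ 0) :
    Indep t h m p := by
  classical
  rw [Indep, Fintype.linearIndependent_iff]
  intro g hg f
  obtain ⟨q, hq⟩ := hDp.surjective (Pi.single f 1)
  obtain ⟨k, hk⟩ : ∃ k : E → ℝ, ∀ e, edgeVec t h m p e = k e • D e :=
    ⟨_, fun e => (hDp.exists_eq_smul e).choose_spec⟩
  have hpair (e : E) : crossForm (edgeVec t h m p e) (edgeDiff t h e q) =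
      k e * (Pi.single f 1 : E → ℝ) e := by
    rw [← hq, directionMap_apply, hk]
    simp only [crossForm_apply, Prod.smul_fst, Prod.smul_snd, smul_eq_mul]
    ring
  have h0 : ∑ e, g e * crossForm (edgeVec t h m p e) (edgeDiff t h e q) = 0 := by
    simp_rw [← sum_crossForm_row, Finset.mul_sum]
    rw [Finset.sum_comm]
    refine Finset.sum_eq_zero fun v _ => ?_
    have h1 := congrFun hg v
    have h2 : crossForm ((∑ e, g e • row t h m p e) v) (q v) = 0 := by
      rw [h1]
      simp [crossForm_apply]
    rw [← h2, crossForm_apply]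
    simp only [Finset.sum_apply, Pi.smul_apply, Prod.fst_sum, Prod.snd_sum, Prod.smul_fst,
      Prod.smul_snd, smul_eq_mul, Finset.sum_mul, ← Finset.sum_sub_distrib, crossForm_apply]
    exact Finset.sum_congr rfl fun e _ => by ring
  have hkf : k f ≠ 0 := fun h => hne f (by rw [hk, h, zero_smul])
  simp only [hpair, Pi.single_apply] at h0
  simpa [hkf] using h0

end Directions

section Necessity

variable [Fintype V]

theorem sparse_of_indep [DecidableEq V] {t h : E → V} {m : E → ℤ × ℤ} {p : V → ℝ × ℝ}
    (hp : Indep t h m p) {V' : Finset V} {E' : Finset E} (hsub : IsSubgraph t h V' E')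
    (hV' : V'.Nonempty) : (E'.card : ℤ) ≤ 2 * V'.card - 2 := by
  have := card_le_of_support_of_sum_eq_zero (R := ℝ) hV' (fun e : E' => row t h m p e)
    (fun e v hv => by
      obtain ⟨h1, h2⟩ := hsub e e.2
      simp [row, (ne_of_mem_of_not_mem h1 hv).symm, (ne_of_mem_of_not_mem h2 hv).symm])
    (fun e => by
      have hrow (v : V) : row t h m p e v =
          (if v = t e then edgeVec t h m p e else 0) -
          (if v = h e then edgeVec t h m p e else 0) := by
        simp only [row, edgeVec, edgeDiff_apply]
        split_ifs <;> simp_all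
      simp [hrow, Finset.sum_sub_distrib])
    (hp.comp _ Subtype.val_injective)
  have hpos := hV'.card_pos
  simp only [Fintype.card_coe, Module.finrank_prod, Module.finrank_self] at this
  omega

/-- A subgraph with at least as many edges as vertices carries a nonzero integer cycle vector. -/
theorem exists_cycle [Fintype E] {t h : E → V} {V' : Finset V} {E' : Finset E}
    (hsub : IsSubgraph t h V' E') (hV' : V'.Nonempty) (hcard : V'.card ≤ E'.card) :
    ∃ c : E → ℤ, c ≠ 0 ∧ (∀ e ∉ E', c e = 0) ∧
      ∀ φ : V → ℤ, ∑ e, c e * (φ (h e) - φ (t e)) = 0 := by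
  classical
  have hdep : ¬ LinearIndependent ℤ
      (fun e : E' => (Pi.single (h e) 1 - Pi.single (t e) 1 : V → ℤ)) := by
    intro hli
    have := card_le_of_support_of_sum_eq_zero (R := ℤ) hV' _
      (fun e v hv => by
        obtain ⟨h1, h2⟩ := hsub e e.2
        simp [(ne_of_mem_of_not_mem h1 hv).symm, (ne_of_mem_of_not_mem h2 hv).symm])
      (fun e => by simp [Finset.sum_sub_distrib]) hli
    have hpos := hV'.card_pos
    simp only [Fintype.card_coe, Module.finrank_self] at this
    omega
  obtain ⟨g, hg, e₁, he₁⟩ := Fintype.not_linearIndependent_iff.1 hdep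
  refine ⟨fun e => if he : e ∈ E' then g ⟨e, he⟩ else 0, ?_, fun e he => by simp [he], fun φ => ?_⟩
  · exact Function.ne_iff.2 ⟨e₁, by simpa using he₁⟩
  · rw [← Finset.sum_subset (Finset.subset_univ E') (fun e _ he => by simp [he]),
      ← Finset.sum_coe_sort]
    have h1 : ∑ v, (∑ e : E', g e • (Pi.single (h e) 1 - Pi.single (t e) 1 : V → ℤ)) v * φ v
        = 0 := by
      rw [hg]
      simp
    rw [← h1]
    simp only [Finset.sum_apply, Finset.sum_mul]
    rw [Finset.sum_comm]
    refine Finset.sum_congr rfl fun e _ => ?_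
    simp [Pi.single_apply, sub_mul, mul_sub, Finset.sum_sub_distrib]

theorem exists_constructive [Fintype E] (t h : E → V) : ∃ m : E → ℤ × ℤ, Constructive t h m := by
  classical
  let S : Finset (Finset E) := {E' | ∃ V' : Finset V, IsSubgraph t h V' E' ∧ V'.Nonempty ∧
    V'.card ≤ E'.card}
  have hcycle (E' : Finset E) : ∃ c : E → ℤ, E' ∈ S → c ≠ 0 ∧ (∀ e ∉ E', c e = 0) ∧
      ∀ φ : V → ℤ, ∑ e, c e * (φ (h e) - φ (t e)) = 0 := by
    by_cases hE' : E' ∈ S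
    · obtain ⟨V', h1, h2, h3⟩ := (Finset.mem_filter.1 hE').2
      obtain ⟨c, hc⟩ := exists_cycle h1 h2 h3
      exact ⟨c, fun _ => hc⟩
    · exact ⟨0, fun h => absurd h hE'⟩
  choose c hc using hcycle
  obtain ⟨x, hx⟩ := exists_forall_sum_mul_ne_zero S c fun E' hE' => (hc E' hE').1
  refine ⟨fun e => (x e, 0), fun V' E' hsub hV' hcard ⟨φ, hφ⟩ => ?_⟩
  have hE' : E' ∈ S := Finset.mem_filter.2 ⟨Finset.mem_univ _, V', hsub,
    Finset.card_pos.1 (by omega), by omega⟩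
  refine hx E' hE' ?_
  rw [← (hc E' hE').2.2 fun v => (φ v).1]
  refine Finset.sum_congr rfl fun e _ => ?_
  by_cases he : e ∈ E'
  · simpa using congrArg (fun y => c E' e * y.1) (hφ e he)
  · simp [(hc E' hE').2.1 e he]

end Necessity

/-- **Main theorem (combinatorial characterization).**
For a finite multigraph `G = (V, E, t, h)` with `V` nonempty and `|E| = 2 |V| - 2`,
the following are equivalent: (i) every subgraph with nonempty vertex set satisfies
`|E'| ≤ 2 |V'| - 2`; (ii) for every constructive gain assignment `m` there is a realization
making the edges independent; (iii) for some gain assignment `m` and some realization `p`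
the edges are independent. -/
theorem main_characterization {V E : Type*} [Fintype V] [Fintype E] [DecidableEq V]
    (t h : E → V)
    (hV : Nonempty V)
    (hE : (Fintype.card E : ℤ) = 2 * Fintype.card V - 2) :
    List.TFAE
      [ (∀ (V' : Finset V) (E' : Finset E), IsSubgraph t h V' E' → V'.Nonempty →
            (E'.card : ℤ) ≤ 2 * V'.card - 2),
        (∀ m : E → ℤ × ℤ, Constructive t h m → ∃ p : V → ℝ × ℝ, Indep t h m p),
        (∃ (m : E → ℤ × ℤ) (p : V → ℝ × ℝ), Indep t h m p) ] := by
  tfae_have 1 → 2 := fun hsparse m hm => by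
    obtain ⟨D, p, hDp, hne⟩ := exists_isDirectionNetwork_edgeVec_ne_zero hE hsparse hm
    exact ⟨p, hDp.indep hne⟩
  tfae_have 2 → 3 := fun hind => by
    obtain ⟨m, hm⟩ := exists_constructive t h
    exact ⟨m, hind m hm⟩
  tfae_have 3 → 1 := fun ⟨m, p, hp⟩ V' E' hsub hV' => sparse_of_indep hp hsub hV'
  tfae_finish

end PeriodicRigidity
end

section
/- Periodic Henneberg theorem. Define two moves on gain graphs: a periodic vertex addition adds a new vertex v₀ and two new edges from v₀ to existing vertices v_{i₁}, v_{i₂} with gains m₀₁, m₀₂ ∈ ℤ², where m₀₁ ≠ m₀₂ is required whenever v_{i₁} = v_{i₂}; a periodic edge split deletes an existing edge with tail v_{i₁}, head v_{i₂} and gain m_e, and adds a new vertex v₀ together with three new edges: from v₀ to v_{i₁} with gain (0,0), from v₀ to v_{i₂} with gain m_e, and from v₀ to some existing vertex v_{i₃} ≠ v_{i₁} with a gain m₀₃ ∈ ℤ², where m₀₃ ≠ m_e is required whenever v_{i₃} = v_{i₂}. Then for a gain graph ⟨G,m⟩ with |E| = 2|V| − 2 the following are equivalent: (a) there exists a realization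 p : V → ℝ² for which the edges of (⟨G,m⟩, p) are independent; (b) some gain graph whose gain assignment is switching-equivalent to m can be obtained from the gain graph with a single vertex and no edges by a finite sequence of periodic vertex additions and periodic edge splits. -/
open Finset

namespace PeriodicHenneberg

/-- Cast an integer gain vector to a vector of `ℝ × ℝ`. -/
def zcast (z : ℤ × ℤ) : ℝ × ℝ := ((z.1 : ℝ), (z.2 : ℝ))

/-- A (finite) gain graph on vertex names and edge names drawn from `ℕ`:
a finite vertex set `VS`, a finite edge set `ES`, tail and head maps `tl`, `hd`,
and a gain map `gn` into `ℤ²`. The values of `tl`, `hd`, `gn` outside `ES` are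
irrelevant. -/
structure GG where
  VS : Finset ℕ
  ES : Finset ℕ
  tl : ℕ → ℕ
  hd : ℕ → ℕ
  gn : ℕ → ℤ × ℤ

/-- Well-formedness: endpoints of edges are vertices. -/
def GG.WF (G : GG) : Prop := ∀ e ∈ G.ES, G.tl e ∈ G.VS ∧ G.hd e ∈ G.VS

/-- The rigidity row of the edge `e` at the realization `p`. -/
def GG.row (G : GG) (p : ℕ → ℝ × ℝ) (e : ℕ) : ℕ → ℝ × ℝ := fun v =>
  if G.tl e = G.hd e then 0
  else if v = G.tl e then p (G.tl e) - p (G.hd e) - zcast (G.gn e)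
  else if v = G.hd e then -(p (G.tl e) - p (G.hd e) - zcast (G.gn e))
  else 0

/-- The edges of the framework `(G, p)` are independent. -/
def GG.Indep (G : GG) (p : ℕ → ℝ × ℝ) : Prop :=
  LinearIndependent ℝ (fun e : {x : ℕ // x ∈ G.ES} => G.row p e.1)

/-- The edge `e` of `G` is, up to reversal, an edge from `u` to `v` with gain `g`. -/
def GG.EdgeIs (G : GG) (e u v : ℕ) (g : ℤ × ℤ) : Prop :=
  (G.tl e = u ∧ G.hd e = v ∧ G.gn e = g) ∨ (G.tl e = v ∧ G.hd e = u ∧ G.gn e = -g)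

/-- Gain graphs constructible from a single vertex (with no edges) by a finite sequence of
periodic vertex additions and periodic edge splits. -/
inductive Constructible : GG → Prop
  | /-- The base case: a single vertex and no edges. -/
    single (G : GG) (v : ℕ) (hVS : G.VS = {v}) (hES : G.ES = ∅) :
      Constructible G
  | /-- Periodic vertex addition: add a new vertex `v₀` and two new edges from `v₀` to
    existing vertices `v₁`, `v₂` with gains `g₁`, `g₂`, where `g₁ ≠ g₂` whenever
    `v₁ = v₂`. -/
    vertexAdd (G G' : GG) (hG : Constructible G)
      (v₀ v₁ v₂ e₁ e₂ : ℕ) (g₁ g₂ : ℤ × ℤ)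
      (hv₀ : v₀ ∉ G.VS) (hv₁ : v₁ ∈ G.VS) (hv₂ : v₂ ∈ G.VS)
      (he₁ : e₁ ∉ G.ES) (he₂ : e₂ ∉ G.ES) (hee : e₁ ≠ e₂)
      (hgain : v₁ = v₂ → g₁ ≠ g₂)
      (hVS : G'.VS = insert v₀ G.VS)
      (hES : G'.ES = insert e₁ (insert e₂ G.ES))
      (hold : ∀ e ∈ G.ES, G'.tl e = G.tl e ∧ G'.hd e = G.hd e ∧ G'.gn e = G.gn e)
      (hnew₁ : G'.EdgeIs e₁ v₀ v₁ g₁) (hnew₂ : G'.EdgeIs e₂ v₀ v₂ g₂) :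
      Constructible G'
  | /-- Periodic edge split: delete an existing edge which is (up to reversal) an edge
    from `v₁` to `v₂` with gain `me`, add a new vertex `v₀` and three new edges: from
    `v₀` to `v₁` with gain `(0,0)`, from `v₀` to `v₂` with gain `me`, and from `v₀` to an
    existing vertex `v₃ ≠ v₁` with a gain `g₃`, where `g₃ ≠ me` whenever `v₃ = v₂`. -/
    edgeSplit (G G' : GG) (hG : Constructible G)
      (v₀ v₁ v₂ v₃ estar e₁ e₂ e₃ : ℕ) (me g₃ : ℤ × ℤ)
      (hestar : estar ∈ G.ES) (hsplit : G.EdgeIs estar v₁ v₂ me)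
      (hv₀ : v₀ ∉ G.VS) (hv₃ : v₃ ∈ G.VS) (hv31 : v₃ ≠ v₁)
      (hgain : v₃ = v₂ → g₃ ≠ me)
      (he₁ : e₁ ∉ G.ES.erase estar) (he₂ : e₂ ∉ G.ES.erase estar)
      (he₃ : e₃ ∉ G.ES.erase estar)
      (h12 : e₁ ≠ e₂) (h13 : e₁ ≠ e₃) (h23 : e₂ ≠ e₃)
      (hVS : G'.VS = insert v₀ G.VS)
      (hES : G'.ES = insert e₁ (insert e₂ (insert e₃ (G.ES.erase estar))))
      (hold : ∀ e ∈ G.ES.erase estar,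
        G'.tl e = G.tl e ∧ G'.hd e = G.hd e ∧ G'.gn e = G.gn e)
      (hnew₁ : G'.EdgeIs e₁ v₀ v₁ (0, 0)) (hnew₂ : G'.EdgeIs e₂ v₀ v₂ me)
      (hnew₃ : G'.EdgeIs e₃ v₀ v₃ g₃) :
      Constructible G'

/-- Two-dimensional cross product. -/
def cross (a b : ℝ × ℝ) : ℝ := a.1 * b.2 - a.2 * b.1

/-- The row of a bar between `a` and `b` with direction `d`. -/
def barRow (a b : ℕ) (d : ℝ × ℝ) : ℕ → ℝ × ℝ := fun w =>
  ((if w = a then 1 else 0) - (if w = b then 1 else 0) : ℝ) • d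

lemma zcast_add (a b : ℤ × ℤ) : zcast (a + b) = zcast a + zcast b := by
  simp [zcast]

lemma zcast_neg (a : ℤ × ℤ) : zcast (-a) = -zcast a := by
  simp [zcast]

lemma zcast_sub (a b : ℤ × ℤ) : zcast (a - b) = zcast a - zcast b := by
  simp [zcast]

lemma zcast_injective : Function.Injective zcast := by
  intro a b h
  simpa [zcast, Prod.ext_iff] using h

lemma row_eq_barRow (G : GG) (p : ℕ → ℝ × ℝ) (e : ℕ) :
    G.row p e = barRow (G.tl e) (G.hd e) (p (G.tl e) - p (G.hd e) - zcast (G.gn e)) := by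
  funext w
  unfold GG.row barRow
  split_ifs <;> simp_all

lemma barRow_swap (a b : ℕ) (d : ℝ × ℝ) : barRow b a (-d) = barRow a b d := by
  funext w
  unfold barRow
  module

lemma barRow_self (a : ℕ) (d : ℝ × ℝ) : barRow a a d = 0 := by
  funext w
  simp [barRow]

lemma barRow_zero (a b : ℕ) : barRow a b 0 = 0 := by
  funext w
  simp [barRow]

lemma GG.EdgeIs.row_eq {G : GG} {e u v : ℕ} {g : ℤ × ℤ} (h : G.EdgeIs e u v g)
    (p : ℕ → ℝ × ℝ) : G.row p e = barRow u v (p u - p v - zcast g) := by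
  rw [row_eq_barRow]
  rcases h with ⟨rfl, rfl, rfl⟩ | ⟨h1, h2, h3⟩
  · rfl
  · rw [h1, h2, h3, zcast_neg, ← barRow_swap]
    congr 1
    abel

lemma GG.EdgeIs.mem {G : GG} (hG : G.WF) {e u v : ℕ} {g : ℤ × ℤ} (h : G.EdgeIs e u v g)
    (he : e ∈ G.ES) : u ∈ G.VS ∧ v ∈ G.VS := by
  have := hG e he
  rcases h with ⟨rfl, rfl, _⟩ | ⟨rfl, rfl, _⟩
  · exact this
  · exact this.symm

lemma GG.indep_iff (G : GG) (p : ℕ → ℝ × ℝ) :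
    G.Indep p ↔ LinearIndepOn ℝ (G.row p) (G.ES : Set ℕ) := Iff.rfl

lemma apply_eq_zero_of_mem_span {f : ℕ → ℕ → ℝ × ℝ} {s : Set ℕ} {v : ℕ}
    (h : ∀ e ∈ s, f e v = 0) {z : ℕ → ℝ × ℝ} (hz : z ∈ Submodule.span ℝ (f '' s)) :
    z v = 0 := by
  have : Submodule.span ℝ (f '' s) ≤
      LinearMap.ker (LinearMap.proj v : (ℕ → ℝ × ℝ) →ₗ[ℝ] ℝ × ℝ) := by
    rw [Submodule.span_le]
    rintro _ ⟨e, he, rfl⟩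
    exact h e he
  exact this hz

lemma GG.row_apply_eq_zero {G : GG} {p : ℕ → ℝ × ℝ} {e v : ℕ} (h1 : v ≠ G.tl e)
    (h2 : v ≠ G.hd e) : G.row p e v = 0 := by
  simp [GG.row, h1, h2]

lemma GG.WF.row_apply_eq_zero {G : GG} (hG : G.WF) {p : ℕ → ℝ × ℝ} {e v : ℕ} (he : e ∈ G.ES)
    (hv : v ∉ G.VS) : G.row p e v = 0 :=
  GG.row_apply_eq_zero (fun h => hv (h ▸ (hG e he).1)) (fun h => hv (h ▸ (hG e he).2))

lemma GG.WF.sum_row {G : GG} (hG : G.WF) (p : ℕ → ℝ × ℝ) {e : ℕ} (he : e ∈ G.ES) :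
    ∑ w ∈ G.VS, G.row p e w = 0 := by
  rw [row_eq_barRow]
  simp only [barRow, ← Finset.sum_smul, Finset.sum_sub_distrib, Finset.sum_ite_eq',
    (hG e he).1, (hG e he).2, if_true, sub_self, zero_smul]

/-- A row space element is determined by its values on all vertices but one. -/
lemma GG.WF.linearIndependent_restrict_iff {G : GG} (hG : G.WF) {w₀ : ℕ} (hw : w₀ ∈ G.VS)
    (p : ℕ → ℝ × ℝ) :
    LinearIndependent ℝ (fun (e : {x // x ∈ G.ES}) (w : {x // x ∈ G.VS.erase w₀}) =>
      G.row p e w) ↔ G.Indep p := by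
  refine LinearMap.linearIndependent_iff_of_disjoint
    (v := fun e : {x // x ∈ G.ES} => G.row p e.1)
    (LinearMap.funLeft ℝ (ℝ × ℝ) (fun w : {x // x ∈ G.VS.erase w₀} => w.1)) ?_
  rw [Submodule.disjoint_def]
  intro z hz hker
  have hr : Set.range (fun e : {x // x ∈ G.ES} => G.row p e.1) = G.row p '' (G.ES : Set ℕ) := by
    ext; simp
  rw [hr] at hz
  have hz1 : ∀ w ∉ G.VS, z w = 0 := fun w hw =>
    apply_eq_zero_of_mem_span (fun e he => hG.row_apply_eq_zero he hw) hz
  have hz2 : ∀ w ∈ G.VS, w ≠ w₀ → z w = 0 := fun w h1 h2 =>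
    congrFun (LinearMap.mem_ker.1 hker) ⟨w, Finset.mem_erase.2 ⟨h2, h1⟩⟩
  have hz3 : ∑ w ∈ G.VS, z w = 0 := by
    have : Submodule.span ℝ (G.row p '' (G.ES : Set ℕ)) ≤
        LinearMap.ker (∑ w ∈ G.VS, (LinearMap.proj w : (ℕ → ℝ × ℝ) →ₗ[ℝ] ℝ × ℝ)) := by
      rw [Submodule.span_le]
      rintro _ ⟨e, he, rfl⟩
      simpa using hG.sum_row p he
    simpa using this hz
  rw [Finset.sum_eq_single_of_mem w₀ hw hz2] at hz3
  funext w
  by_cases h1 : w ∈ G.VS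
  · by_cases h2 : w = w₀
    · rw [h2, hz3]; rfl
    · exact hz2 w h1 h2
  · exact hz1 w h1

lemma GG.Indep.card_add_two_le {G : GG} (hG : G.WF) {p : ℕ → ℝ × ℝ} (h : G.Indep p)
    (hne : G.VS.Nonempty) : G.ES.card + 2 ≤ 2 * G.VS.card := by
  obtain ⟨w₀, hw⟩ := hne
  have := ((hG.linearIndependent_restrict_iff hw p).2 h).fintype_card_le_finrank
  have hc := Finset.card_erase_add_one hw
  simp only [Fintype.card_coe, Module.finrank_pi_fintype, Module.finrank_prod,
    Module.finrank_self, Finset.sum_const, Finset.card_univ, smul_eq_mul] at this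
  lia

lemma GG.Indep.isOpen {G : GG} (hG : G.WF) (hne : G.VS.Nonempty) (p : ℕ → ℝ × ℝ) (v : ℕ) :
    IsOpen {x : ℝ × ℝ | G.Indep (Function.update p v x)} := by
  obtain ⟨w₀, hw⟩ := hne
  simp_rw [← hG.linearIndependent_restrict_iff hw]
  refine isOpen_setOfPred_linearIndependent.preimage
    (f := fun (x : ℝ × ℝ) (e : {x // x ∈ G.ES}) (w : {x // x ∈ G.VS.erase w₀}) =>
      G.row (Function.update p v x) e w) ?_
  refine continuous_pi fun e => continuous_pi fun w => ?_
  have : Continuous fun x : ℝ × ℝ => Function.update p v x :=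
    continuous_const.update v continuous_id
  simp only [row_eq_barRow, barRow]
  fun_prop

/-- A vertex of an independent framework can be moved off a given line. -/
lemma GG.Indep.exists_update {G : GG} (hG : G.WF) {p : ℕ → ℝ × ℝ} (h : G.Indep p) {v : ℕ}
    (hv : v ∈ G.VS) (a : ℝ × ℝ) {w : ℝ × ℝ} (hw : w ≠ 0) :
    ∃ x, G.Indep (Function.update p v x) ∧ cross (x - a) w ≠ 0 := by
  have hpos : w.1 ^ 2 + w.2 ^ 2 ≠ 0 := by
    intro h0
    refine hw (Prod.ext ?_ ?_) <;> simp <;> nlinarith [sq_nonneg w.1, sq_nonneg w.2]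
  have hopen : IsOpen {t : ℝ | G.Indep (Function.update p v (p v + t • (w.2, -w.1)))} :=
    (GG.Indep.isOpen hG ⟨v, hv⟩ p v).preimage
      (f := fun t : ℝ => p v + t • (w.2, -w.1)) (by fun_prop)
  obtain ⟨t, ht, hne⟩ := (dense_compl_singleton
    (-cross (p v - a) w / (w.1 ^ 2 + w.2 ^ 2))).inter_open_nonempty _ hopen ⟨0, by
    rw [Set.mem_ofPred_eq, zero_smul, add_zero, Function.update_eq_self]; exact h⟩
  refine ⟨_, ht, fun h0 => hne ?_⟩
  simp only [Set.mem_singleton_iff]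
  rw [eq_div_iff hpos]
  simp only [cross, Prod.fst_sub, Prod.snd_sub, Prod.fst_add, Prod.snd_add, Prod.smul_fst,
    Prod.smul_snd, smul_eq_mul] at h0 ⊢
  linear_combination h0

lemma barRow_apply_left {a b : ℕ} (h : a ≠ b) (d : ℝ × ℝ) : barRow a b d a = d := by
  simp [barRow, h]

lemma not_mem_span_insert_of_cross_ne_zero {f : ℕ → ℕ → ℝ × ℝ} {s : Set ℕ} {v e₁ e₂ : ℕ}
    (h0 : ∀ e ∈ s, f e v = 0) (hc : cross (f e₁ v) (f e₂ v) ≠ 0) :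
    f e₁ ∉ Submodule.span ℝ (f '' insert e₂ s) := by
  rw [Set.image_insert_eq, Submodule.mem_span_insert]
  rintro ⟨a, z, hz, hf⟩
  apply hc
  have := apply_eq_zero_of_mem_span h0 hz
  rw [hf]
  simp [cross, this]
  ring

lemma linearIndepOn_insert_insert {f : ℕ → ℕ → ℝ × ℝ} {s : Set ℕ} {v e₁ e₂ : ℕ}
    (hs : LinearIndepOn ℝ f s) (h0 : ∀ e ∈ s, f e v = 0) (h1 : e₁ ∉ s) (h2 : e₂ ∉ s)
    (h12 : e₁ ≠ e₂) (hc : cross (f e₁ v) (f e₂ v) ≠ 0) :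
    LinearIndepOn ℝ f (insert e₁ (insert e₂ s)) := by
  rw [linearIndepOn_insert (by simp [h1, h12]), linearIndepOn_insert h2]
  refine ⟨⟨hs, fun h => hc ?_⟩, not_mem_span_insert_of_cross_ne_zero h0 hc⟩
  simp [cross, apply_eq_zero_of_mem_span h0 h]

lemma GG.row_congr {G G' : GG} {p p' : ℕ → ℝ × ℝ} {e : ℕ} (ht : G'.tl e = G.tl e)
    (hh : G'.hd e = G.hd e) (hg : G'.gn e = G.gn e) (hp1 : p' (G.tl e) = p (G.tl e))
    (hp2 : p' (G.hd e) = p (G.hd e)) : G'.row p' e = G.row p e := by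
  simp only [row_eq_barRow, ht, hh, hg, hp1, hp2]

lemma exists_cross_ne_zero {a b : ℝ × ℝ} (h : a ≠ b) : ∃ x, cross (x - a) (x - b) ≠ 0 := by
  refine ⟨a + ((b - a).2, -(b - a).1), fun h0 => h ?_⟩
  simp only [cross, Prod.fst_sub, Prod.snd_sub, Prod.fst_add, Prod.snd_add] at h0
  have h1 : (b.1 - a.1) ^ 2 + (b.2 - a.2) ^ 2 = 0 := by linear_combination -h0
  refine Prod.ext ?_ ?_ <;> nlinarith [sq_nonneg (b.1 - a.1), sq_nonneg (b.2 - a.2)]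

lemma GG.WF.of_eq_on {G G' : GG} (hG : G.WF) {v₀ : ℕ} {s : Finset ℕ} (hs : s ⊆ G.ES)
    (hVS : G'.VS = insert v₀ G.VS)
    (hold : ∀ e ∈ s, G'.tl e = G.tl e ∧ G'.hd e = G.hd e ∧ G'.gn e = G.gn e) :
    ∀ e ∈ s, G'.tl e ∈ G'.VS ∧ G'.hd e ∈ G'.VS := by
  intro e he
  obtain ⟨h1, h2, -⟩ := hold e he
  rw [hVS, h1, h2]
  exact ⟨Finset.mem_insert_of_mem (hG e (hs he)).1, Finset.mem_insert_of_mem (hG e (hs he)).2⟩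

lemma GG.EdgeIs.endpoints_mem {G : GG} {e u v : ℕ} {g : ℤ × ℤ} (h : G.EdgeIs e u v g)
    {S : Finset ℕ} (hu : u ∈ S) (hv : v ∈ S) : G.tl e ∈ S ∧ G.hd e ∈ S := by
  rcases h with ⟨rfl, rfl, _⟩ | ⟨rfl, rfl, _⟩ <;> exact ⟨by assumption, by assumption⟩

lemma GG.WF.row_update {G G' : GG} (hG : G.WF) {v₀ : ℕ} (hv₀ : v₀ ∉ G.VS) {e : ℕ}
    (he : e ∈ G.ES) (hold : G'.tl e = G.tl e ∧ G'.hd e = G.hd e ∧ G'.gn e = G.gn e)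
    (p : ℕ → ℝ × ℝ) (x : ℝ × ℝ) : G'.row (Function.update p v₀ x) e = G.row p e :=
  GG.row_congr hold.1 hold.2.1 hold.2.2
    (Function.update_of_ne (ne_of_mem_of_not_mem (hG e he).1 hv₀) _ _)
    (Function.update_of_ne (ne_of_mem_of_not_mem (hG e he).2 hv₀) _ _)

lemma GG.EdgeIs.row_update {G : GG} {e u v : ℕ} {g : ℤ × ℤ} (h : G.EdgeIs e u v g)
    (huv : v ≠ u) (p : ℕ → ℝ × ℝ) (x : ℝ × ℝ) :
    G.row (Function.update p u x) e = barRow u v (x - (p v + zcast g)) := by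
  rw [h.row_eq, Function.update_self, Function.update_of_ne huv, sub_sub]

/-- Vertex addition preserves independence for a suitable position of the new vertex. -/
lemma GG.Indep.vertexAdd {G G' : GG} (hwf : G.WF) {p : ℕ → ℝ × ℝ} (hp : G.Indep p)
    {v₀ v₁ v₂ e₁ e₂ : ℕ} {g₁ g₂ : ℤ × ℤ}
    (hv₀ : v₀ ∉ G.VS) (hv₁ : v₁ ∈ G.VS) (hv₂ : v₂ ∈ G.VS)
    (he₁ : e₁ ∉ G.ES) (he₂ : e₂ ∉ G.ES) (hee : e₁ ≠ e₂)
    (hgain : v₁ = v₂ → g₁ ≠ g₂)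
    (hES : G'.ES = insert e₁ (insert e₂ G.ES))
    (hold : ∀ e ∈ G.ES, G'.tl e = G.tl e ∧ G'.hd e = G.hd e ∧ G'.gn e = G.gn e)
    (hnew₁ : G'.EdgeIs e₁ v₀ v₁ g₁) (hnew₂ : G'.EdgeIs e₂ v₀ v₂ g₂) :
    ∃ p, G'.Indep p := by
  obtain ⟨p, hp, hne⟩ : ∃ p, G.Indep p ∧ p v₁ + zcast g₁ ≠ p v₂ + zcast g₂ := by
    by_cases h : v₁ = v₂
    · subst h
      exact ⟨p, hp, fun h => hgain rfl (zcast_injective (add_left_cancel h))⟩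
    · obtain ⟨x, hx, hc⟩ := hp.exists_update hwf hv₁ (p v₂ + zcast g₂ - zcast g₁)
        (w := (1, 0)) (by simp)
      refine ⟨_, hx, fun h0 => hc ?_⟩
      rw [Function.update_self, Function.update_of_ne (Ne.symm h)] at h0
      rw [← h0]
      simp [cross]
  have h1 : v₁ ≠ v₀ := ne_of_mem_of_not_mem hv₁ hv₀
  have h2 : v₂ ≠ v₀ := ne_of_mem_of_not_mem hv₂ hv₀
  obtain ⟨x, hx⟩ := exists_cross_ne_zero hne
  refine ⟨Function.update p v₀ x, ?_⟩
  have hrow : ∀ e ∈ G.ES, G'.row (Function.update p v₀ x) e = G.row p e := fun e he =>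
    hwf.row_update hv₀ he (hold e he) p x
  rw [GG.indep_iff, hES, Finset.coe_insert, Finset.coe_insert]
  refine linearIndepOn_insert_insert (v := v₀)
    (LinearIndepOn.congr hp fun e he => (hrow e he).symm) ?_ he₁ he₂ hee ?_
  · intro e he
    rw [hrow e he, hwf.row_apply_eq_zero he hv₀]
  · rwa [hnew₁.row_update h1, hnew₂.row_update h2, barRow_apply_left h1.symm,
      barRow_apply_left h2.symm]

/-- Before splitting an edge, the third neighbour can be moved off the line of the edge. -/
lemma GG.Indep.exists_not_collinear {G : GG} (hwf : G.WF) {p : ℕ → ℝ × ℝ} (hp : G.Indep p)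
    {v₁ v₂ v₃ e : ℕ} {g g₃ : ℤ × ℤ} (he : e ∈ G.ES) (hsplit : G.EdgeIs e v₁ v₂ g)
    (hv₃ : v₃ ∈ G.VS) (hv31 : v₃ ≠ v₁) (hgain : v₃ = v₂ → g₃ ≠ g) :
    ∃ p, G.Indep p ∧
      cross (p v₃ + zcast g₃ - p v₁) (p v₂ + zcast g - p v₁) ≠ 0 := by
  by_cases h : v₃ = v₂
  · subst h
    obtain ⟨x, hx, hc⟩ := hp.exists_update hwf hv₃ (p v₁ - zcast g₃) (w := zcast g₃ - zcast g)
      (sub_ne_zero.2 fun h => hgain rfl (zcast_injective h))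
    refine ⟨_, hx, fun h0 => hc ?_⟩
    rw [Function.update_self, Function.update_of_ne hv31.symm] at h0
    simp only [cross, Prod.fst_sub, Prod.snd_sub, Prod.fst_add, Prod.snd_add] at h0 ⊢
    linear_combination -h0
  · have hd : p v₂ + zcast g - p v₁ ≠ 0 := by
      intro h0
      refine LinearIndepOn.ne_zero hp he ?_
      rw [hsplit.row_eq, show p v₁ - p v₂ - zcast g = -(p v₂ + zcast g - p v₁) by abel, h0,
        neg_zero, barRow_zero]
    obtain ⟨x, hx, hc⟩ := hp.exists_update hwf hv₃ (p v₁ - zcast g₃) hd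
    refine ⟨_, hx, fun h0 => hc ?_⟩
    rw [Function.update_self, Function.update_of_ne hv31.symm,
      Function.update_of_ne (Ne.symm h)] at h0
    rwa [sub_sub_eq_add_sub]

/-- An edge split preserves independence for a suitable position of the new vertex. -/
lemma GG.Indep.edgeSplit {G G' : GG} (hwf : G.WF) {p : ℕ → ℝ × ℝ} (hp : G.Indep p)
    {v₀ v₁ v₂ v₃ estar e₁ e₂ e₃ : ℕ} {me g₃ : ℤ × ℤ}
    (hestar : estar ∈ G.ES) (hsplit : G.EdgeIs estar v₁ v₂ me)
    (hv₀ : v₀ ∉ G.VS) (hv₃ : v₃ ∈ G.VS) (hv31 : v₃ ≠ v₁)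
    (hgain : v₃ = v₂ → g₃ ≠ me)
    (he₁ : e₁ ∉ G.ES.erase estar) (he₂ : e₂ ∉ G.ES.erase estar)
    (he₃ : e₃ ∉ G.ES.erase estar)
    (h12 : e₁ ≠ e₂) (h13 : e₁ ≠ e₃) (h23 : e₂ ≠ e₃)
    (hES : G'.ES = insert e₁ (insert e₂ (insert e₃ (G.ES.erase estar))))
    (hold : ∀ e ∈ G.ES.erase estar,
      G'.tl e = G.tl e ∧ G'.hd e = G.hd e ∧ G'.gn e = G.gn e)
    (hnew₁ : G'.EdgeIs e₁ v₀ v₁ (0, 0)) (hnew₂ : G'.EdgeIs e₂ v₀ v₂ me)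
    (hnew₃ : G'.EdgeIs e₃ v₀ v₃ g₃) :
    ∃ p, G'.Indep p := by
  obtain ⟨p, hp, hc⟩ := hp.exists_not_collinear hwf hestar hsplit hv₃ hv31 hgain
  obtain ⟨hv₁, hv₂⟩ := hsplit.mem hwf hestar
  have h1 : v₁ ≠ v₀ := ne_of_mem_of_not_mem hv₁ hv₀
  have h2 : v₂ ≠ v₀ := ne_of_mem_of_not_mem hv₂ hv₀
  have h3 : v₃ ≠ v₀ := ne_of_mem_of_not_mem hv₃ hv₀
  set x : ℝ × ℝ := (1 / 2 : ℝ) • (p v₁ + (p v₂ + zcast me)) with hxdef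
  refine ⟨Function.update p v₀ x, ?_⟩
  have hz : zcast (0, 0) = 0 := by simp [zcast]
  have hrow : ∀ e ∈ G.ES.erase estar, G'.row (Function.update p v₀ x) e = G.row p e :=
    fun e he => hwf.row_update hv₀ (Finset.mem_of_mem_erase he) (hold e he) p x
  have hvan : ∀ e ∈ G.ES.erase estar, G'.row (Function.update p v₀ x) e v₀ = 0 :=
    fun e he => by rw [hrow e he, hwf.row_apply_eq_zero (Finset.mem_of_mem_erase he) hv₀]
  have hr₁ := hnew₁.row_update h1 p x
  have hr₂ := hnew₂.row_update h2 p x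
  have hr₃ := hnew₃.row_update h3 p x
  rw [hz, add_zero] at hr₁
  rw [GG.indep_iff, ← Finset.insert_erase hestar, Finset.coe_insert,
    linearIndepOn_insert (by simp)] at hp
  obtain ⟨hp, hnot⟩ := hp
  have himg : G'.row (Function.update p v₀ x) '' (G.ES.erase estar : Finset ℕ) =
      G.row p '' (G.ES.erase estar : Finset ℕ) := Set.image_congr fun e he => hrow e he
  rw [GG.indep_iff, hES, Finset.insert_comm e₁ e₂, Finset.coe_insert, Finset.coe_insert,
    Finset.coe_insert]
  generalize hf : G'.row (Function.update p v₀ x) = f at *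
  have hcr : cross (f e₁ v₀) (f e₃ v₀) ≠ 0 := by
    rw [hr₁, hr₃, barRow_apply_left h1.symm, barRow_apply_left h3.symm]
    intro h0
    apply hc
    simp only [cross, hxdef, Prod.fst_sub, Prod.snd_sub, Prod.fst_add, Prod.snd_add,
      Prod.smul_fst, Prod.smul_snd, smul_eq_mul] at h0 ⊢
    linear_combination 2 * h0
  have hind := linearIndepOn_insert_insert (hp.congr fun e he => (hrow e he).symm) hvan
    (by exact_mod_cast he₁) (by exact_mod_cast he₃) h13 hcr
  rw [linearIndepOn_insert (by
    simp only [Set.mem_insert_iff, Finset.mem_coe]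
    rintro (h | h | h)
    · exact h12 h.symm
    · exact h23 h
    · exact he₂ h)]
  refine ⟨hind, fun hmem => ?_⟩
  rw [Set.image_insert_eq, Set.image_insert_eq, Submodule.mem_span_insert] at hmem
  obtain ⟨a, z, hz, hfz⟩ := hmem
  rw [Submodule.mem_span_insert] at hz
  obtain ⟨b, y, hy, rfl⟩ := hz
  have hy0 := apply_eq_zero_of_mem_span hvan hy
  have hsum : f e₁ + f e₂ = (1 / 2 : ℝ) • G.row p estar := by
    rw [hr₁, hr₂, hsplit.row_eq, hxdef]
    funext w
    simp only [barRow, Pi.add_apply, Pi.smul_apply]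
    module
  have hzero : f e₁ v₀ + f e₂ v₀ = 0 := by
    rw [← Pi.add_apply, hsum, Pi.smul_apply, hwf.row_apply_eq_zero hestar hv₀, smul_zero]
  have hlin : (1 + a) • f e₁ v₀ + b • f e₃ v₀ = 0 := by
    rw [hfz] at hzero
    simp only [Pi.add_apply, Pi.smul_apply, hy0, add_zero] at hzero
    rw [← hzero]
    module
  have e1 := congrArg Prod.fst hlin
  have e2 := congrArg Prod.snd hlin
  simp only [Prod.fst_add, Prod.snd_add, Prod.smul_fst, Prod.smul_snd, smul_eq_mul, Prod.fst_zero,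
    Prod.snd_zero] at e1 e2
  have ha : 1 + a = 0 := by
    refine (mul_eq_zero.1 (?_ : (1 + a) * cross (f e₁ v₀) (f e₃ v₀) = 0)).resolve_right hcr
    simp only [cross]
    linear_combination (f e₃ v₀).2 * e1 - (f e₃ v₀).1 * e2
  have hb : b = 0 := by
    refine (mul_eq_zero.1 (?_ : b * cross (f e₁ v₀) (f e₃ v₀) = 0)).resolve_right hcr
    simp only [cross]
    linear_combination (f e₁ v₀).1 * e2 - (f e₁ v₀).2 * e1
  apply hnot
  have : G.row p estar = (2 : ℝ) • y := by
    have : y = (1 / 2 : ℝ) • G.row p estar := by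
      rw [← hsum, hfz, hb, show a = -1 by linarith]
      module
    rw [this]
    module
  rw [this, ← himg]
  exact Submodule.smul_mem _ _ hy

lemma Constructible.wf_and_indep {G : GG} (hG : Constructible G) :
    G.WF ∧ ∃ p, G.Indep p := by
  induction hG with
  | single G v hVS hES =>
    refine ⟨fun e he => by simp [hES] at he, 0, ?_⟩
    rw [GG.indep_iff, hES, Finset.coe_empty]
    exact linearIndepOn_empty ..
  | vertexAdd G G' _ v₀ v₁ v₂ e₁ e₂ g₁ g₂ hv₀ hv₁ hv₂ he₁ he₂ hee hgain hVS hES hold hnew₁ hnew₂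
      ih =>
    obtain ⟨hwf, p, hp⟩ := ih
    refine ⟨fun e he => ?_, hp.vertexAdd hwf hv₀ hv₁ hv₂ he₁ he₂ hee hgain hES hold hnew₁ hnew₂⟩
    rw [hES, Finset.mem_insert, Finset.mem_insert] at he
    rcases he with rfl | rfl | he
    · exact hnew₁.endpoints_mem (by simp [hVS]) (by simp [hVS, hv₁])
    · exact hnew₂.endpoints_mem (by simp [hVS]) (by simp [hVS, hv₂])
    · exact hwf.of_eq_on subset_rfl hVS hold e he
  | edgeSplit G G' _ v₀ v₁ v₂ v₃ estar e₁ e₂ e₃ me g₃ hestar hsplit hv₀ hv₃ hv31 hgain he₁ he₂ he₃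
      h12 h13 h23 hVS hES hold hnew₁ hnew₂ hnew₃ ih =>
    obtain ⟨hwf, p, hp⟩ := ih
    obtain ⟨hv₁, hv₂⟩ := hsplit.mem hwf hestar
    refine ⟨fun e he => ?_, hp.edgeSplit hwf hestar hsplit hv₀ hv₃ hv31 hgain he₁ he₂ he₃
      h12 h13 h23 hES hold hnew₁ hnew₂ hnew₃⟩
    rw [hES, Finset.mem_insert, Finset.mem_insert, Finset.mem_insert] at he
    rcases he with rfl | rfl | rfl | he
    · exact hnew₁.endpoints_mem (by simp [hVS]) (by simp [hVS, hv₁])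
    · exact hnew₂.endpoints_mem (by simp [hVS]) (by simp [hVS, hv₂])
    · exact hnew₃.endpoints_mem (by simp [hVS]) (by simp [hVS, hv₃])
    · exact hwf.of_eq_on (Finset.erase_subset _ _) hVS hold e he

/-- The gain graph with gains switched by `φ`. -/
def GG.switch (G : GG) (φ : ℕ → ℤ × ℤ) : GG :=
  { G with gn := fun e => G.gn e + φ (G.tl e) - φ (G.hd e) }

lemma GG.EdgeIs.switch {G : GG} {e u v : ℕ} {g : ℤ × ℤ} (h : G.EdgeIs e u v g)
    (φ : ℕ → ℤ × ℤ) : (G.switch φ).EdgeIs e u v (g + φ u - φ v) := by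
  rcases h with ⟨rfl, rfl, rfl⟩ | ⟨rfl, rfl, h⟩
  · exact Or.inl ⟨rfl, rfl, rfl⟩
  · refine Or.inr ⟨rfl, rfl, ?_⟩
    simp only [GG.switch, h]
    abel

/-- The edges at the vertex `v`. -/
def GG.inc (G : GG) (v : ℕ) : Finset ℕ := G.ES.filter fun e => G.tl e = v ∨ G.hd e = v

/-- Deletion of the vertex `v` and the edges at `v`. -/
def GG.del (G : GG) (v : ℕ) : GG :=
  { G with VS := G.VS.erase v, ES := G.ES.filter fun e => ¬(G.tl e = v ∨ G.hd e = v) }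

lemma GG.card_inc_add (G : GG) (v : ℕ) : (G.inc v).card + (G.del v).ES.card = G.ES.card :=
  Finset.card_filter_add_card_filter_not _

lemma GG.mem_ES_iff (G : GG) (v e : ℕ) : e ∈ G.ES ↔ e ∈ G.inc v ∨ e ∈ (G.del v).ES := by
  simp only [GG.inc, GG.del, Finset.mem_filter]
  tauto

lemma GG.not_mem_del_of_mem_inc {G : GG} {v e : ℕ} (h : e ∈ G.inc v) : e ∉ (G.del v).ES := by
  simp only [GG.inc, GG.del, Finset.mem_filter] at *
  tauto

lemma GG.del_subset (G : GG) (v : ℕ) : (G.del v).ES ⊆ G.ES := Finset.filter_subset _ _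

lemma GG.WF.del {G : GG} (hG : G.WF) (v : ℕ) : (G.del v).WF := by
  intro e he
  simp only [GG.del, Finset.mem_filter, not_or, Finset.mem_erase] at *
  exact ⟨⟨he.2.1, (hG e he.1).1⟩, he.2.2, (hG e he.1).2⟩

lemma GG.Indep.del {G : GG} {p : ℕ → ℝ × ℝ} (h : G.Indep p) (v : ℕ) : (G.del v).Indep p :=
  LinearIndepOn.mono h (Finset.coe_subset.2 (G.del_subset v))

lemma GG.Indep.exists_edgeIs {G : GG} (hG : G.WF) {p : ℕ → ℝ × ℝ} (h : G.Indep p) {v e : ℕ}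
    (he : e ∈ G.inc v) : ∃ u g, u ∈ G.VS ∧ u ≠ v ∧ G.EdgeIs e v u g := by
  obtain ⟨he, hv⟩ := Finset.mem_filter.1 he
  have hloop : G.tl e ≠ G.hd e := by
    intro h0
    refine LinearIndepOn.ne_zero h he ?_
    rw [row_eq_barRow, h0, barRow_self]
  rcases hv with hv | hv
  · exact ⟨G.hd e, G.gn e, (hG e he).2, fun h0 => hloop (hv.trans h0.symm),
      Or.inl ⟨hv, rfl, rfl⟩⟩
  · exact ⟨G.tl e, -G.gn e, (hG e he).1, fun h0 => hloop (h0.trans hv.symm),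
      Or.inr ⟨rfl, hv, (neg_neg _).symm⟩⟩

lemma GG.Indep.gain_ne {G : GG} {p : ℕ → ℝ × ℝ} (h : G.Indep p) {u v e₁ e₂ : ℕ} {g₁ g₂ : ℤ × ℤ}
    (h1 : e₁ ∈ G.ES) (h2 : e₂ ∈ G.ES) (hne : e₁ ≠ e₂) (hE₁ : G.EdgeIs e₁ u v g₁)
    (hE₂ : G.EdgeIs e₂ u v g₂) : g₁ ≠ g₂ := by
  rintro rfl
  exact hne (LinearIndepOn.injOn h h1 h2 (by rw [hE₁.row_eq, hE₂.row_eq]))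

/-- Some vertex of an independent framework has degree two or three. -/
lemma GG.Indep.exists_card_inc {G : GG} (hG : G.WF) {p : ℕ → ℝ × ℝ} (h : G.Indep p)
    (hV : 2 ≤ G.VS.card) (hc : G.ES.card + 2 = 2 * G.VS.card) :
    ∃ v ∈ G.VS, (G.inc v).card = 2 ∨ (G.inc v).card = 3 := by
  have hsum : ∑ v ∈ G.VS, (G.inc v).card ≤ 2 * G.ES.card := by
    have := Finset.sum_card_bipartiteAbove_eq_sum_card_bipartiteBelow
      (fun v e => G.tl e = v ∨ G.hd e = v) (s := G.VS) (t := G.ES)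
    refine this.trans_le ?_
    rw [mul_comm]
    refine Finset.sum_le_card_nsmul _ _ _ fun e _ => ?_
    refine (Finset.card_le_card (t := {G.tl e, G.hd e}) fun v hv => ?_).trans Finset.card_le_two
    rcases (Finset.mem_filter.1 hv).2 with h | h <;> simp [← h]
  obtain ⟨v, hv, hlt⟩ : ∃ v ∈ G.VS, (G.inc v).card < 4 := by
    by_contra! hge
    have := Finset.card_nsmul_le_sum _ _ _ hge
    rw [smul_eq_mul] at this
    lia
  refine ⟨v, hv, ?_⟩
  have herase : (G.del v).VS.card = G.VS.card - 1 := Finset.card_erase_of_mem hv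
  have := (h.del v).card_add_two_le (hG.del v) (Finset.card_pos.1 (by lia))
  have := G.card_inc_add v
  lia

lemma GG.exists_switch_of_card_inc_eq_two {G : GG} (hG : G.WF) {p : ℕ → ℝ × ℝ} (h : G.Indep p)
    {v : ℕ} (hv : v ∈ G.VS) (hinc : (G.inc v).card = 2) {φ : ℕ → ℤ × ℤ}
    (hφ : Constructible ((G.del v).switch φ)) : Constructible (G.switch φ) := by
  obtain ⟨e₁, e₂, hne, heq⟩ := Finset.card_eq_two.1 hinc
  have h1 : e₁ ∈ G.inc v := by simp [heq]
  have h2 : e₂ ∈ G.inc v := by simp [heq]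
  obtain ⟨v₁, g₁, hv₁, hn₁, hE₁⟩ := h.exists_edgeIs hG h1
  obtain ⟨v₂, g₂, hv₂, hn₂, hE₂⟩ := h.exists_edgeIs hG h2
  refine Constructible.vertexAdd _ _ hφ v v₁ v₂ e₁ e₂ _ _ (Finset.notMem_erase _ _)
    (Finset.mem_erase.2 ⟨hn₁, hv₁⟩) (Finset.mem_erase.2 ⟨hn₂, hv₂⟩)
    (GG.not_mem_del_of_mem_inc h1) (GG.not_mem_del_of_mem_inc h2) hne ?_
    (Finset.insert_erase hv).symm ?_ (fun _ _ => ⟨rfl, rfl, rfl⟩) (hE₁.switch φ) (hE₂.switch φ)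
  · rintro rfl heq
    exact h.gain_ne ((G.mem_ES_iff v _).2 (Or.inl h1)) ((G.mem_ES_iff v _).2 (Or.inl h2)) hne hE₁
      hE₂ (by simpa using heq)
  · ext e
    change e ∈ G.ES ↔ e ∈ insert e₁ (insert e₂ (G.del v).ES)
    rw [G.mem_ES_iff v, heq]
    simp [or_assoc]

/-- Deletion of the vertex `v₀`, followed by insertion of an edge `e` from `u` to `w`. -/
def GG.unsplit (G : GG) (v₀ e u w : ℕ) (g : ℤ × ℤ) : GG where
  VS := G.VS.erase v₀
  ES := insert e (G.del v₀).ES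
  tl := Function.update G.tl e u
  hd := Function.update G.hd e w
  gn := Function.update G.gn e g

lemma GG.unsplit_agree (G : GG) (v₀ e u w : ℕ) (g : ℤ × ℤ) {x : ℕ} (hx : x ≠ e) :
    (G.unsplit v₀ e u w g).tl x = G.tl x ∧ (G.unsplit v₀ e u w g).hd x = G.hd x ∧
      (G.unsplit v₀ e u w g).gn x = G.gn x :=
  ⟨Function.update_of_ne hx _ _, Function.update_of_ne hx _ _, Function.update_of_ne hx _ _⟩

lemma GG.unsplit_edgeIs (G : GG) (v₀ e u w : ℕ) (g : ℤ × ℤ) :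
    (G.unsplit v₀ e u w g).EdgeIs e u w g :=
  Or.inl ⟨Function.update_self .., Function.update_self .., Function.update_self ..⟩

lemma GG.WF.unsplit {G : GG} (hG : G.WF) {v₀ e u w : ℕ} {g : ℤ × ℤ} (he : e ∉ (G.del v₀).ES)
    (hu : u ∈ G.VS) (hw : w ∈ G.VS) (hu0 : u ≠ v₀) (hw0 : w ≠ v₀) :
    (G.unsplit v₀ e u w g).WF := by
  intro x hx
  rcases Finset.mem_insert.1 hx with rfl | hx
  · exact (G.unsplit_edgeIs v₀ x u w g).endpoints_mem (Finset.mem_erase.2 ⟨hu0, hu⟩)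
      (Finset.mem_erase.2 ⟨hw0, hw⟩)
  · obtain ⟨h1, h2, -⟩ := G.unsplit_agree v₀ e u w g (ne_of_mem_of_not_mem hx he)
    rw [h1, h2]
    exact hG.del v₀ x hx

lemma GG.Indep.unsplit {G : GG} {p : ℕ → ℝ × ℝ} (h : G.Indep p) {v₀ e u w : ℕ} {g : ℤ × ℤ}
    (he : e ∉ (G.del v₀).ES)
    (hnot : barRow u w (p u - p w - zcast g) ∉
      Submodule.span ℝ (G.row p '' ((G.del v₀).ES : Set ℕ))) :
    (G.unsplit v₀ e u w g).Indep p := by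
  have hrow : ∀ x ∈ ((G.del v₀).ES : Set ℕ), G.row p x = (G.unsplit v₀ e u w g).row p x := by
    intro x hx
    obtain ⟨h1, h2, h3⟩ := G.unsplit_agree v₀ e u w g (ne_of_mem_of_not_mem hx he)
    exact (GG.row_congr h1 h2 h3 rfl rfl).symm
  change LinearIndepOn ℝ _ (↑(insert e (G.del v₀).ES) : Set ℕ)
  rw [Finset.coe_insert, linearIndepOn_insert (by exact_mod_cast he)]
  refine ⟨LinearIndepOn.congr (h.del v₀) hrow, ?_⟩
  rwa [(G.unsplit_edgeIs v₀ e u w g).row_eq, ← Set.image_congr hrow]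

/-- A vertex of degree three, together with a labelling of its edges and neighbours. -/
structure GG.IsStar (G : GG) (v₀ : ℕ) (e v : Fin 3 → ℕ) (g : Fin 3 → ℤ × ℤ) : Prop where
  mem_VS : v₀ ∈ G.VS
  injective : Function.Injective e
  mem_inc_iff : ∀ x, x ∈ G.inc v₀ ↔ ∃ i, x = e i
  mem : ∀ i, v i ∈ G.VS
  ne : ∀ i, v i ≠ v₀
  edgeIs : ∀ i, G.EdgeIs (e i) v₀ (v i) (g i)

lemma GG.IsStar.mem_inc {G : GG} {v₀ : ℕ} {e v : Fin 3 → ℕ} {g : Fin 3 → ℤ × ℤ}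
    (h : G.IsStar v₀ e v g) (i : Fin 3) : e i ∈ G.inc v₀ := (h.mem_inc_iff _).2 ⟨i, rfl⟩

lemma GG.IsStar.mem_ES {G : GG} {v₀ : ℕ} {e v : Fin 3 → ℕ} {g : Fin 3 → ℤ × ℤ}
    (h : G.IsStar v₀ e v g) (i : Fin 3) : e i ∈ G.ES := (G.mem_ES_iff v₀ _).2 (Or.inl (h.mem_inc i))

lemma GG.Indep.exists_isStar {G : GG} (hG : G.WF) {p : ℕ → ℝ × ℝ} (h : G.Indep p) {v₀ : ℕ}
    (hv : v₀ ∈ G.VS) (hc : (G.inc v₀).card = 3) : ∃ e v g, G.IsStar v₀ e v g := by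
  let f := (Finset.equivFinOfCardEq hc).symm
  choose v g h1 h2 h3 using fun i : Fin 3 => h.exists_edgeIs hG (f i).2
  refine ⟨fun i => f i, v, g, hv, Subtype.val_injective.comp f.injective, fun x => ?_, h1, h2, h3⟩
  refine ⟨fun hx => ⟨f.symm ⟨x, hx⟩, by simp⟩, ?_⟩
  rintro ⟨i, rfl⟩
  exact (f i).2

lemma GG.IsStar.ES_eq {G : GG} {v₀ : ℕ} {e v : Fin 3 → ℕ} {g : Fin 3 → ℤ × ℤ}
    (h : G.IsStar v₀ e v g) {i j k : Fin 3} (hij : i ≠ j) (hik : i ≠ k) (hjk : j ≠ k) :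
    G.ES = insert (e i) (insert (e j) (insert (e k) (G.del v₀).ES)) := by
  have hall : ∀ l : Fin 3, l = i ∨ l = j ∨ l = k := by lia
  ext x
  rw [G.mem_ES_iff v₀, h.mem_inc_iff]
  simp only [Finset.mem_insert]
  constructor
  · rintro (⟨l, rfl⟩ | hx)
    · rcases hall l with rfl | rfl | rfl <;> simp
    · simp [hx]
  · rintro (rfl | rfl | rfl | hx)
    · exact Or.inl ⟨_, rfl⟩
    · exact Or.inl ⟨_, rfl⟩
    · exact Or.inl ⟨_, rfl⟩
    · exact Or.inr hx

lemma GG.IsStar.constructible {G : GG} {v₀ : ℕ} {e v : Fin 3 → ℕ} {g : Fin 3 → ℤ × ℤ}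
    (h : G.IsStar v₀ e v g) {p : ℕ → ℝ × ℝ} (hp : G.Indep p)
    {i j k : Fin 3} (hij : i ≠ j) (hik : i ≠ k) (hjk : j ≠ k) (hv : v k ≠ v i) {φ : ℕ → ℤ × ℤ}
    (hφ : Constructible ((G.unsplit v₀ (e i) (v i) (v j) (g j - g i)).switch φ)) :
    Constructible (G.switch (Function.update φ v₀ (φ (v i) - g i))) := by
  have hnot := fun l => GG.not_mem_del_of_mem_inc (h.mem_inc l)
  have herase : (insert (e i) (G.del v₀).ES).erase (e i) = (G.del v₀).ES :=
    Finset.erase_insert (hnot i)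
  have hE : ∀ l, (G.switch (Function.update φ v₀ (φ (v i) - g i))).EdgeIs (e l) v₀ (v l)
      (g l + (φ (v i) - g i) - φ (v l)) := fun l => by
    have := (h.edgeIs l).switch (Function.update φ v₀ (φ (v i) - g i))
    rwa [Function.update_self, Function.update_of_ne (h.ne l)] at this
  refine Constructible.edgeSplit _ _ hφ v₀ (v i) (v j) (v k) (e i) (e i) (e j) (e k)
    (g j + (φ (v i) - g i) - φ (v j)) (g k + (φ (v i) - g i) - φ (v k))
    (Finset.mem_insert_self _ _) ?_ (Finset.notMem_erase _ _)
    (Finset.mem_erase.2 ⟨h.ne k, h.mem k⟩) hv ?_ (Finset.notMem_erase _ _)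
    (by rw [GG.switch, GG.unsplit, herase]; exact hnot j)
    (by rw [GG.switch, GG.unsplit, herase]; exact hnot k)
    (h.injective.ne hij) (h.injective.ne hik) (h.injective.ne hjk)
    (Finset.insert_erase h.mem_VS).symm ?_ ?_ ?_ (hE j) (hE k)
  · rw [show g j + (φ (v i) - g i) - φ (v j) = g j - g i + φ (v i) - φ (v j) by abel]
    exact (G.unsplit_edgeIs v₀ (e i) (v i) (v j) (g j - g i)).switch φ
  · intro hkj heq
    refine hp.gain_ne (h.mem_ES k) (h.mem_ES j) (h.injective.ne hjk.symm) (h.edgeIs k)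
      (hkj ▸ h.edgeIs j) ?_
    rw [hkj] at heq
    simpa using heq
  · rw [GG.switch, GG.switch, GG.unsplit, herase]
    exact h.ES_eq hij hik hjk
  · intro x hx
    rw [GG.switch, GG.unsplit, herase] at hx
    obtain ⟨h1, h2, h3⟩ := G.unsplit_agree v₀ (e i) (v i) (v j) (g j - g i)
      (ne_of_mem_of_not_mem hx (hnot i))
    refine ⟨h1.symm, h2.symm, ?_⟩
    have hx' := (Finset.mem_filter.1 hx).2
    rw [not_or] at hx'
    simp only [GG.switch]
    rw [h1, h2, h3, Function.update_of_ne hx'.1, Function.update_of_ne hx'.2]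
  · convert hE i using 1
    simp

/-- If all three bars between the neighbours of a degree three vertex are spanned by the
remaining rows, then the rows are dependent. -/
lemma exists_barRow_not_mem_span {f : ℕ → ℕ → ℝ × ℝ} {s : Set ℕ} {e₁ e₂ e₃ v₀ v₁ v₂ v₃ : ℕ}
    (h1 : e₁ ∉ insert e₂ (insert e₃ s)) (h2 : e₂ ∉ insert e₃ s) (h3 : e₃ ∉ s)
    (hf : LinearIndepOn ℝ f (insert e₁ (insert e₂ (insert e₃ s)))) {x q₁ q₂ q₃ : ℝ × ℝ}
    (hf1 : f e₁ = barRow v₀ v₁ (x - q₁)) (hf2 : f e₂ = barRow v₀ v₂ (x - q₂))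
    (hf3 : f e₃ = barRow v₀ v₃ (x - q₃)) (hc : cross (q₁ - q₃) (q₂ - q₃) ≠ 0) :
    barRow v₁ v₂ (q₁ - q₂) ∉ Submodule.span ℝ (f '' s) ∨
    barRow v₁ v₃ (q₁ - q₃) ∉ Submodule.span ℝ (f '' s) ∨
    barRow v₂ v₃ (q₂ - q₃) ∉ Submodule.span ℝ (f '' s) := by
  by_contra! hall
  obtain ⟨m12, m13, m23⟩ := hall
  rw [linearIndepOn_insert h1, linearIndepOn_insert h2, linearIndepOn_insert h3] at hf
  obtain ⟨⟨⟨-, n3⟩, n2⟩, n1⟩ := hf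
  obtain ⟨a, b, c, habc, hx⟩ : ∃ a b c : ℝ, a + b + c = 1 ∧ x = a • q₁ + b • q₂ + c • q₃ := by
    refine ⟨cross (x - q₃) (q₂ - q₃) / cross (q₁ - q₃) (q₂ - q₃),
      cross (q₁ - q₃) (x - q₃) / cross (q₁ - q₃) (q₂ - q₃),
      1 - cross (x - q₃) (q₂ - q₃) / cross (q₁ - q₃) (q₂ - q₃) -
        cross (q₁ - q₃) (x - q₃) / cross (q₁ - q₃) (q₂ - q₃), by ring, ?_⟩
    refine Prod.ext ?_ ?_ <;>
    · simp only [Prod.fst_add, Prod.snd_add, Prod.smul_fst, Prod.smul_snd, smul_eq_mul]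
      field_simp
      simp only [cross, Prod.fst_sub, Prod.snd_sub]
      ring
  have key : a • f e₁ + b • f e₂ + c • f e₃ = (a * b) • barRow v₁ v₂ (q₁ - q₂) +
      (a * c) • barRow v₁ v₃ (q₁ - q₃) + (b * c) • barRow v₂ v₃ (q₂ - q₃) := by
    obtain rfl : c = 1 - a - b := by linarith
    rw [hf1, hf2, hf3, hx]
    funext w
    simp only [barRow, Pi.add_apply, Pi.smul_apply]
    module
  have hmem : a • f e₁ + b • f e₂ + c • f e₃ ∈ Submodule.span ℝ (f '' s) := by
    rw [key]
    exact add_mem (add_mem (Submodule.smul_mem _ _ m12) (Submodule.smul_mem _ _ m13))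
      (Submodule.smul_mem _ _ m23)
  have mono : ∀ {t u : Set ℕ}, t ⊆ u → Submodule.span ℝ (f '' t) ≤ Submodule.span ℝ (f '' u) :=
    fun h => Submodule.span_mono (Set.image_mono h)
  have hself : ∀ {e : ℕ} {t : Set ℕ}, e ∈ t → f e ∈ Submodule.span ℝ (f '' t) :=
    fun h => Submodule.subset_span (Set.mem_image_of_mem _ h)
  have ha : a = 0 := by
    by_contra ha
    refine n1 ((Submodule.smul_mem_iff _ ha).1 ?_)
    have := mono (u := insert e₂ (insert e₃ s))
      ((Set.subset_insert _ _).trans (Set.subset_insert _ _)) hmem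
    rw [add_assoc] at this
    exact (Submodule.add_mem_iff_left _ (add_mem (Submodule.smul_mem _ _ (hself (by simp)))
      (Submodule.smul_mem _ _ (hself (by simp))))).1 this
  rw [ha, zero_smul, zero_add] at hmem
  have hb : b = 0 := by
    by_contra hb
    refine n2 ((Submodule.smul_mem_iff _ hb).1 ?_)
    have := mono (u := insert e₃ s) (Set.subset_insert _ _) hmem
    exact (Submodule.add_mem_iff_left _ (Submodule.smul_mem _ _ (hself (by simp)))).1 this
  rw [hb, zero_smul, zero_add] at hmem
  have hc1 : c = 1 := by linarith
  rw [hc1, one_smul] at hmem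
  exact n3 hmem

/-- The neighbours of a degree three vertex are not all equal. -/
lemma GG.IsStar.exists_ne {G : GG} {v₀ : ℕ} {e v : Fin 3 → ℕ} {g : Fin 3 → ℤ × ℤ}
    (h : G.IsStar v₀ e v g) {p : ℕ → ℝ × ℝ} (hp : G.Indep p) :
    ∃ i j k : Fin 3, i ≠ j ∧ i ≠ k ∧ j ≠ k ∧ v i ≠ v j ∧ v i ≠ v k := by
  have hne : ¬ (v 0 = v 1 ∧ v 0 = v 2) := by
    rintro ⟨h1, h2⟩
    have hv : ∀ i, v i = v 0 := by
      intro i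
      fin_cases i
      · rfl
      · exact h1.symm
      · exact h2.symm
    let H : GG := { G with VS := {v₀, v 0}, ES := Finset.univ.image e }
    have hwf : H.WF := by
      intro x hx
      obtain ⟨i, -, rfl⟩ := Finset.mem_image.1 hx
      exact (h.edgeIs i).endpoints_mem (by simp [H]) (by simp [H, hv i])
    have hH : H.Indep p := by
      refine LinearIndepOn.mono hp fun x hx => ?_
      obtain ⟨i, -, rfl⟩ := Finset.mem_image.1 hx
      exact h.mem_ES i
    have h3 := hH.card_add_two_le hwf ⟨v₀, by simp [H]⟩
    have h4 : H.ES.card = 3 := by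
      rw [Finset.card_image_of_injective _ h.injective]
      simp
    have h5 : H.VS.card ≤ 2 := Finset.card_le_two
    lia
  by_cases h01 : v 0 = v 1
  · exact ⟨2, 0, 1, by decide, by decide, by decide, by lia, by lia⟩
  · by_cases h02 : v 0 = v 2
    · exact ⟨1, 0, 2, by decide, by decide, by decide, by lia, by lia⟩
    · exact ⟨0, 1, 2, by decide, by decide, by decide, h01, h02⟩

lemma GG.IsStar.exists_not_collinear {G : GG} (hG : G.WF) {v₀ : ℕ} {e v : Fin 3 → ℕ}
    {g : Fin 3 → ℤ × ℤ} (h : G.IsStar v₀ e v g) {p : ℕ → ℝ × ℝ} (hp : G.Indep p)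
    {i j k : Fin 3} (hjk : j ≠ k) (hvj : v i ≠ v j) (hvk : v i ≠ v k) :
    ∃ p, G.Indep p ∧ cross (p (v i) + zcast (g i) - (p (v k) + zcast (g k)))
      (p (v j) + zcast (g j) - (p (v k) + zcast (g k))) ≠ 0 := by
  obtain ⟨p, hp, hne⟩ : ∃ p, G.Indep p ∧
      p (v j) + zcast (g j) - (p (v k) + zcast (g k)) ≠ 0 := by
    by_cases hv : v j = v k
    · refine ⟨p, hp, fun h0 => ?_⟩
      rw [hv, add_sub_add_left_eq_sub, sub_eq_zero] at h0
      exact hp.gain_ne (h.mem_ES j) (h.mem_ES k) (h.injective.ne hjk) (h.edgeIs j)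
        (hv ▸ h.edgeIs k) (zcast_injective h0)
    · obtain ⟨x, hx, hc⟩ := hp.exists_update hG (h.mem j)
        (p (v k) + zcast (g k) - zcast (g j)) (w := (1, 0)) (by simp)
      refine ⟨_, hx, fun h0 => hc ?_⟩
      rw [Function.update_self, Function.update_of_ne (Ne.symm hv)] at h0
      rw [← sub_add, sub_add_eq_add_sub, h0]
      simp [cross]
  obtain ⟨x, hx, hc⟩ := hp.exists_update hG (h.mem i)
    (p (v k) + zcast (g k) - zcast (g i)) hne
  refine ⟨_, hx, ?_⟩
  rw [Function.update_self, Function.update_of_ne hvj.symm, Function.update_of_ne hvk.symm]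
  rwa [← sub_add, sub_add_eq_add_sub] at hc

/-- Every independent gain graph with `2 |V| - 2` edges is constructible after switching. -/
lemma GG.exists_constructible_switch (n : ℕ) : ∀ G : GG, G.WF → G.VS.card = n + 1 →
    G.ES.card = 2 * n → (∃ p, G.Indep p) → ∃ φ, Constructible (G.switch φ) := by
  induction n with
  | zero =>
    intro G _ hV hE _
    obtain ⟨v, hv⟩ := Finset.card_eq_one.1 hV
    exact ⟨0, Constructible.single _ v hv (Finset.card_eq_zero.1 hE)⟩
  | succ n ih =>
    rintro G hG hV hE ⟨p, hp⟩
    obtain ⟨v₀, hv₀, hdeg⟩ := hp.exists_card_inc hG (by lia) (by lia)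
    have hVd : (G.VS.erase v₀).card = n + 1 := by rw [Finset.card_erase_of_mem hv₀, hV]; rfl
    have hcd := G.card_inc_add v₀
    rcases hdeg with hdeg | hdeg
    · obtain ⟨φ, hφ⟩ := ih (G.del v₀) (hG.del v₀) hVd (by lia) ⟨p, hp.del v₀⟩
      exact ⟨φ, GG.exists_switch_of_card_inc_eq_two hG hp hv₀ hdeg hφ⟩
    · obtain ⟨e, v, g, hs⟩ := hp.exists_isStar hG hv₀ hdeg
      obtain ⟨i, j, k, hij, hik, hjk, hvij, hvik⟩ := hs.exists_ne hp
      obtain ⟨p, hp, hc⟩ := hs.exists_not_collinear hG hp hjk hvij hvik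
      have hnot := fun l => GG.not_mem_del_of_mem_inc (hs.mem_inc l)
      have hrow : ∀ l, G.row p (e l) = barRow v₀ (v l) (p v₀ - (p (v l) + zcast (g l))) := by
        intro l
        rw [(hs.edgeIs l).row_eq, sub_sub]
      have hstep : ∀ {a b c : Fin 3}, a ≠ b → a ≠ c → b ≠ c → v c ≠ v a →
          barRow (v a) (v b) (p (v a) + zcast (g a) - (p (v b) + zcast (g b))) ∉
            Submodule.span ℝ (G.row p '' ((G.del v₀).ES : Set ℕ)) →
          ∃ φ, Constructible (G.switch φ) := by
        intro a b c hab hac hbc hv hspan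
        obtain ⟨φ, hφ⟩ := ih (G.unsplit v₀ (e a) (v a) (v b) (g b - g a))
          (hG.unsplit (hnot a) (hs.mem a) (hs.mem b) (hs.ne a) (hs.ne b)) hVd
          (by
            change (insert (e a) (G.del v₀).ES).card = _
            rw [Finset.card_insert_of_notMem (hnot a)]
            lia)
          ⟨p, hp.unsplit (hnot a) (by
            rwa [zcast_sub, show p (v a) - p (v b) - (zcast (g b) - zcast (g a)) =
              p (v a) + zcast (g a) - (p (v b) + zcast (g b)) by abel])⟩
        exact ⟨_, hs.constructible hp hab hac hbc hv hφ⟩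
      have hp' := hp
      rw [GG.indep_iff, hs.ES_eq hij hik hjk, Finset.coe_insert, Finset.coe_insert,
        Finset.coe_insert] at hp'
      have hinj := hs.injective
      rcases exists_barRow_not_mem_span
        (by simp [hinj.eq_iff, hij, hik, hnot i]) (by simp [hinj.eq_iff, hjk, hnot j])
        (by simp [hnot k]) hp' (hrow i) (hrow j) (hrow k) hc with hspan | hspan | hspan
      · exact hstep hij hik hjk hvik.symm hspan
      · exact hstep hik hij hjk.symm hvij.symm hspan
      · exact hstep hjk hij.symm hik.symm hvij hspan

lemma GG.indep_of_switch {G G' : GG} (hES : G'.ES = G.ES)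
    (hends : ∀ e ∈ G.ES, G'.tl e = G.tl e ∧ G'.hd e = G.hd e) {φ : ℕ → ℤ × ℤ}
    (hgn : ∀ e ∈ G.ES, G'.gn e = G.gn e + φ (G.tl e) - φ (G.hd e)) {p : ℕ → ℝ × ℝ}
    (hp : G'.Indep p) : G.Indep fun v => p v - zcast (φ v) := by
  rw [GG.indep_iff, hES] at hp
  refine hp.congr fun e he => ?_
  rw [row_eq_barRow, row_eq_barRow, (hends e he).1, (hends e he).2, hgn e he, zcast_sub, zcast_add]
  congr 1
  abel

/-- **Periodic Henneberg theorem.** For a gain graph `G` with `|E| = 2 |V| - 2`, there is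
a realization making the edges independent iff some gain graph with the same underlying
directed multigraph and a switching-equivalent (T-gain equivalent) gain assignment can be
obtained from a single vertex by a finite sequence of periodic vertex additions and
periodic edge splits. -/
theorem periodic_henneberg (G : GG) (hwf : G.WF)
    (hcount : (G.ES.card : ℤ) = 2 * G.VS.card - 2) :
    (∃ p : ℕ → ℝ × ℝ, G.Indep p) ↔
      ∃ G' : GG, G'.VS = G.VS ∧ G'.ES = G.ES ∧
        (∀ e ∈ G.ES, G'.tl e = G.tl e ∧ G'.hd e = G.hd e) ∧
        (∃ φ : ℕ → ℤ × ℤ, ∀ e ∈ G.ES,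
          G'.gn e = G.gn e + φ (G.tl e) - φ (G.hd e)) ∧
        Constructible G' := by
  constructor
  · intro hp
    have hpos : 0 < G.VS.card := by lia
    obtain ⟨φ, hφ⟩ := GG.exists_constructible_switch (G.VS.card - 1) G hwf (by lia) (by lia) hp
    exact ⟨G.switch φ, rfl, rfl, fun _ _ => ⟨rfl, rfl⟩, ⟨φ, fun _ _ => rfl⟩, hφ⟩
  · rintro ⟨G', -, hES, hends, ⟨φ, hgn⟩, hG'⟩
    obtain ⟨-, p, hp⟩ := hG'.wf_and_indep
    exact ⟨_, GG.indep_of_switch hES hends hgn hp⟩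

end PeriodicHenneberg
end

section
/- Necessity of constructive gain assignments. Let ⟨G,m⟩ be a gain graph, p : V → ℝ² any realization, and (V',E') a balanced subgraph with E' nonempty and |E'| ≥ 2|V'| − 2. Then the family of rigidity rows (r_e)_{e ∈ E'} is linearly dependent over ℝ. In particular, if G contains a balanced subgraph with E' nonempty and |E'| = 2|V'| − 2, then for no realization p are the edges of (⟨G,m⟩, p) independent, i.e. ⟨G,m⟩ is infinitesimally flexible on the fixed torus for every realization. -/
open Finset

namespace PeriodicRigidity

variable {V E : Type*}

theorem row_eq_single [DecidableEq V] (t h : E → V) (m : E → ℤ × ℤ) (p : V → ℝ × ℝ) (e : E) :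
    row t h m p e = Pi.single (t e) (p (t e) - p (h e) - zcast (m e)) -
      Pi.single (h e) (p (t e) - p (h e) - zcast (m e)) := by
  funext v
  by_cases hth : t e = h e
  · simp [row, hth]
  · by_cases hvt : v = t e
    · subst hvt
      simp [row, hth]
    · by_cases hvh : v = h e
      · subst hvh
        simp [row, hth, hvt]
      · simp [row, hth, hvt, hvh]

/-- The total force and the torque about the origin of a force `x` applied at `a`. -/
def wrench (a : ℝ × ℝ) : ℝ × ℝ →ₗ[ℝ] ℝ × ℝ × ℝ where
  toFun x := (x.1, x.2, a.1 * x.2 - a.2 * x.1)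
  map_add' x y := by
    ext <;> simp only [Prod.fst_add, Prod.snd_add]
    ring
  map_smul' c x := by
    ext <;> simp only [Prod.smul_fst, Prod.smul_snd, smul_eq_mul, RingHom.id_apply]
    ring

/-- The total force and the total torque of a system of forces applied at the points `q i`. -/
noncomputable def totalWrench {ι : Type*} [Fintype ι] [DecidableEq ι] (q : ι → ℝ × ℝ) :
    (ι → ℝ × ℝ) →ₗ[ℝ] ℝ × ℝ × ℝ :=
  LinearMap.lsum ℝ (fun _ => ℝ × ℝ) ℝ fun i => wrench (q i)

theorem totalWrench_single {ι : Type*} [Fintype ι] [DecidableEq ι] (q : ι → ℝ × ℝ) (i : ι)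
    (x : ℝ × ℝ) : totalWrench q (Pi.single i x) = wrench (q i) x :=
  LinearMap.lsum_piSingle ..

theorem totalWrench_surjective {ι : Type*} [Fintype ι] [DecidableEq ι] {q : ι → ℝ × ℝ} {i j : ι}
    (hij : q i ≠ q j) : Function.Surjective (totalWrench q) := by
  rintro ⟨c₁, c₂, c₃⟩
  set a := (q i).1 - (q j).1 with ha
  set b := (q i).2 - (q j).2 with hb
  have hD : a ^ 2 + b ^ 2 ≠ 0 := fun h0 => hij <| Prod.ext
    (sub_eq_zero.1 (by nlinarith [sq_nonneg a, sq_nonneg b] : a = 0))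
    (sub_eq_zero.1 (by nlinarith [sq_nonneg a, sq_nonneg b] : b = 0))
  set s := (c₃ - ((q j).1 * c₂ - (q j).2 * c₁)) / (a ^ 2 + b ^ 2) with hs
  have hs' : s * (a ^ 2 + b ^ 2) = c₃ - ((q j).1 * c₂ - (q j).2 * c₁) := div_mul_cancel₀ _ hD
  refine ⟨Pi.single i (-s * b, s * a) + Pi.single j (c₁ + s * b, c₂ - s * a), ?_⟩
  rw [map_add, totalWrench_single, totalWrench_single]
  ext
  · simp [wrench]
  · simp [wrench]
  · simp only [wrench, LinearMap.coe_mk, AddHom.coe_mk, Prod.snd_add]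
    linear_combination hs' - s * a * ha - s * b * hb

/-- The rows of a bar framework with at least one nonzero bar, if independent, number at most
`2 n - 3`. -/
theorem card_add_three_le_of_linearIndependent {ι κ : Type*} [Fintype ι] [DecidableEq ι]
    [Fintype κ] (q : ι → ℝ × ℝ) (a b : κ → ι)
    (hli : LinearIndependent ℝ fun k =>
      (Pi.single (a k) (q (a k) - q (b k)) - Pi.single (b k) (q (a k) - q (b k)) : ι → ℝ × ℝ))
    [Nonempty κ] : Fintype.card κ + 3 ≤ 2 * Fintype.card ι := by
  obtain ⟨k⟩ := ‹Nonempty κ›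
  have hk : q (a k) ≠ q (b k) := fun hq => hli.ne_zero k (by simp [hq])
  have hker : Set.range (fun k => (Pi.single (a k) (q (a k) - q (b k)) -
      Pi.single (b k) (q (a k) - q (b k)) : ι → ℝ × ℝ)) ⊆ LinearMap.ker (totalWrench q) := by
    rintro _ ⟨k, rfl⟩
    rw [SetLike.mem_coe, LinearMap.mem_ker, map_sub, totalWrench_single, totalWrench_single]
    ext <;> simp [wrench]
    ring
  have hspan := Submodule.finrank_mono (Submodule.span_le.2 hker)
  rw [finrank_span_eq_card hli] at hspan
  have hrank := (totalWrench q).finrank_range_add_finrank_ker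
  rw [LinearMap.range_eq_top.2 (totalWrench_surjective hk), finrank_top] at hrank
  simp [Module.finrank_pi_fintype] at hrank
  omega

theorem not_linearIndependent_row_of_balanced [DecidableEq V] {t h : E → V} {m : E → ℤ × ℤ}
    (p : V → ℝ × ℝ) {V' : Finset V} {E' : Finset E} (hsub : IsSubgraph t h V' E')
    (hbal : Balanced t h m E') (hne : E'.Nonempty) (hcard : 2 * (V'.card : ℤ) - 2 ≤ E'.card) :
    ¬ LinearIndependent ℝ (fun e : {x : E // x ∈ E'} => row t h m p e.1) := by
  intro hli
  obtain ⟨φ, hφ⟩ := hbal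
  let q : V' → ℝ × ℝ := fun v => p v + zcast (φ v)
  let a : E' → V' := fun e => ⟨t e, (hsub e e.2).1⟩
  let b : E' → V' := fun e => ⟨h e, (hsub e e.2).2⟩
  let extend : (V' → ℝ × ℝ) →ₗ[ℝ] (V → ℝ × ℝ) :=
    LinearMap.pi fun v => if hv : v ∈ V' then LinearMap.proj ⟨v, hv⟩ else 0
  have hextend (i : V') (x : ℝ × ℝ) : extend (Pi.single i x) = Pi.single i.1 x := by
    funext v
    by_cases hv : v ∈ V'
    · simp [extend, hv, Pi.single_apply, Subtype.ext_iff]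
    · have hvi : v ≠ i := fun h' => hv (h' ▸ i.2)
      simp [extend, hv, hvi]
  have hrow (e : E') : row t h m p e = extend
      (Pi.single (a e) (q (a e) - q (b e)) - Pi.single (b e) (q (a e) - q (b e))) := by
    have hd : p (t e) - p (h e) - zcast (m e) = q (a e) - q (b e) := by
      ext <;> simp [q, a, b, zcast, hφ e e.2] <;> ring
    rw [map_sub, hextend, hextend, row_eq_single, hd]
  have := hne.to_subtype
  have hle := card_add_three_le_of_linearIndependent q a b
    (LinearIndependent.of_comp extend (by simpa only [hrow, Function.comp_def] using hli))
  simp only [Fintype.card_coe] at hle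
  omega

/-- **Necessity of constructive gain assignments.**
If `(V', E')` is a balanced subgraph with `E'` nonempty and `|E'| ≥ 2 |V'| - 2`, then the
rigidity rows `(r_e)_{e ∈ E'}` are linearly dependent at every realization `p`. In
particular, if `G` contains a balanced subgraph with `E'` nonempty and `|E'| = 2 |V'| - 2`,
then the edges of `(⟨G, m⟩, p)` are independent for no realization `p`. -/
theorem constructive_necessary {V E : Type*} [DecidableEq V]
    (t h : E → V) (m : E → ℤ × ℤ) :
    (∀ (p : V → ℝ × ℝ) (V' : Finset V) (E' : Finset E),
        IsSubgraph t h V' E' → Balanced t h m E' → E'.Nonempty →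
        2 * (V'.card : ℤ) - 2 ≤ E'.card →
        ¬ LinearIndependent ℝ (fun e : {x : E // x ∈ E'} => row t h m p e.1)) ∧
    ((∃ (V' : Finset V) (E' : Finset E),
        IsSubgraph t h V' E' ∧ Balanced t h m E' ∧ E'.Nonempty ∧
        (E'.card : ℤ) = 2 * V'.card - 2) →
      ∀ p : V → ℝ × ℝ, ¬ Indep t h m p) := by
  refine ⟨fun p V' E' => not_linearIndependent_row_of_balanced p, ?_⟩
  rintro ⟨V', E', hsub, hbal, hne, hcard⟩ p hli
  exact not_linearIndependent_row_of_balanced p hsub hbal hne hcard.ge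
    (hli.comp Subtype.val Subtype.val_injective)

end PeriodicRigidity
end

section
/- Periodic vertex addition preserves independence. Let ⟨G,m⟩ be a gain graph and p : V → ℝ² a realization. Let ⟨G',m'⟩ be obtained from ⟨G,m⟩ by adding a new vertex v₀ and two new edges from v₀ to vertices v_{i₁} and v_{i₂} of V (possibly v_{i₁} = v_{i₂}) with gains m₀₁ and m₀₂ respectively, and let p₀ ∈ ℝ² be such that the three points p₀, p(v_{i₁}) + m₀₁, p(v_{i₂}) + m₀₂ of ℝ² are not collinear. Extend p to p' : V ∪ {v₀} → ℝ² by p'(v₀) = p₀. Then the edges of (⟨G,m⟩, p) are independent if and only if the edges of (⟨G',m'⟩, p') are independent. -/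
open Finset

namespace PeriodicRigidity

variable {V E : Type*}

/-- Extension by zero along `some`, as a linear map. -/
def extendNone (V : Type*) : (V → ℝ × ℝ) →ₗ[ℝ] (Option V → ℝ × ℝ) :=
  LinearMap.pi fun ov => ov.elim 0 fun v => LinearMap.proj v

@[simp]
lemma extendNone_none (f : V → ℝ × ℝ) : extendNone V f none = 0 := rfl

@[simp]
lemma extendNone_some (f : V → ℝ × ℝ) (v : V) : extendNone V f (some v) = f v := rfl

lemma ker_extendNone : LinearMap.ker (extendNone V) = ⊥ :=
  LinearMap.ker_eq_bot.2 fun _ _ hfg => funext fun v => congrFun hfg (some v)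

lemma collinear_triple_of_sub_eq_smul {a b c : ℝ × ℝ} {r : ℝ} (hr : a - b = r • (a - c)) :
    Collinear ℝ ({a, b, c} : Set (ℝ × ℝ)) := by
  rw [collinear_iff_of_mem (Set.mem_insert a _)]
  refine ⟨c - a, ?_⟩
  rintro q (rfl | rfl | rfl)
  · exact ⟨0, by simp⟩
  · refine ⟨r, ?_⟩
    rw [← neg_sub a c, smul_neg, ← hr, vadd_eq_add]
    abel
  · exact ⟨1, by simp⟩

lemma linearIndependent_sub_of_not_collinear {a b c : ℝ × ℝ}
    (hcol : ¬ Collinear ℝ ({a, b, c} : Set (ℝ × ℝ))) :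
    LinearIndependent ℝ (fun i : Bool => if i then a - c else a - b) := by
  have hac : a - c ≠ 0 := sub_ne_zero.2 (ne₁₃_of_not_collinear hcol)
  have hpair : LinearIndependent ℝ ![a - c, a - b] :=
    (LinearIndependent.pair_iff' hac).2 fun r hr =>
      hcol (collinear_triple_of_sub_eq_smul hr.symm)
  rw [Fintype.linearIndependent_iff]
  intro g hg
  have h := LinearIndependent.pair_iff.1 hpair (g true) (g false) (by simpa using hg)
  exact Bool.forall_bool.2 ⟨h.2, h.1⟩

/-- **Periodic vertex addition preserves independence.**
Add a new vertex `v₀` (modelled by `none : Option V`) and two new edges from `v₀` to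
`i₁` and `i₂` (possibly equal) with gains `g₁`, `g₂`, realize `v₀` at a point `p₀` not
collinear with `p i₁ + g₁` and `p i₂ + g₂`. Then the original edges are independent iff
the edges of the new framework are independent. -/
theorem vertex_addition {V E : Type*} [DecidableEq V]
    (t h : E → V) (m : E → ℤ × ℤ) (p : V → ℝ × ℝ)
    (i₁ i₂ : V) (g₁ g₂ : ℤ × ℤ) (p₀ : ℝ × ℝ)
    (hcol : ¬ Collinear ℝ ({p₀, p i₁ + zcast g₁, p i₂ + zcast g₂} : Set (ℝ × ℝ))) :
    Indep t h m p ↔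
      Indep (E := E ⊕ Bool) (V := Option V)
        (Sum.elim (fun e => some (t e)) (fun _ : Bool => (none : Option V)))
        (Sum.elim (fun e => some (h e)) (fun b : Bool => if b then some i₂ else some i₁))
        (Sum.elim m (fun b : Bool => if b then g₂ else g₁))
        (fun ov => ov.elim p₀ p) := by
  unfold Indep
  set R := row (E := E ⊕ Bool) (V := Option V)
    (Sum.elim (fun e => some (t e)) (fun _ : Bool => (none : Option V)))
    (Sum.elim (fun e => some (h e)) (fun b : Bool => if b then some i₂ else some i₁))
    (Sum.elim m (fun b : Bool => if b then g₂ else g₁))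
    (fun ov => ov.elim p₀ p) with hR
  have hinl : R ∘ Sum.inl = extendNone V ∘ row t h m p := by
    funext e ov
    cases ov <;> simp [hR, row]
  have hinr : (LinearMap.proj none : (Option V → ℝ × ℝ) →ₗ[ℝ] ℝ × ℝ) ∘ R ∘ Sum.inr =
      fun b : Bool => if b then p₀ - (p i₂ + zcast g₂) else p₀ - (p i₁ + zcast g₁) := by
    funext b
    cases b <;> simp [hR, row, sub_sub]
  have hnew := linearIndependent_sub_of_not_collinear hcol
  rw [← hinr] at hnew
  have hspan : Submodule.span ℝ (Set.range (R ∘ Sum.inl)) ≤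
      LinearMap.ker (LinearMap.proj none : (Option V → ℝ × ℝ) →ₗ[ℝ] ℝ × ℝ) := by
    rw [Submodule.span_le, hinl]
    rintro _ ⟨e, rfl⟩
    simp
  have hdisj := ((Submodule.range_ker_disjoint hnew).mono_right hspan).symm
  rw [linearIndependent_sum, hinl, LinearMap.linearIndependent_iff _ ker_extendNone, ← hinl]
  exact ⟨fun hold => ⟨hold, hnew.of_comp, hdisj⟩, And.left⟩

end PeriodicRigidity
end

section
/- Periodic edge split preserves independence (special position form). Let ⟨G,m⟩ be a gain graph and p : V → ℝ² a realization for which the edges of (⟨G,m⟩, p) are independent. Let e* ∈ E have tail v_{i₁}, head v_{i₂} and gain m_e, set a = p(v_{i₁}) and b = p(v_{i₂}) + m_e, and assume a ≠ b. Choose 0 < s < 1 and put p₀ = (1−s)·a + s·b. Let v_{i₃} ∈ V and m₀₃ ∈ ℤ² be such that p₀ − p(v_{i₃}) − m₀₃ is not a real scalar multiple of a − b. Let ⟨G',m'⟩ be obtained from ⟨G,m⟩ by deleting e* and adding a new vertex v₀ together with three new edges: from v₀ to v_{i₁} with gain (0,0), from v₀ to v_{i₂} with gain m_e, and from v₀ to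 v_{i₃} with gain m₀₃; extend p to p' by p'(v₀) = p₀. Then the edges of (⟨G',m'⟩, p') are independent. -/
open Finset

namespace PeriodicRigidity

variable {V E : Type*}

/-- Extension of a function on `V` by `0` at the new vertex, as a linear map. -/
def extendZero (V : Type*) : (V → ℝ × ℝ) →ₗ[ℝ] (Option V → ℝ × ℝ) where
  toFun f ov := ov.elim 0 f
  map_add' f g := by ext (_ | _) <;> simp
  map_smul' c f := by ext (_ | _) <;> simp

@[simp] theorem extendZero_none (f : V → ℝ × ℝ) : extendZero V f none = 0 := rfl

@[simp] theorem extendZero_some (f : V → ℝ × ℝ) (v : V) : extendZero V f (some v) = f v := rfl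

@[simp] theorem zcast_zero : zcast (0, 0) = 0 := by simp [zcast]

/-- The row of an edge between old vertices is the extension by zero of the old row. -/
theorem row_eq_extendZero [DecidableEq V] {E' : Type*} {t h : E → V} {m : E → ℤ × ℤ}
    {p : V → ℝ × ℝ} {t' h' : E' → Option V} {m' : E' → ℤ × ℤ} {p' : Option V → ℝ × ℝ}
    {e : E} {e' : E'} (ht : t' e' = some (t e)) (hh : h' e' = some (h e)) (hm : m' e' = m e)
    (hp : ∀ v, p' (some v) = p v) :
    row t' h' m' p' e' = extendZero V (row t h m p e) := by
  funext ov
  cases ov <;> simp [row, ht, hh, hm, hp]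

/-- The row of an edge from the new vertex to an old vertex `u`. -/
theorem row_of_none_some [DecidableEq V] {t h : E → Option V} {m : E → ℤ × ℤ}
    {p : Option V → ℝ × ℝ} {e : E} {u : V} (ht : t e = none) (hh : h e = some u) :
    row t h m p e = fun ov => ov.elim (p none - p (some u) - zcast (m e))
      (Pi.single u (-(p none - p (some u) - zcast (m e)))) := by
  funext ov
  cases ov <;> simp [row, ht, hh, Pi.single_apply]

/-- An edge with distinct end points has a row supported on these two. -/
theorem row_eq_single_sub_single [DecidableEq V] {t h : E → V} {m : E → ℤ × ℤ}
    {p : V → ℝ × ℝ} {e : E} (hne : t e ≠ h e) :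
    row t h m p e = Pi.single (t e) (p (t e) - p (h e) - zcast (m e)) -
      Pi.single (h e) (p (t e) - p (h e) - zcast (m e)) := by
  funext v
  by_cases h1 : v = t e
  · subst h1; simp [row, hne]
  · by_cases h2 : v = h e
    · subst h2; simp [row, hne, hne.symm]
    · simp [row, hne, h1, h2]

/-- Splitting one member `r estar` of an independent family into three vectors, whose values at
the new coordinate satisfy only the one relation that recovers `r estar`. -/
theorem linearIndependent_split {r : E → V → ℝ × ℝ} (hr : LinearIndependent ℝ r)
    {r' : E ⊕ Bool → Option V → ℝ × ℝ} {estar : E} {s : ℝ} (hs0 : 0 < s) (hs1 : s < 1)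
    {d w : ℝ × ℝ} (hd : d ≠ 0) (hw : ∀ c : ℝ, w ≠ c • d)
    (hold : ∀ e, e ≠ estar → r' (.inl e) = extendZero V (r e))
    (htail : r' (.inl estar) none = -(s • d))
    (hhead : r' (.inr false) none = (1 - s) • d)
    (hthird : r' (.inr true) none = w)
    (hrel : ∀ v, (1 - s) • r' (.inl estar) (some v) + s • r' (.inr false) (some v) =
      ((1 - s) * s) • r estar v) :
    LinearIndependent ℝ r' := by
  classical
  rw [linearIndependent_iff]
  intro l hl
  obtain ⟨⟨l₁, l₂⟩, rfl⟩ := (Finsupp.sumFinsuppLEquivProdFinsupp ℝ).symm.surjective l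
  have hsum : Finsupp.linearCombination ℝ r'
      ((Finsupp.sumFinsuppLEquivProdFinsupp ℝ).symm (l₁, l₂)) =
      Finsupp.linearCombination ℝ (r' ∘ Sum.inl) l₁ +
        Finsupp.linearCombination ℝ (r' ∘ Sum.inr) l₂ := by
    simp [Finsupp.linearCombination_apply, Finsupp.sumFinsuppLEquivProdFinsupp,
      Finsupp.sumFinsuppAddEquivProdFinsupp, Finsupp.sumFinsuppEquivProdFinsupp,
      Finsupp.sum_sumElim]
    rfl
  have hsplit : Finsupp.linearCombination ℝ (r' ∘ Sum.inl) l₁ =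
      l₁ estar • r' (.inl estar) +
        extendZero V (Finsupp.linearCombination ℝ r (l₁.erase estar)) := by
    conv_lhs => rw [← Finsupp.single_add_erase estar l₁]
    rw [map_add, Finsupp.linearCombination_single, Finsupp.apply_linearCombination,
      Finsupp.linearCombination_apply, Finsupp.linearCombination_apply]
    congr 1
    refine Finsupp.sum_congr fun e he => ?_
    have hne : e ≠ estar := by
      rintro rfl
      simp [Finsupp.support_erase] at he
    simp [hold e hne]
  have hbool : Finsupp.linearCombination ℝ (r' ∘ Sum.inr) l₂ =
      l₂ true • r' (.inr true) + l₂ false • r' (.inr false) := by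
    rw [Finsupp.linearCombination_apply, Finsupp.sum_fintype _ _ (by simp)]
    simp
  rw [hsum, hsplit, hbool] at hl
  have hnone := congrFun hl none
  simp only [Pi.add_apply, Pi.smul_apply, extendZero_none, htail, hhead, hthird,
    Pi.zero_apply, add_zero] at hnone
  have htrue : l₂ true = 0 := by
    by_contra hne
    refine hw ((l₂ true)⁻¹ * (l₁ estar * s - l₂ false * (1 - s))) ?_
    rw [mul_smul, eq_inv_smul_iff₀ hne]
    linear_combination (norm := module) hnone
  have hbal : l₁ estar * s = l₂ false * (1 - s) := by
    rw [htrue, zero_smul, zero_add] at hnone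
    have : (l₂ false * (1 - s) - l₁ estar * s) • d = 0 := by
      rw [← hnone]; module
    linarith [(smul_eq_zero.1 this).resolve_right hd]
  have hs1' : 1 - s ≠ 0 := by linarith
  have hzero : l₁.erase estar + Finsupp.single estar (l₁ estar * s) = 0 := by
    refine linearIndependent_iff.1 hr _ ?_
    rw [map_add, Finsupp.linearCombination_single]
    funext v
    have hv := congrFun hl (some v)
    simp only [htrue, Pi.add_apply, Pi.smul_apply, extendZero_some, Pi.zero_apply, zero_smul,
      zero_add] at hv ⊢
    refine (smul_eq_zero.1 (?_ : (1 - s) • _ = (0 : ℝ × ℝ))).resolve_left hs1'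
    have hfalse : (1 - s) • l₂ false • r' (.inr false) (some v) =
        l₁ estar • s • r' (.inr false) (some v) := by
      rw [smul_smul, smul_smul, hbal, mul_comm]
    have hv' := congrArg ((1 - s) • ·) hv
    simp only [smul_add, hfalse, smul_zero] at hv'
    have hrel' := congrArg (l₁ estar • ·) (hrel v)
    simp only [smul_add] at hrel'
    rw [← hv']
    linear_combination (norm := module) -hrel'
  have hstar : l₁ estar = 0 := by
    have := DFunLike.congr_fun hzero estar
    simpa [hs0.ne'] using this
  have hfalse : l₂ false = 0 := by
    simpa [hstar, hs1'] using hbal.symm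
  have h₁ : l₁ = 0 := by
    rw [← Finsupp.single_add_erase estar l₁]
    simpa [hstar] using hzero
  have h₂ : l₂ = 0 := by
    ext b
    cases b <;> simp [hfalse, htrue]
  rw [h₁, h₂]
  exact map_zero _

/-- **Periodic edge split preserves independence (special position form).**
Starting from an independent framework, delete the edge `e⋆` (with tail `v₁ = t e⋆`, head
`v₂ = h e⋆` and gain `m e⋆`), add a new vertex `v₀` (modelled by `none : Option V`) placed
at `p₀ = (1 - s) • a + s • b` on the segment from `a = p (t e⋆)` to `b = p (h e⋆) + m e⋆`,
together with three new edges: from `v₀` to `v₁` with gain `(0,0)` (reusing the index `e⋆`),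
from `v₀` to `v₂` with gain `m e⋆`, and from `v₀` to `v₃` with gain `m₀₃`, where
`p₀ - p v₃ - m₀₃` is not a scalar multiple of `a - b`. Then the new framework is
independent. -/
theorem edge_split {V E : Type*} [DecidableEq V] [DecidableEq E]
    (t h : E → V) (m : E → ℤ × ℤ) (p : V → ℝ × ℝ)
    (hp : Indep t h m p)
    (estar : E) (s : ℝ) (hs0 : 0 < s) (hs1 : s < 1)
    (hab : p (t estar) ≠ p (h estar) + zcast (m estar))
    (v₃ : V) (m₀₃ : ℤ × ℤ)
    (hdir : ∀ c : ℝ,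
      ((1 - s) • p (t estar) + s • (p (h estar) + zcast (m estar))) - p v₃ - zcast m₀₃ ≠
        c • (p (t estar) - (p (h estar) + zcast (m estar)))) :
    Indep (E := E ⊕ Bool) (V := Option V)
      (Sum.elim (fun e => if e = estar then (none : Option V) else some (t e))
        (fun _ : Bool => (none : Option V)))
      (Sum.elim (fun e => if e = estar then some (t estar) else some (h e))
        (fun b : Bool => if b then some v₃ else some (h estar)))
      (Sum.elim (fun e => if e = estar then (0, 0) else m e)
        (fun b : Bool => if b then m₀₃ else m estar))
      (fun ov => ov.elim
        ((1 - s) • p (t estar) + s • (p (h estar) + zcast (m estar))) p) := by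
  have hne : t estar ≠ h estar := fun heq =>
    hp.ne_zero estar (by funext v; simp [row, heq])
  have hsub : p (t estar) - p (h estar) - zcast (m estar) =
      p (t estar) - (p (h estar) + zcast (m estar)) := sub_sub _ _ _
  refine linearIndependent_split hp (estar := estar) hs0 hs1 (sub_ne_zero.2 hab) hdir
    (fun e he => row_eq_extendZero (by simp [he]) (by simp [he]) (by simp [he]) fun _ => rfl)
    ?_ ?_ ?_ fun v => ?_
  · rw [row_of_none_some (u := t estar) (by simp) (by simp)]
    simp only [Option.elim, Sum.elim_inl, if_true, zcast_zero]
    module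
  · rw [row_of_none_some (u := h estar) (by simp) (by simp)]
    simp only [Option.elim, Sum.elim_inr, Bool.false_eq_true, if_false]
    module
  · rw [row_of_none_some (u := v₃) (by simp) (by simp)]
    simp only [Option.elim, Sum.elim_inr, if_true]
  · rw [row_of_none_some (u := t estar) (by simp) (by simp),
      row_of_none_some (u := h estar) (by simp) (by simp), row_eq_single_sub_single hne]
    simp only [Option.elim, Sum.elim_inl, Sum.elim_inr, if_true, Bool.false_eq_true, if_false,
      zcast_zero, Pi.sub_apply, Pi.single_apply]
    split_ifs <;> module

end PeriodicRigidity
end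

section
/- Lattice Lemma. Let G = (V,E,t,h) be a finite multigraph in which every subgraph (V',E') with V' nonempty satisfies |E'| ≤ 2|V'| − 2. Let (V₁,E₁) and (V₂,E₂) be subgraphs with V₁ ∩ V₂ nonempty, |E₁| = 2|V₁| − 2 and |E₂| = 2|V₂| − 2. Then |E₁ ∪ E₂| = 2|V₁ ∪ V₂| − 2 and |E₁ ∩ E₂| = 2|V₁ ∩ V₂| − 2. In particular, for any fixed vertex v₀ ∈ V, the set of subgraphs containing v₀ that attain the count |E'| = 2|V'| − 2 is closed under pairwise union and intersection, hence forms a lattice. -/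
open Finset

namespace PeriodicRigidity

variable {V E : Type*}

theorem IsSubgraph.union [DecidableEq V] [DecidableEq E] {t h : E → V}
    {V₁ V₂ : Finset V} {E₁ E₂ : Finset E}
    (h₁ : IsSubgraph t h V₁ E₁) (h₂ : IsSubgraph t h V₂ E₂) :
    IsSubgraph t h (V₁ ∪ V₂) (E₁ ∪ E₂) := by
  intro e he
  rcases mem_union.1 he with he | he
  · exact ⟨mem_union_left _ (h₁ e he).1, mem_union_left _ (h₁ e he).2⟩
  · exact ⟨mem_union_right _ (h₂ e he).1, mem_union_right _ (h₂ e he).2⟩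

theorem IsSubgraph.inter [DecidableEq V] [DecidableEq E] {t h : E → V}
    {V₁ V₂ : Finset V} {E₁ E₂ : Finset E}
    (h₁ : IsSubgraph t h V₁ E₁) (h₂ : IsSubgraph t h V₂ E₂) :
    IsSubgraph t h (V₁ ∩ V₂) (E₁ ∩ E₂) := by
  intro e he
  obtain ⟨he₁, he₂⟩ := mem_inter.1 he
  exact ⟨mem_inter.2 ⟨(h₁ e he₁).1, (h₂ e he₂).1⟩, mem_inter.2 ⟨(h₁ e he₁).2, (h₂ e he₂).2⟩⟩

/-- **Lattice Lemma.** In a multigraph where every subgraph with nonempty vertex set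
satisfies `|E'| ≤ 2 |V'| - 2`, if `(V₁, E₁)` and `(V₂, E₂)` are subgraphs with
`V₁ ∩ V₂` nonempty and `|E₁| = 2 |V₁| - 2`, `|E₂| = 2 |V₂| - 2`, then
`|E₁ ∪ E₂| = 2 |V₁ ∪ V₂| - 2` and `|E₁ ∩ E₂| = 2 |V₁ ∩ V₂| - 2`; moreover union and
intersection are again subgraphs, so the tight subgraphs through a fixed vertex are
closed under union and intersection (a lattice). -/
theorem lattice_lemma {V E : Type*} [DecidableEq V] [DecidableEq E]
    (t h : E → V)
    (hcount : ∀ (V' : Finset V) (E' : Finset E), IsSubgraph t h V' E' → V'.Nonempty →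
        (E'.card : ℤ) ≤ 2 * V'.card - 2)
    (V₁ V₂ : Finset V) (E₁ E₂ : Finset E)
    (h₁ : IsSubgraph t h V₁ E₁) (h₂ : IsSubgraph t h V₂ E₂)
    (hint : (V₁ ∩ V₂).Nonempty)
    (hc₁ : (E₁.card : ℤ) = 2 * V₁.card - 2)
    (hc₂ : (E₂.card : ℤ) = 2 * V₂.card - 2) :
    ((E₁ ∪ E₂).card : ℤ) = 2 * (V₁ ∪ V₂).card - 2 ∧
    ((E₁ ∩ E₂).card : ℤ) = 2 * (V₁ ∩ V₂).card - 2 ∧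
    IsSubgraph t h (V₁ ∪ V₂) (E₁ ∪ E₂) ∧
    IsSubgraph t h (V₁ ∩ V₂) (E₁ ∩ E₂) := by
  have hU := h₁.union h₂
  have hI := h₁.inter h₂
  have hcU := hcount _ _ hU (hint.mono (inter_subset_left.trans subset_union_left))
  have hcI := hcount _ _ hI hint
  have hV := card_union_add_card_inter V₁ V₂
  have hE := card_union_add_card_inter E₁ E₂
  exact ⟨by omega, by omega, hU, hI⟩

end PeriodicRigidity
end

section
/- Intersection lemma. Let ⟨G,m⟩ be a gain graph such that |E| = 2|V| − 2, every subgraph (V',E') with V' nonempty satisfies |E'| ≤ 2|V'| − 2, and m is constructive; let v₀ be a 3-valent vertex with pairwise distinct neighbours v₁, v₂, v₃ and gains m₀₁, m₀₂, m₀₃. Let i, j, k be the three elements of {1,2,3} in some order, and let (V_{ij},E_{ij}) be a balanced subgraph with v_i, v_j ∈ V_{ij}, v_k ∉ V_{ij}, v₀ ∉ V_{ij} and |E_{ij}| = 2|V_{ij}| − 3, and let (V_{ik},E_{ik}) be a balanced subgraph with v_i, v_k ∈ V_{ik}, v_j ∉ V_{ik}, v₀ ∉ V_{ik} and |E_{ik}|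 = 2|V_{ik}| − 3. Then exactly one of the following holds: (1) |V_{ij} ∩ V_{ik}| = 1 and |E_{ij} ∪ E_{ik}| = 2|V_{ij} ∪ V_{ik}| − 4; or (2) |V_{ij} ∩ V_{ik}| > 1, |E_{ij} ∪ E_{ik}| = 2|V_{ij} ∪ V_{ik}| − 3, and |E_{ij} ∩ E_{ik}| = 2|V_{ij} ∩ V_{ik}| − 3. -/
open Finset

namespace PeriodicRigidity

variable {V E : Type*}

/-- Balancedness passes to subsets of edges. -/
theorem Balanced.mono {t h : E → V} {m : E → ℤ × ℤ} {E₁ E₂ : Finset E}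
    (hb : Balanced t h m E₂) (hle : E₁ ⊆ E₂) : Balanced t h m E₁ :=
  let ⟨φ, hφ⟩ := hb
  ⟨φ, fun e he => hφ e (hle he)⟩

/-- An edge from `u` to `v`, up to reversal, has both ends in any set containing both. -/
theorem EdgeIs.ends_mem {t h : E → V} {m : E → ℤ × ℤ} {e : E} {u v : V} {g : ℤ × ℤ}
    (he : EdgeIs t h m e u v g) {W : Finset V} (hu : u ∈ W) (hv : v ∈ W) :
    t e ∈ W ∧ h e ∈ W := by
  rcases he with ⟨rfl, rfl, -⟩ | ⟨rfl, rfl, -⟩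
  · exact ⟨hu, hv⟩
  · exact ⟨hv, hu⟩

/-- A subgraph avoiding a vertex `u` contains no edge at `u`. -/
theorem EdgeIs.notMem {t h : E → V} {m : E → ℤ × ℤ} {e : E} {u v : V} {g : ℤ × ℤ}
    (he : EdgeIs t h m e u v g) {W : Finset V} {F : Finset E} (hF : IsSubgraph t h W F)
    (hu : u ∉ W) : e ∉ F := by
  intro heF
  rcases he with ⟨rfl, -, -⟩ | ⟨-, rfl, -⟩
  · exact hu (hF e heF).1
  · exact hu (hF e heF).2

/-- A subgraph containing three neighbours of `v₀`, along distinct edges, but not `v₀`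
itself satisfies a sharper edge count. -/
theorem card_le_of_three_neighbours [DecidableEq V] [DecidableEq E]
    {t h : E → V} {m : E → ℤ × ℤ}
    (hsub : ∀ (V' : Finset V) (E' : Finset E), IsSubgraph t h V' E' → V'.Nonempty →
        (E'.card : ℤ) ≤ 2 * V'.card - 2)
    {v₀ v₁ v₂ v₃ : V} {g₁ g₂ g₃ : ℤ × ℤ} {e₁ e₂ e₃ : E}
    (he12 : e₁ ≠ e₂) (he13 : e₁ ≠ e₃) (he23 : e₂ ≠ e₃)
    (hE1 : EdgeIs t h m e₁ v₀ v₁ g₁) (hE2 : EdgeIs t h m e₂ v₀ v₂ g₂)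
    (hE3 : EdgeIs t h m e₃ v₀ v₃ g₃) {W : Finset V} {F : Finset E}
    (hF : IsSubgraph t h W F) (h0 : v₀ ∉ W) (h1 : v₁ ∈ W) (h2 : v₂ ∈ W) (h3 : v₃ ∈ W) :
    (F.card : ℤ) ≤ 2 * W.card - 3 := by
  have hS : IsSubgraph t h (insert v₀ W) (insert e₁ (insert e₂ (insert e₃ F))) := by
    intro e he
    have hv₀ := mem_insert_self v₀ W
    simp only [mem_insert] at he
    rcases he with rfl | rfl | rfl | he
    · exact hE1.ends_mem hv₀ (mem_insert_of_mem h1)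
    · exact hE2.ends_mem hv₀ (mem_insert_of_mem h2)
    · exact hE3.ends_mem hv₀ (mem_insert_of_mem h3)
    · exact ⟨mem_insert_of_mem (hF e he).1, mem_insert_of_mem (hF e he).2⟩
  have hc := hsub _ _ hS (insert_nonempty _ _)
  rw [card_insert_of_notMem h0,
    card_insert_of_notMem (by simp [he12, he13, hE1.notMem hF h0]),
    card_insert_of_notMem (by simp [he23, hE2.notMem hF h0]),
    card_insert_of_notMem (hE3.notMem hF h0)] at hc
  push_cast at hc
  linarith

/-- **Intersection lemma.** In a gain graph with `|E| = 2 |V| - 2`, all subgraphs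
satisfying `|E'| ≤ 2 |V'| - 2`, and `m` constructive, let `v₀` be a 3-valent vertex with
pairwise distinct neighbours `v₁, v₂, v₃`.  For `(x, y, z)` a permutation of
`(v₁, v₂, v₃)` (playing the roles of `v_i, v_j, v_k`), let `(Vij, Eij)` be a balanced
subgraph with `x, y ∈ Vij`, `z ∉ Vij`, `v₀ ∉ Vij`, `|Eij| = 2 |Vij| - 3`, and let
`(Vik, Eik)` be a balanced subgraph with `x, z ∈ Vik`, `y ∉ Vik`, `v₀ ∉ Vik`,
`|Eik| = 2 |Vik| - 3`. Then exactly one of the two stated count alternatives holds. -/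
theorem intersection_lemma {V E : Type*} [Fintype V] [Fintype E] [DecidableEq V]
    [DecidableEq E]
    (t h : E → V) (m : E → ℤ × ℤ)
    (hE : (Fintype.card E : ℤ) = 2 * Fintype.card V - 2)
    (hsub : ∀ (V' : Finset V) (E' : Finset E), IsSubgraph t h V' E' → V'.Nonempty →
        (E'.card : ℤ) ≤ 2 * V'.card - 2)
    (hcon : Constructive t h m)
    (v₀ v₁ v₂ v₃ : V) (m₀₁ m₀₂ m₀₃ : ℤ × ℤ) (e₁ e₂ e₃ : E)
    (he12 : e₁ ≠ e₂) (he13 : e₁ ≠ e₃) (he23 : e₂ ≠ e₃)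
    (hv10 : v₁ ≠ v₀) (hv20 : v₂ ≠ v₀) (hv30 : v₃ ≠ v₀)
    (hv12 : v₁ ≠ v₂) (hv23 : v₂ ≠ v₃) (hv13 : v₁ ≠ v₃)
    (hE1 : EdgeIs t h m e₁ v₀ v₁ m₀₁)
    (hE2 : EdgeIs t h m e₂ v₀ v₂ m₀₂)
    (hE3 : EdgeIs t h m e₃ v₀ v₃ m₀₃)
    (hval : ∀ e : E, t e = v₀ ∨ h e = v₀ → e = e₁ ∨ e = e₂ ∨ e = e₃)
    (x y z : V)
    (hperm : (x = v₁ ∧ y = v₂ ∧ z = v₃) ∨ (x = v₁ ∧ y = v₃ ∧ z = v₂) ∨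
      (x = v₂ ∧ y = v₁ ∧ z = v₃) ∨ (x = v₂ ∧ y = v₃ ∧ z = v₁) ∨
      (x = v₃ ∧ y = v₁ ∧ z = v₂) ∨ (x = v₃ ∧ y = v₂ ∧ z = v₁))
    (Vij Vik : Finset V) (Eij Eik : Finset E)
    (hij : IsSubgraph t h Vij Eij) (hij_bal : Balanced t h m Eij)
    (hijx : x ∈ Vij) (hijy : y ∈ Vij) (hijz : z ∉ Vij) (hij0 : v₀ ∉ Vij)
    (hijc : (Eij.card : ℤ) = 2 * Vij.card - 3)
    (hik : IsSubgraph t h Vik Eik) (hik_bal : Balanced t h m Eik)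
    (hikx : x ∈ Vik) (hikz : z ∈ Vik) (hiky : y ∉ Vik) (hik0 : v₀ ∉ Vik)
    (hikc : (Eik.card : ℤ) = 2 * Vik.card - 3) :
    Xor'
      ((Vij ∩ Vik).card = 1 ∧
        ((Eij ∪ Eik).card : ℤ) = 2 * (Vij ∪ Vik).card - 4)
      (1 < (Vij ∩ Vik).card ∧
        ((Eij ∪ Eik).card : ℤ) = 2 * (Vij ∪ Vik).card - 3 ∧
        ((Eij ∩ Eik).card : ℤ) = 2 * (Vij ∩ Vik).card - 3) := by
  have hI := hij.inter hik
  have hne : (Vij ∩ Vik).Nonempty := ⟨x, mem_inter.2 ⟨hijx, hikx⟩⟩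
  have hpos := hne.card_pos
  have hVc := card_union_add_card_inter Vij Vik
  have hEc := card_union_add_card_inter Eij Eik
  have hIc := hsub _ _ hI hne
  have hIc' : 2 ≤ (Vij ∩ Vik).card →
      ((Eij ∩ Eik).card : ℤ) ≠ 2 * (Vij ∩ Vik).card - 2 := fun h2 heq =>
    hcon _ _ hI h2 heq (hij_bal.mono inter_subset_left)
  have hx : x ∈ Vij ∪ Vik := mem_union_left _ hijx
  have hy : y ∈ Vij ∪ Vik := mem_union_left _ hijy
  have hz : z ∈ Vij ∪ Vik := mem_union_right _ hikz
  have hv : v₁ ∈ Vij ∪ Vik ∧ v₂ ∈ Vij ∪ Vik ∧ v₃ ∈ Vij ∪ Vik := by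
    rcases hperm with ⟨rfl, rfl, rfl⟩ | ⟨rfl, rfl, rfl⟩ | ⟨rfl, rfl, rfl⟩ |
      ⟨rfl, rfl, rfl⟩ | ⟨rfl, rfl, rfl⟩ | ⟨rfl, rfl, rfl⟩ <;>
    exact ⟨by assumption, by assumption, by assumption⟩
  have hUc := card_le_of_three_neighbours hsub he12 he13 he23 hE1 hE2 hE3 (hij.union hik)
    (by simp [hij0, hik0]) hv.1 hv.2.1 hv.2.2
  rcases Nat.lt_or_ge 1 (Vij ∩ Vik).card with h1 | h1
  · have := hIc' h1
    exact Or.inr ⟨⟨h1, by omega, by omega⟩, by omega⟩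
  · exact Or.inl ⟨⟨by omega, by omega⟩, by omega⟩

end PeriodicRigidity
end

section
/- Connectivity of the intersection. Let ⟨G,m⟩ be a gain graph such that |E| = 2|V| − 2, every subgraph (V',E') with V' nonempty satisfies |E'| ≤ 2|V'| − 2, and m is constructive; let v₀ be a 3-valent vertex with pairwise distinct neighbours v₁, v₂, v₃ and gains m₀₁, m₀₂, m₀₃. Let i, j, k be the three elements of {1,2,3} in some order, let (V_{ij},E_{ij}) be a balanced subgraph with v_i, v_j ∈ V_{ij}, v_k ∉ V_{ij}, v₀ ∉ V_{ij} and |E_{ij}| = 2|V_{ij}| − 3, and let (V_{ik},E_{ik}) be a balanced subgraph with v_i, v_k ∈ V_{ik}, v_j ∉ V_{ik}, v₀ ∉ V_{ik} and |E_{ik}| = 2|V_{ik}| − 3. Then the graph (V_{ij} ∩ V_{ik}, E_{ij} ∩ E_{ik}) is connected. -/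
open Finset

namespace PeriodicRigidity

variable {V E : Type*}

/-- `(V', E')` is connected: any two of its vertices are joined by a walk using edges of
`E'` and vertices of `V'`. -/
def Conn (t h : E → V) (V' : Finset V) (E' : Finset E) : Prop :=
  ∀ u ∈ V', ∀ w ∈ V', ∃ (n : ℕ) (f : ℕ → V),
    f 0 = u ∧ f n = w ∧ (∀ l ≤ n, f l ∈ V') ∧
    ∀ l < n, ∃ e ∈ E', (t e = f l ∧ h e = f (l + 1)) ∨ (t e = f (l + 1) ∧ h e = f l)

/-- A chain of related elements can be indexed by an initial segment of the naturals. -/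
lemma exists_seq_of_reflTransGen {α : Type*} {r : α → α → Prop} {a b : α}
    (hab : Relation.ReflTransGen r a b) :
    ∃ (n : ℕ) (f : ℕ → α), f 0 = a ∧ f n = b ∧ ∀ l < n, r (f l) (f (l + 1)) := by
  induction hab using Relation.ReflTransGen.head_induction_on with
  | refl => exact ⟨0, fun _ => b, rfl, rfl, by simp⟩
  | @head a c hac _ ih =>
    obtain ⟨n, f, h0, hn, hf⟩ := ih
    refine ⟨n + 1, fun l => Nat.casesOn l a f, rfl, hn, fun l hl => ?_⟩
    cases l with
    | zero => simpa [h0] using hac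
    | succ l => exact hf l (by omega)

/-- In a gain graph whose nonempty subgraphs satisfy `|E'| ≤ 2 |V'| - 2`, a subgraph with at
least `2 |V'| - 3` edges is connected. -/
lemma conn_of_two_mul_sub_three_le {V E : Type*} {t h : E → V}
    (hsub : ∀ (V' : Finset V) (E' : Finset E), IsSubgraph t h V' E' → V'.Nonempty →
        (E'.card : ℤ) ≤ 2 * V'.card - 2)
    {V' : Finset V} {E' : Finset E} (hVE : IsSubgraph t h V' E')
    (hcard : 2 * (V'.card : ℤ) - 3 ≤ E'.card) : Conn t h V' E' := by
  classical
  intro u hu w hw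
  let r : V → V → Prop := fun a b =>
    b ∈ V' ∧ ∃ e ∈ E', (t e = a ∧ h e = b) ∨ (t e = b ∧ h e = a)
  by_cases huw : Relation.ReflTransGen r u w
  · obtain ⟨n, f, h0, hn, hf⟩ := exists_seq_of_reflTransGen huw
    refine ⟨n, f, h0, hn, fun l hl => ?_, fun l hl => (hf l hl).2⟩
    cases l with
    | zero => exact h0 ▸ hu
    | succ l => exact (hf l hl).1
  · exfalso
    let p : V → Prop := Relation.ReflTransGen r u
    have hp : ∀ e ∈ E', p (t e) ↔ p (h e) := fun e he =>
      ⟨fun ht => ht.tail ⟨(hVE e he).2, e, he, Or.inl ⟨rfl, rfl⟩⟩,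
        fun hh => hh.tail ⟨(hVE e he).1, e, he, Or.inr ⟨rfl, rfl⟩⟩⟩
    have hA := hsub {v ∈ V' | p v} {e ∈ E' | p (t e)}
      (fun e he => by
        obtain ⟨he, hpe⟩ := mem_filter.1 he
        exact ⟨mem_filter.2 ⟨(hVE e he).1, hpe⟩,
          mem_filter.2 ⟨(hVE e he).2, (hp e he).1 hpe⟩⟩)
      ⟨u, mem_filter.2 ⟨hu, Relation.ReflTransGen.refl⟩⟩
    have hB := hsub {v ∈ V' | ¬ p v} {e ∈ E' | ¬ p (t e)}
      (fun e he => by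
        obtain ⟨he, hpe⟩ := mem_filter.1 he
        exact ⟨mem_filter.2 ⟨(hVE e he).1, hpe⟩,
          mem_filter.2 ⟨(hVE e he).2, fun hh => hpe ((hp e he).2 hh)⟩⟩)
      ⟨w, mem_filter.2 ⟨hw, huw⟩⟩
    have hV := card_filter_add_card_filter_not (s := V') (fun v => p v)
    have hE := card_filter_add_card_filter_not (s := E') (fun e => p (t e))
    omega

/-- **Connectivity of the intersection.** In the setting of the intersection lemma, the
intersection `(Vij ∩ Vik, Eij ∩ Eik)` of the two balanced subgraphs is connected. -/
theorem intersection_connected {V E : Type*} [Fintype V] [Fintype E] [DecidableEq V]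
    [DecidableEq E]
    (t h : E → V) (m : E → ℤ × ℤ)
    (hE : (Fintype.card E : ℤ) = 2 * Fintype.card V - 2)
    (hsub : ∀ (V' : Finset V) (E' : Finset E), IsSubgraph t h V' E' → V'.Nonempty →
        (E'.card : ℤ) ≤ 2 * V'.card - 2)
    (hcon : Constructive t h m)
    (v₀ v₁ v₂ v₃ : V) (m₀₁ m₀₂ m₀₃ : ℤ × ℤ) (e₁ e₂ e₃ : E)
    (he12 : e₁ ≠ e₂) (he13 : e₁ ≠ e₃) (he23 : e₂ ≠ e₃)
    (hv10 : v₁ ≠ v₀) (hv20 : v₂ ≠ v₀) (hv30 : v₃ ≠ v₀)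
    (hv12 : v₁ ≠ v₂) (hv23 : v₂ ≠ v₃) (hv13 : v₁ ≠ v₃)
    (hE1 : EdgeIs t h m e₁ v₀ v₁ m₀₁)
    (hE2 : EdgeIs t h m e₂ v₀ v₂ m₀₂)
    (hE3 : EdgeIs t h m e₃ v₀ v₃ m₀₃)
    (hval : ∀ e : E, t e = v₀ ∨ h e = v₀ → e = e₁ ∨ e = e₂ ∨ e = e₃)
    (x y z : V)
    (hperm : (x = v₁ ∧ y = v₂ ∧ z = v₃) ∨ (x = v₁ ∧ y = v₃ ∧ z = v₂) ∨
      (x = v₂ ∧ y = v₁ ∧ z = v₃) ∨ (x = v₂ ∧ y = v₃ ∧ z = v₁) ∨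
      (x = v₃ ∧ y = v₁ ∧ z = v₂) ∨ (x = v₃ ∧ y = v₂ ∧ z = v₁))
    (Vij Vik : Finset V) (Eij Eik : Finset E)
    (hij : IsSubgraph t h Vij Eij) (hij_bal : Balanced t h m Eij)
    (hijx : x ∈ Vij) (hijy : y ∈ Vij) (hijz : z ∉ Vij) (hij0 : v₀ ∉ Vij)
    (hijc : (Eij.card : ℤ) = 2 * Vij.card - 3)
    (hik : IsSubgraph t h Vik Eik) (hik_bal : Balanced t h m Eik)
    (hikx : x ∈ Vik) (hikz : z ∈ Vik) (hiky : y ∉ Vik) (hik0 : v₀ ∉ Vik)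
    (hikc : (Eik.card : ℤ) = 2 * Vik.card - 3) :
    Conn t h (Vij ∩ Vik) (Eij ∩ Eik) := by
  apply conn_of_two_mul_sub_three_le hsub
  · intro e he
    obtain ⟨he₁, he₂⟩ := mem_inter.1 he
    exact ⟨mem_inter.2 ⟨(hij e he₁).1, (hik e he₂).1⟩,
      mem_inter.2 ⟨(hij e he₁).2, (hik e he₂).2⟩⟩
  set W := Vij ∪ Vik with hW
  set F := Eij ∪ Eik with hF
  have hFW : IsSubgraph t h W F := by
    intro e he
    rcases mem_union.1 he with he | he
    · exact ⟨mem_union_left _ (hij e he).1, mem_union_left _ (hij e he).2⟩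
    · exact ⟨mem_union_right _ (hik e he).1, mem_union_right _ (hik e he).2⟩
  have h0W : v₀ ∉ W := by simp [hW, hij0, hik0]
  have hxW : x ∈ W := mem_union_left _ hijx
  have hyW : y ∈ W := mem_union_left _ hijy
  have hzW : z ∈ W := mem_union_right _ hikz
  have hvW : v₁ ∈ W ∧ v₂ ∈ W ∧ v₃ ∈ W := by
    rcases hperm with ⟨rfl, rfl, rfl⟩ | ⟨rfl, rfl, rfl⟩ | ⟨rfl, rfl, rfl⟩ |
      ⟨rfl, rfl, rfl⟩ | ⟨rfl, rfl, rfl⟩ | ⟨rfl, rfl, rfl⟩ <;> exact ⟨‹_›, ‹_›, ‹_›⟩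
  have hnot : ∀ {e v g}, EdgeIs t h m e v₀ v g → e ∉ F := by
    rintro e v g (⟨he, -, -⟩ | ⟨-, he, -⟩) heF
    · exact h0W (he ▸ (hFW e heF).1)
    · exact h0W (he ▸ (hFW e heF).2)
  have hmem : ∀ {e v g}, EdgeIs t h m e v₀ v g → v ∈ W →
      t e ∈ insert v₀ W ∧ h e ∈ insert v₀ W := by
    rintro e v g (⟨ht, hh, -⟩ | ⟨ht, hh, -⟩) hv <;> simp [ht, hh, hv]
  have hcard := hsub (insert v₀ W) (insert e₁ (insert e₂ (insert e₃ F)))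
    (by
      intro e he
      simp only [mem_insert] at he
      rcases he with rfl | rfl | rfl | he
      · exact hmem hE1 hvW.1
      · exact hmem hE2 hvW.2.1
      · exact hmem hE3 hvW.2.2
      · exact ⟨mem_insert_of_mem (hFW e he).1, mem_insert_of_mem (hFW e he).2⟩)
    (insert_nonempty _ _)
  rw [card_insert_of_notMem h0W,
    card_insert_of_notMem (by simp [he12, he13, hnot hE1]),
    card_insert_of_notMem (by simp [he23, hnot hE2]),
    card_insert_of_notMem (hnot hE3)] at hcard
  have hV := card_union_add_card_inter Vij Vik
  have hE' := card_union_add_card_inter Eij Eik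
  rw [← hW] at hV
  rw [← hF] at hE'
  push_cast at hcard
  omega

end PeriodicRigidity
end
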